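/- For every ε > 0 there exists a constant C ≥ 1 such that the following holds. Let K be a quartic number field ([K:ℚ] = 4) whose Galois closure L over ℚ satisfies |Gal(L/ℚ)| = 24 (so Gal(L/ℚ) ≅ S₄), let P ≤ Gal(L/ℚ) be a subgroup of order 8, and let F be the fixed field of P (the cubic resolvent of K, with [F:ℚ] = 3). Then C⁻¹·|D_K|^{−ε} ≤ |Cl(K)[2]| / |Cl(F)[2]| ≤ C·|D_K|^{ε}, where |Cl(K)[2]| is the number of elements of order dividing 2 in the ideal class group of the ring of integers of K, and D_K is the discriminant of K. -/

import Mathlib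

open NumberField

/-- `S` can be coloured with `n` colours so that elements of equal colour are `R`-related. -/
def Colorable {α : Type*} (S : Set α) (R : α → α → Prop) (n : ℕ) : Prop :=
  ∃ f : α → Fin n, ∀ a ∈ S, ∀ b ∈ S, f a = f b → R a b

namespace Colorable

variable {α β : Type*} {S : Set α} {R R' : α → α → Prop} {n m : ℕ}

theorem of_finite {T : Type*} [Finite T] (f : α → T) (hn : Nat.card T ≤ n)
    (h : ∀ a ∈ S, ∀ b ∈ S, f a = f b → R a b) : Colorable S R n := by
  classical
  refine ⟨fun a => Fin.castLE hn (Finite.equivFin T (f a)), fun a ha b hb hab => h a ha b hb ?_⟩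
  exact (Finite.equivFin T).injective (Fin.castLE_injective hn hab)

theorem mono (h : Colorable S R n) (hn : n ≤ m) : Colorable S R m := by
  obtain ⟨f, hf⟩ := h
  exact ⟨fun a => Fin.castLE hn (f a), fun a ha b hb hab =>
    hf a ha b hb (Fin.castLE_injective hn hab)⟩

theorem comap {S' : Set β} {Q : β → β → Prop} (h : Colorable S' Q n) (g : α → β)
    (hg : ∀ a ∈ S, g a ∈ S') (hR : ∀ a ∈ S, ∀ b ∈ S, Q (g a) (g b) → R a b) :
    Colorable S R n := by
  obtain ⟨f, hf⟩ := h
  exact ⟨f ∘ g, fun a ha b hb hab => hR a ha b hb (hf _ (hg a ha) _ (hg b hb) hab)⟩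

theorem trans (hm : 0 < m) (h : Colorable S R n)
    (h' : ∀ b ∈ S, Colorable {a | a ∈ S ∧ R a b} R' m) :
    Colorable S R' (n * m) := by
  classical
  obtain ⟨f, hf⟩ := h
  rcases isEmpty_or_nonempty α with hα | hα
  · exact ⟨fun a => hα.elim a, fun a => hα.elim a⟩
  let ref : Fin n → α := fun i => if h : ∃ b ∈ S, f b = i then h.choose else hα.some
  have href : ∀ a ∈ S, ref (f a) ∈ S ∧ f (ref (f a)) = f a := by
    intro a ha
    have h : ∃ b ∈ S, f b = f a := ⟨a, ha, rfl⟩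
    simp only [ref, dif_pos h]
    exact h.choose_spec
  let g : ∀ b : α, α → Fin m := fun b => if h : b ∈ S then (h' b h).choose else fun _ => ⟨0, hm⟩
  have hg : ∀ b ∈ S, ∀ a ∈ S, R a b → ∀ a' ∈ S, R a' b → g b a = g b a' → R' a a' := by
    intro b hb a ha hab a' ha' hab' hh
    simp only [g, dif_pos hb] at hh
    exact (h' b hb).choose_spec a ⟨ha, hab⟩ a' ⟨ha', hab'⟩ hh
  refine of_finite (T := Fin n × Fin m) (fun a => (f a, g (ref (f a)) a)) (by simp) ?_
  intro a ha b hb hab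
  simp only [Prod.mk.injEq] at hab
  obtain ⟨h1, h2⟩ := hab
  obtain ⟨hr, hr'⟩ := href a ha
  refine hg _ hr a ha (hf _ ha _ hr hr'.symm) b hb (hf _ hb _ hr (by rw [hr', h1])) ?_
  rw [h2, h1]

end Colorable

theorem Colorable.card_le {α : Type*} {n : ℕ}
    (h : Colorable (Set.univ : Set α) (fun a b => a = b) n) : Nat.card α ≤ n := by
  obtain ⟨f, hf⟩ := h
  have := Nat.card_le_card_of_injective f (fun a b hab => hf a trivial b trivial hab)
  simpa using this

theorem exists_pow_card_primeFactors_le (c : ℝ) (hc : 1 ≤ c) (ε : ℝ) (hε : 0 < ε) :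
    ∃ C : ℝ, 1 ≤ C ∧ ∀ N : ℕ, N ≠ 0 → c ^ N.primeFactors.card ≤ C * (N : ℝ) ^ ε := by
  obtain ⟨B, hB⟩ := exists_nat_ge (c ^ ε⁻¹)
  refine ⟨c ^ B, one_le_pow₀ hc, fun N hN => ?_⟩
  have h1 : ∀ p ∈ N.primeFactors, c ≤ (if p < B then c else 1) * (p : ℝ) ^ ε := by
    intro p hp
    have hp1 : (1 : ℝ) ≤ p := by exact_mod_cast (Nat.prime_of_mem_primeFactors hp).one_le
    split_ifs with h
    · exact le_mul_of_one_le_right (by linarith) (Real.one_le_rpow hp1 hε.le)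
    · have h2 : c ^ ε⁻¹ ≤ p := hB.trans (by exact_mod_cast not_lt.mp h)
      have h3 := Real.rpow_le_rpow (by positivity) h2 hε.le
      rwa [← Real.rpow_mul (by linarith), inv_mul_cancel₀ hε.ne', Real.rpow_one,
        ← one_mul ((p : ℝ) ^ ε)] at h3
  calc c ^ N.primeFactors.card = ∏ p ∈ N.primeFactors, c := by simp
    _ ≤ ∏ p ∈ N.primeFactors, ((if p < B then c else 1) * (p : ℝ) ^ ε) :=
        Finset.prod_le_prod (fun _ _ => by linarith) h1
    _ = (∏ p ∈ N.primeFactors, (if p < B then c else 1)) * (∏ p ∈ N.primeFactors, (p : ℝ)) ^ ε := by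
        rw [Finset.prod_mul_distrib, Real.finsetProd_rpow _ _ (fun _ _ => by positivity)]
    _ ≤ c ^ B * (N : ℝ) ^ ε := by
        gcongr
        · rw [Finset.prod_ite]
          simp only [Finset.prod_const, one_pow, mul_one]
          refine pow_le_pow_right₀ hc ?_
          calc _ ≤ (Finset.range B).card := Finset.card_le_card (fun p hp => by
                  simp only [Finset.mem_filter] at hp; simpa using hp.2)
            _ = B := by simp
        · rw [← Nat.cast_prod]
          exact_mod_cast Nat.le_of_dvd (Nat.pos_of_ne_zero hN) (Nat.prod_primeFactors_dvd N)

theorem Int.exists_two_mul_abs_add_mul_le (b a : ℤ) (ha : a ≠ 0) :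
    ∃ k : ℤ, 2 * |b + k * a| ≤ |a| := by
  obtain ⟨n, hn | hn⟩ := Int.eq_nat_or_neg a
  all_goals
    have hn0 : 0 < n := by omega
    have h1 := Int.le_bmod (x := b) hn0
    have h2 := Int.bmod_lt (x := b) hn0
    have h3 := Int.bmod_add_bdiv' b n
  · refine ⟨-(b.bdiv n), ?_⟩
    have : b + -(b.bdiv n) * a = b.bmod n := by rw [hn]; linarith
    rw [this, hn, abs_of_nonneg (a := (n : ℤ)) (by omega)]
    have : |b.bmod n| ≤ n / 2 := abs_le.mpr ⟨by omega, by omega⟩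
    omega
  · refine ⟨b.bdiv n, ?_⟩
    have : b + (b.bdiv n) * a = b.bmod n := by rw [hn]; linarith
    rw [this, hn, abs_neg, abs_of_nonneg (a := (n : ℤ)) (by omega)]
    have : |b.bmod n| ≤ n / 2 := abs_le.mpr ⟨by omega, by omega⟩
    omega

theorem eq_one_and_eq_one_of_reduced {a r b c : ℤ} (ha : 1 ≤ a) (hr : 1 ≤ r) (hb0 : 0 ≤ b)
    (hc0 : 0 ≤ c) (hb : 2 * b ≤ a) (hc : 2 * c ≤ r) (h1 : r * r ≤ a + c ^ 2)
    (h2 : a * a ≤ r + b ^ 2) : a = 1 ∧ r = 1 := by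
  have j1 : 3 * (r * r) ≤ 4 * a := by nlinarith
  have j2 : 3 * (a * a) ≤ 4 * r := by nlinarith
  have ha1 : a = 1 := by
    by_contra hne
    have : 2 ≤ a := by omega
    nlinarith
  subst ha1
  exact ⟨rfl, by nlinarith⟩

/-- The determinant of the Gram matrix of three vectors. -/
def gramDet {M : Type*} [AddCommGroup M] (B : LinearMap.BilinForm ℤ M) (u v w : M) : ℤ :=
  B u u * (B v v * B w w - B v w * B v w) - B u v * (B u v * B w w - B v w * B u w)
    + B u w * (B u v * B v w - B v v * B u w)

/-- An anisotropic symmetric form over `ℤ` has an orthonormal triple (up to signs) as soon as it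
has a unimodular triple. -/
theorem exists_orthogonal_triple {M : Type*} [AddCommGroup M] (B : LinearMap.BilinForm ℤ M)
    (hB : ∀ x y, B x y = B y x) (hani : ∀ x, B x x = 0 → x = 0) (u₀ v₀ w₀ : M)
    (h₀ : |gramDet B u₀ v₀ w₀| = 1) :
    ∃ u v w : M, B u v = 0 ∧ B u w = 0 ∧ B v w = 0 ∧ |B u u| = 1 ∧ |B v v| = 1 ∧ |B w w| = 1 := by
  let S : Set (M × M × M) := {t | |gramDet B t.1 t.2.1 t.2.2| = 1}
  obtain ⟨⟨u, v₁, w₁⟩, hu, hmin⟩ := WellFounded.has_min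
    (measure (fun t : M × M × M => (B t.1 t.1).natAbs)).wf S ⟨(u₀, v₀, w₀), h₀⟩
  let R : M → ℤ := fun v => B u u * B v v - B u v * B u v
  obtain ⟨⟨v₂, w₂⟩, hv, hmin'⟩ := WellFounded.has_min
    (measure (fun t : M × M => (R t.1).natAbs)).wf {t | |gramDet B u t.1 t.2| = 1} ⟨(v₁, w₁), hu⟩
  have hua : ∀ x y z, |gramDet B x y z| = 1 → |B u u| ≤ |B x x| := by
    intro x y z h
    have := hmin (x, y, z) h
    simp only [InvImage, WellFoundedRelation.rel, not_lt] at this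
    rw [Int.abs_eq_natAbs, Int.abs_eq_natAbs]
    exact_mod_cast this
  have hva : ∀ y z, |gramDet B u y z| = 1 → |R v₂| ≤ |R y| := by
    intro y z h
    have := hmin' (y, z) h
    simp only [InvImage, WellFoundedRelation.rel, not_lt] at this
    rw [Int.abs_eq_natAbs, Int.abs_eq_natAbs]
    exact_mod_cast this
  simp only [Set.mem_ofPred_eq] at hv
  clear hmin hmin' hu h₀
  have ha : B u u ≠ 0 := by
    intro h
    have := hani u h
    subst this
    simp [gramDet] at hv
  obtain ⟨k, hk⟩ := Int.exists_two_mul_abs_add_mul_le (B u v₂) (B u u) ha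
  obtain ⟨v, hvdef⟩ : ∃ v, v = v₂ + k • u := ⟨_, rfl⟩
  have hRv : R v = R v₂ := by
    simp only [R, hvdef, map_add, map_smul, LinearMap.add_apply, LinearMap.smul_apply, smul_eq_mul,
      hB v₂ u]
    ring
  have hb : 2 * |B u v| ≤ |B u u| := by
    simpa [hvdef, mul_comm] using hk
  have hv' : |gramDet B u v w₂| = 1 := by
    rw [← hv]
    congr 1
    simp only [gramDet, hvdef, map_add, map_smul, LinearMap.add_apply, LinearMap.smul_apply,
      smul_eq_mul, hB v₂ u]
    ring
  have key : ∀ w, B u u * gramDet B u v w = R v * R w - (B u u * B v w - B u v * B u w) ^ 2 := by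
    intro w
    simp only [gramDet, R]
    ring
  have hR : R v ≠ 0 := by
    intro h
    have h1 : B (B u u • v - B u v • u) (B u u • v - B u v • u) = B u u * R v := by
      simp only [R, map_sub, map_smul, LinearMap.sub_apply, LinearMap.smul_apply, smul_eq_mul,
        hB v u]
      ring
    have h2 := hani _ (h1.trans (by rw [h, mul_zero]))
    have h3 : B (B u u • v - B u v • u) w₂ = 0 := by rw [h2]; simp
    simp only [map_sub, map_smul, LinearMap.sub_apply, LinearMap.smul_apply, smul_eq_mul] at h3
    have h4 := key w₂
    rw [h, h3] at h4
    have h5 : gramDet B u v w₂ = 0 := by simpa [ha] using h4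
    rw [h5] at hv'
    simp at hv'
  obtain ⟨l, hl⟩ := Int.exists_two_mul_abs_add_mul_le (B u u * B v w₂ - B u v * B u w₂) (R v) hR
  obtain ⟨w, hwdef⟩ : ∃ w, w = w₂ + l • v := ⟨_, rfl⟩
  have hw : |gramDet B u v w| = 1 := by
    rw [← hv']
    congr 1
    simp only [gramDet, hwdef, map_add, map_smul, LinearMap.add_apply, LinearMap.smul_apply,
      smul_eq_mul, hB w₂ v]
    ring
  have hc : 2 * |B u u * B v w - B u v * B u w| ≤ |R v| := by
    convert hl using 3
    simp only [R, hwdef, map_add, map_smul, smul_eq_mul]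
    ring
  have hRR : |R v| ≤ |R w| := by
    rw [hRv]
    refine hva w v ?_
    rw [← hw]
    congr 1
    simp only [gramDet, hB w v]
    ring
  have had : |B u u| ≤ |B v v| := by
    refine hua v u w ?_
    rw [← hw]
    congr 1
    simp only [gramDet, hB v u]
    ring
  have hkey := key w
  have hRdef : R v = B u u * B v v - B u v * B u v := rfl
  have i1 : |R v| * |R v| ≤ |R v| * |R w| := mul_le_mul_of_nonneg_left hRR (abs_nonneg _)
  have i2 : |R v| * |R w| ≤ |B u u| + |B u u * B v w - B u v * B u w| ^ 2 := by
    rw [← abs_mul, show R v * R w = B u u * gramDet B u v w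
      + (B u u * B v w - B u v * B u w) ^ 2 by linarith]
    refine (abs_add_le _ _).trans ?_
    rw [abs_mul, hw, mul_one, abs_pow]
  have i3 : |B u u| * |B u u| ≤ |B u u| * |B v v| := mul_le_mul_of_nonneg_left had (abs_nonneg _)
  have i4 : |B u u| * |B v v| ≤ |R v| + |B u v| ^ 2 := by
    rw [← abs_mul, show B u u * B v v = R v + (B u v) ^ 2 by rw [hRdef]; ring]
    refine (abs_add_le _ _).trans ?_
    rw [abs_pow]
  have pa : 1 ≤ |B u u| := Int.one_le_abs ha
  have pR : 1 ≤ |R v| := Int.one_le_abs hR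
  have nb := abs_nonneg (B u v)
  have nc := abs_nonneg (B u u * B v w - B u v * B u w)
  obtain ⟨a1, r1⟩ := eq_one_and_eq_one_of_reduced pa pR nb nc hb hc (i1.trans i2) (i3.trans i4)
  have b0 : B u v = 0 := by
    rw [← abs_eq_zero]; omega
  have c0 : B u u * B v w - B u v * B u w = 0 := by
    rw [← abs_eq_zero]; omega
  have e0 : B v w = 0 := by simpa [b0, ha] using c0
  have d1 : |B v v| = 1 := by
    rw [hRdef, b0] at r1
    simpa [abs_mul, a1] using r1
  have aa : B u u * B u u = 1 := by
    rw [← abs_mul_abs_self, a1]; rfl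
  refine ⟨u, v, w - (B u u * B u w) • u, b0, ?_, ?_, a1, d1, ?_⟩
  · simp only [map_sub, map_smul, smul_eq_mul]
    linear_combination (-B u w) * aa
  · simp [e0, hB v u, b0]
  · have : |gramDet B u v (w - (B u u * B u w) • u)| = 1 := by
      rw [← hw]
      congr 1
      simp only [gramDet, map_sub, map_smul, LinearMap.sub_apply, LinearMap.smul_apply,
        smul_eq_mul, hB w u, hB v u]
      ring
    have h2 : B u (w - (B u u * B u w) • u) = 0 := by
      simp only [map_sub, map_smul, smul_eq_mul]
      linear_combination (-B u w) * aa
    have h3 : B v (w - (B u u * B u w) • u) = 0 := by simp [e0, hB v u, b0]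
    rw [gramDet, h2, h3, b0] at this
    simpa [abs_mul, a1, d1] using this

open Matrix in
/-- An indefinite unimodular ternary form over `ℤ` is isotropic. -/
theorem exists_isotropic_of_unimodular (G : Matrix (Fin 3) (Fin 3) ℤ) (hG : G.IsSymm)
    (hdet : |G.det| = 1) (hpos : ∃ x, 0 < x ⬝ᵥ G *ᵥ x) (hneg : ∃ x, x ⬝ᵥ G *ᵥ x < 0) :
    ∃ x, x ≠ 0 ∧ x ⬝ᵥ G *ᵥ x = 0 := by
  by_contra! hani
  let B := Matrix.toBilin' G
  have hBdef : ∀ x y, B x y = x ⬝ᵥ G *ᵥ y := fun x y => Matrix.toBilin'_apply' G x y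
  have hB : ∀ x y, B x y = B y x := by
    intro x y
    rw [hBdef, hBdef, Matrix.dotProduct_mulVec, ← Matrix.mulVec_transpose, hG.eq, dotProduct_comm]
  have hani' : ∀ x, B x x = 0 → x = 0 := by
    intro x hx
    by_contra h
    exact hani x h ((hBdef x x).symm.trans hx)
  have hs : ∀ i j, G i j = G j i := fun i j => (hG.apply j i)
  obtain ⟨u, v, w, huv, huw, hvw, hu, hv, hw⟩ := exists_orthogonal_triple B hB hani'
    (Pi.single 0 1) (Pi.single 1 1) (Pi.single 2 1) (by
      have : gramDet B (Pi.single 0 1) (Pi.single 1 1) (Pi.single 2 1) = G.det := by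
        rw [Matrix.det_fin_three]
        simp only [gramDet, B, Matrix.toBilin'_single]
        rw [hs 1 0, hs 2 0, hs 2 1]
        ring
      rw [this, hdet])
  have hne : ∀ x, |B x x| = 1 → x ≠ 0 := by
    rintro x hx rfl
    simp at hx
  have hsame : ∀ x y, B x y = 0 → |B x x| = 1 → |B y y| = 1 → B x x = B y y := by
    intro x y hxy hx hy
    by_contra h
    have h1 : B (x + y) (x + y) = 0 := by
      simp only [map_add, LinearMap.add_apply, hB y x, hxy]
      rcases eq_or_eq_neg_of_abs_eq hx with h1 | h1 <;>
        rcases eq_or_eq_neg_of_abs_eq hy with h2 | h2 <;> rw [h1, h2] at h ⊢ <;> simp at h ⊢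
    have h2 := hani' _ h1
    have h3 : B x (x + y) = 0 := by rw [h2]; simp
    rw [map_add, hxy, add_zero] at h3
    rw [h3] at hx
    simp at hx
  have e1 := hsame u v huv hu hv
  have e2 := hsame u w huw hu hw
  let P : Matrix (Fin 3) (Fin 3) ℤ := Matrix.of ![u, v, w]
  have hP : P * G * Pᵀ = B u u • (1 : Matrix (Fin 3) (Fin 3) ℤ) := by
    have : ∀ i j, (P * G * Pᵀ) i j = B (P i) (P j) := by
      intro i j
      rw [hBdef, Matrix.mul_assoc, Matrix.mul_apply, dotProduct]
      refine Finset.sum_congr rfl fun k _ => ?_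
      simp [Matrix.mul_apply, Matrix.mulVec, dotProduct]
    ext i j
    rw [this]
    have p0 : P 0 = u := rfl
    have p1 : P 1 = v := rfl
    have p2 : P 2 = w := rfl
    rw [Matrix.smul_apply, smul_eq_mul]
    fin_cases i <;> fin_cases j <;>
      simp only [Fin.zero_eta, Fin.mk_one, Fin.reduceFinMk, p0, p1, p2, huv, huw, hvw, hB v u,
        hB w u, hB w v, ← e1, ← e2, Matrix.one_apply_eq, mul_one, Matrix.one_apply_ne, mul_zero,
        ne_eq, Fin.reduceEq, not_false_eq_true]
  have hPdet : IsUnit P.det := by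
    have := congr_arg Matrix.det hP
    rw [Matrix.det_mul, Matrix.det_mul, Matrix.det_transpose, Matrix.det_smul, Matrix.det_one,
      Fintype.card_fin, mul_one] at this
    refine isUnit_of_mul_isUnit_right (x := P.det * G.det) ?_
    rw [this]
    exact (Int.isUnit_iff_abs_eq.mpr hu).pow 3
  have hdef : ∀ x, ∃ c : Fin 3 → ℤ, x ⬝ᵥ G *ᵥ x = B u u * (c ⬝ᵥ c) := by
    intro x
    refine ⟨P⁻¹ᵀ *ᵥ x, ?_⟩
    have hx : x = Pᵀ *ᵥ (P⁻¹ᵀ *ᵥ x) := by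
      rw [Matrix.mulVec_mulVec, ← Matrix.transpose_mul, Matrix.nonsing_inv_mul _ hPdet]
      simp
    set c := P⁻¹ᵀ *ᵥ x
    calc x ⬝ᵥ G *ᵥ x = c ⬝ᵥ (P * G * Pᵀ) *ᵥ c := by
          conv_lhs => rw [hx]
          rw [← Matrix.mulVec_mulVec, ← Matrix.mulVec_mulVec, Matrix.dotProduct_mulVec c P,
            ← Matrix.mulVec_transpose]
      _ = _ := by
          rw [hP, Matrix.smul_mulVec, Matrix.one_mulVec, dotProduct_smul, smul_eq_mul]
  have hcc : ∀ c : Fin 3 → ℤ, 0 ≤ c ⬝ᵥ c := fun c => by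
    simp only [dotProduct]
    exact Finset.sum_nonneg fun i _ => mul_self_nonneg _
  obtain ⟨x, hx⟩ := hpos
  obtain ⟨y, hy⟩ := hneg
  obtain ⟨c, hc⟩ := hdef x
  obtain ⟨d, hd⟩ := hdef y
  have := hcc c
  have := hcc d
  rcases eq_or_eq_neg_of_abs_eq hu with h | h <;> rw [h] at hc hd <;> nlinarith

open IsDedekindDomain in
theorem IsDedekindDomain.exists_span_singleton_eq_sq {R : Type*} [CommRing R] [IsDedekindDomain R]
    {x : R} (hx : x ≠ 0) (h : ∀ v : HeightOneSpectrum R, IsSquare (v.intValuation x)) :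
    ∃ J : Ideal R, J ≠ ⊥ ∧ Ideal.span {x} = J ^ 2 := by
  classical
  have hI : Ideal.span {x} ≠ ⊥ := by simpa using hx
  have hI0 : Ideal.span {x} ≠ 0 := hI
  set s := UniqueFactorizationMonoid.normalizedFactors (Ideal.span {x}) with hs
  have hcount : ∀ p ∈ s, 2 ∣ s.count p := by
    intro p hp
    have hp' := UniqueFactorizationMonoid.prime_of_normalized_factor p hp
    let v : HeightOneSpectrum R := ⟨p, Ideal.isPrime_of_prime hp', hp'.ne_zero⟩
    obtain ⟨r, hr⟩ := h v
    rw [v.intValuation_if_neg hx, Ideal.count_associates_factors_eq hI v.isPrime v.ne_bot] at hr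
    have hr0 : r ≠ 0 := by
      rintro rfl
      simp at hr
    have h2 := congr_arg WithZero.log hr
    rw [WithZero.log_mul hr0 hr0, WithZero.log_exp] at h2
    change -((s.count p : ℕ) : ℤ) = _ at h2
    omega
  obtain ⟨t, ht⟩ : ∃ t : Multiset (Ideal R), s = 2 • t := by
    refine ⟨∑ p ∈ s.toFinset, (s.count p / 2) • {p}, ?_⟩
    ext p
    by_cases hp : p ∈ s
    · rw [Multiset.count_nsmul, Multiset.count_sum', Finset.sum_eq_single p]
      · have := hcount p hp
        simp
        omega
      · intro b _ hb
        simp [hb.symm]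
      · intro h'
        exact absurd (Multiset.mem_toFinset.mpr hp) h'
    · rw [Multiset.count_eq_zero_of_notMem hp, Multiset.count_nsmul, Multiset.count_sum',
        Finset.sum_eq_zero, mul_zero]
      intro b hb
      have : p ≠ b := by
        rintro rfl
        exact hp (Multiset.mem_toFinset.mp hb)
      simp [this]
  have key : Ideal.span {x} = t.prod ^ 2 := by
    rw [← Ideal.prod_normalizedFactors_eq_self hI, ← hs, ht, Multiset.prod_nsmul]
  refine ⟨t.prod, ?_, key⟩
  intro h0
  rw [h0] at key
  apply hI
  rw [key, ← Ideal.zero_eq_bot]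
  simp

section Global

variable {E : Type*} [Field E] [NumberField E]

theorem NumberField.exists_mul_sq_eq_algebraMap (a : E) :
    ∃ y x : 𝓞 E, y ≠ 0 ∧ a * (algebraMap (𝓞 E) E y) ^ 2 = algebraMap (𝓞 E) E x := by
  obtain ⟨x, y, hy, rfl⟩ := IsFractionRing.div_surjective (A := 𝓞 E) a
  have hy0 : y ≠ 0 := nonZeroDivisors.ne_zero hy
  have : algebraMap (𝓞 E) E y ≠ 0 := by simpa using hy0
  refine ⟨y, x * y, hy0, ?_⟩
  rw [map_mul]
  field_simp

/-- The nonzero elements of `E` having even valuation at all primes not dividing `N`. -/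
def EvenAway (N : ℕ) (a : E) : Prop :=
  a ≠ 0 ∧ ∀ v : IsDedekindDomain.HeightOneSpectrum (𝓞 E), ((N : ℕ) : 𝓞 E) ∉ v.asIdeal →
    IsSquare (v.valuation E a)

theorem EvenAway.mul {N : ℕ} {a b : E} (ha : EvenAway N a) (hb : EvenAway N b) :
    EvenAway N (a * b) :=
  ⟨mul_ne_zero ha.1 hb.1, fun v hv => by rw [map_mul]; exact (ha.2 v hv).mul (hb.2 v hv)⟩

theorem EvenAway.div {N : ℕ} {a b : E} (ha : EvenAway N a) (hb : EvenAway N b) :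
    EvenAway N (a / b) :=
  ⟨div_ne_zero ha.1 hb.1, fun v hv => by rw [map_div₀]; exact (ha.2 v hv).div (hb.2 v hv)⟩

theorem EvenAway.of_isSquare {N : ℕ} {a : E} (ha : a ≠ 0) (h : IsSquare a) : EvenAway N a :=
  ⟨ha, fun v _ => h.map (v.valuation E)⟩

theorem EvenAway.of_mul_isSquare {N : ℕ} {a b : E} (hb : EvenAway N b) (ha : a ≠ 0)
    (h : IsSquare (a * b)) : EvenAway N a := by
  have := (EvenAway.of_isSquare (N := N) (mul_ne_zero ha hb.1) h).div hb
  rwa [mul_div_cancel_right₀ _ hb.1] at this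

theorem EvenAway.of_span_eq_sq {N : ℕ} {x : 𝓞 E} {J : Ideal (𝓞 E)} (hx : x ≠ 0)
    (h : Ideal.span {x} = J ^ 2) : EvenAway N (algebraMap (𝓞 E) E x) := by
  classical
  refine ⟨by simpa using hx, fun v _ => ?_⟩
  have hJ : J ≠ 0 := by
    rintro rfl
    simp [hx] at h
  rw [v.valuation_of_algebraMap, v.intValuation_if_neg hx, h, Associates.mk_pow,
    Associates.count_pow (by simpa using hJ) (by
      simpa [Associates.irreducible_mk] using v.irreducible)]
  refine ⟨WithZero.exp (-((Associates.mk v.asIdeal).count (Associates.mk J).factors : ℤ)), ?_⟩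
  rw [← WithZero.exp_add]
  congr 1
  push_cast
  ring

variable (E) in
theorem NumberField.card_heightOneSpectrum_dvd_le (N : ℕ) (hN : N ≠ 0) :
    Finite {v : IsDedekindDomain.HeightOneSpectrum (𝓞 E) // ((N : ℕ) : 𝓞 E) ∈ v.asIdeal} ∧
    Nat.card {v : IsDedekindDomain.HeightOneSpectrum (𝓞 E) // ((N : ℕ) : 𝓞 E) ∈ v.asIdeal} ≤
      N.primeFactors.card * Module.finrank ℚ E := by
  classical
  let s : Finset (Ideal (𝓞 E)) := N.primeFactors.biUnion fun p =>
    IsDedekindDomain.primesOverFinset (Ideal.span {(p : ℤ)}) (𝓞 E)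
  have hmem : ∀ v : {v : IsDedekindDomain.HeightOneSpectrum (𝓞 E) //
      ((N : ℕ) : 𝓞 E) ∈ v.asIdeal}, v.1.asIdeal ∈ s := by
    rintro ⟨v, hv⟩
    have hprod : ((N : ℕ) : 𝓞 E) ∈ v.asIdeal → ∃ p ∈ N.primeFactors, ((p : ℕ) : 𝓞 E) ∈ v.asIdeal := by
      intro h
      rw [← Nat.prod_primeFactorsList hN] at h
      push_cast at h
      have := v.isPrime
      obtain ⟨q, hq, hq'⟩ := (Ideal.IsPrime.multiset_prod_mem_iff_exists_mem this
        (↑(N.primeFactorsList.map (fun n : ℕ => (n : 𝓞 E))))).mp (by simpa using h)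
      simp only [Multiset.mem_coe, List.mem_map] at hq
      obtain ⟨p, hp, rfl⟩ := hq
      exact ⟨p, by simpa using hp, hq'⟩
    obtain ⟨p, hp, hpv⟩ := hprod hv
    have hpp := Nat.prime_of_mem_primeFactors hp
    have hmax : (Ideal.span {(p : ℤ)}).IsMaximal :=
      @Int.ideal_span_isMaximal_of_prime p ⟨hpp⟩
    refine Finset.mem_biUnion.mpr ⟨p, hp, ?_⟩
    rw [IsDedekindDomain.mem_primesOverFinset_iff (p := Ideal.span {(p : ℤ)}) (by simpa using hpp.ne_zero)]
    refine ⟨v.isPrime, ⟨?_⟩⟩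
    refine hmax.eq_of_le (Ideal.comap_ne_top _ v.isPrime.ne_top) ?_
    rw [Ideal.span_singleton_le_iff_mem, Ideal.mem_comap]
    simpa using hpv
  let f : {v : IsDedekindDomain.HeightOneSpectrum (𝓞 E) //
      ((N : ℕ) : 𝓞 E) ∈ v.asIdeal} → s := fun v => ⟨v.1.asIdeal, hmem v⟩
  have hf : Function.Injective f := by
    intro v w h
    have : v.1.asIdeal = w.1.asIdeal := congr_arg Subtype.val h
    exact Subtype.ext (IsDedekindDomain.HeightOneSpectrum.ext this)
  refine ⟨Finite.of_injective f hf, (Nat.card_le_card_of_injective f hf).trans ?_⟩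
  rw [Nat.card_eq_fintype_card, Fintype.card_coe]
  refine Finset.card_biUnion_le_card_mul _ _ _ fun p hp => ?_
  have hpp := Nat.prime_of_mem_primeFactors hp
  have hmax : (Ideal.span {(p : ℤ)}).IsMaximal :=
    @Int.ideal_span_isMaximal_of_prime p ⟨hpp⟩
  have hp0 : Ideal.span {(p : ℤ)} ≠ ⊥ := by simpa using hpp.ne_zero
  rw [← Ideal.sum_ramification_inertia (𝓞 E) ℚ E hp0, Finset.card_eq_sum_ones]
  refine Finset.sum_le_sum fun P hP => ?_
  have : P.IsPrime := ((IsDedekindDomain.mem_primesOverFinset_iff hp0 _).mp hP).1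
  have : P.LiesOver (Ideal.span {(p : ℤ)}) :=
    ((IsDedekindDomain.mem_primesOverFinset_iff hp0 _).mp hP).2
  refine Right.one_le_mul ?_ ?_
  · exact Nat.pos_iff_ne_zero.mpr <| Ideal.IsDedekindDomain.ramificationIdx'_ne_zero_of_liesOver _ hp0
  · exact Nat.pos_iff_ne_zero.mpr <| Ideal.inertiaDeg'_ne_zero _ P

end Global

section Global

variable {E : Type*} [Field E] [NumberField E]

variable (E) in
theorem NumberField.Units.colorable_isSquare :
    Colorable (Set.univ : Set (𝓞 E)ˣ) (fun u v => IsSquare (u / v)) (2 ^ (Module.finrank ℚ E)) := by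
  classical
  obtain ⟨g, hg⟩ := IsCyclic.exists_generator (α := Units.torsion E)
  choose k hk using fun ζ => Subgroup.mem_zpowers_iff.mp (hg ζ)
  choose ζe hζe _ using Units.exist_unique_eq_mul_prod E
  have hcard : Units.rank E + 1 ≤ Module.finrank ℚ E := by
    have h1 := InfinitePlace.card_add_two_mul_card_eq_rank E
    have h2 := InfinitePlace.card_eq_nrRealPlaces_add_nrComplexPlaces E
    have h3 : 0 < Module.finrank ℚ E := Module.finrank_pos
    rw [Units.rank]
    omega
  refine Colorable.mono ?_ (Nat.pow_le_pow_right two_pos hcard)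
  refine Colorable.of_finite (T := Bool × (Fin (Units.rank E) → Bool))
    (fun u => (decide (k (ζe u).1 % 2 = 0), fun i => decide ((ζe u).2 i % 2 = 0))) ?_ ?_
  · simp [Nat.card_eq_fintype_card, pow_succ, mul_comm]
  · intro u _ v _ h
    simp only [Prod.mk.injEq, decide_eq_decide, funext_iff] at h
    obtain ⟨h1, h2⟩ := h
    have hsq : ∀ (w : (𝓞 E)ˣ) (m n : ℤ), (m % 2 = 0 ↔ n % 2 = 0) → IsSquare (w ^ m / w ^ n) := by
      intro w m n h
      rw [div_eq_mul_inv, ← zpow_sub]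
      exact (show Even (m - n) by rw [Int.even_iff]; omega).isSquare_zpow w
    rw [hζe u, hζe v, mul_div_mul_comm, ← Finset.prod_div_distrib]
    refine IsSquare.mul ?_ ?_
    · rw [← hk (ζe u).1, ← hk (ζe v).1]
      push_cast
      exact hsq _ _ _ h1
    · exact Finset.isSquare_prod _ fun i _ => hsq _ _ _ (h2 i)

variable (E) in
/-- Elements with even valuation away from `N`, up to squares. -/
theorem NumberField.colorable_evenAway (N : ℕ) (hN : N ≠ 0) :
    Colorable {a : E | EvenAway N a} (fun a b => IsSquare (a / b))
      (2 ^ (N.primeFactors.card * Module.finrank ℚ E) *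
        (Nat.card {c : ClassGroup (𝓞 E) // c ^ 2 = 1} * 2 ^ Module.finrank ℚ E)) := by
  classical
  obtain ⟨hfin, hcard⟩ := NumberField.card_heightOneSpectrum_dvd_le E N hN
  have hcl : 0 < Nat.card {c : ClassGroup (𝓞 E) // c ^ 2 = 1} :=
    Nat.card_pos_iff.mpr ⟨⟨1, by simp⟩, inferInstance⟩
  refine Colorable.trans (R := fun a b => EvenAway 1 (a / b)) (by positivity) ?_ ?_
  · refine Colorable.of_finite (T := {v : IsDedekindDomain.HeightOneSpectrum (𝓞 E) //
      ((N : ℕ) : 𝓞 E) ∈ v.asIdeal} → Bool) (fun a v => decide (IsSquare (v.1.valuation E a))) ?_ ?_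
    · have := Fintype.ofFinite {v : IsDedekindDomain.HeightOneSpectrum (𝓞 E) //
        ((N : ℕ) : 𝓞 E) ∈ v.asIdeal}
      rw [Nat.card_eq_fintype_card] at hcard ⊢
      rw [Fintype.card_fun, Fintype.card_bool]
      exact Nat.pow_le_pow_right two_pos hcard
    · intro a ha b hb h
      refine ⟨div_ne_zero ha.1 hb.1, fun v _ => ?_⟩
      by_cases hv : ((N : ℕ) : 𝓞 E) ∈ v.asIdeal
      · have h := congr_fun h ⟨v, hv⟩
        simp only [decide_eq_decide] at h
        have h1 : v.valuation E a ≠ 0 := by simpa using ha.1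
        have h2 : v.valuation E b ≠ 0 := by simpa using hb.1
        rw [map_div₀]
        have key : ∀ x : WithZero (Multiplicative ℤ), x ≠ 0 → (IsSquare x ↔ Even (WithZero.log x)) := by
          intro x hx
          constructor
          · rintro ⟨r, rfl⟩
            have hr : r ≠ 0 := by rintro rfl; simp at hx
            rw [WithZero.log_mul hr hr]
            exact ⟨_, rfl⟩
          · rintro ⟨r, hr⟩
            refine ⟨WithZero.exp r, ?_⟩
            rw [← WithZero.exp_add, ← hr, WithZero.exp_log hx]
        rw [key _ h1, key _ h2] at h
        rw [key _ (div_ne_zero h1 h2), WithZero.log_div h1 h2, Int.even_sub]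
        exact h
      · exact (ha.div hb).2 v hv
  · intro b hb
    have hJ : ∀ a : E, EvenAway 1 a → ∃ (y x : 𝓞 E) (J : Ideal (𝓞 E)), y ≠ 0 ∧
        a * (algebraMap (𝓞 E) E y) ^ 2 = algebraMap (𝓞 E) E x ∧ J ≠ ⊥ ∧ Ideal.span {x} = J ^ 2 := by
      intro a ha
      obtain ⟨y, x, hy, hx⟩ := NumberField.exists_mul_sq_eq_algebraMap a
      have hy' : algebraMap (𝓞 E) E y ≠ 0 := by simpa using hy
      have hx0 : x ≠ 0 := by
        rintro rfl
        rw [map_zero] at hx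
        exact mul_ne_zero ha.1 (pow_ne_zero 2 hy') hx
      obtain ⟨J, hJ, hJ'⟩ := IsDedekindDomain.exists_span_singleton_eq_sq hx0 (fun v => by
        have e : v.valuation E (algebraMap (𝓞 E) E x) = v.intValuation x :=
          v.valuation_of_algebraMap x
        rw [← e, ← hx, map_mul, map_pow]
        refine IsSquare.mul (ha.2 v ?_) (IsSquare.sq _)
        simpa using (Ideal.ne_top_iff_one _).mp v.isPrime.ne_top)
      exact ⟨y, x, J, hy, hx, hJ, hJ'⟩
    have hJsq : ∀ (x : 𝓞 E) (J : Ideal (𝓞 E)) (hJ : J ≠ ⊥), Ideal.span {x} = J ^ 2 →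
        ClassGroup.mk0 ⟨J, mem_nonZeroDivisors_of_ne_zero hJ⟩ ^ 2 = 1 := by
      intro x J hJ h
      rw [← map_pow]
      refine (ClassGroup.mk0_eq_one_iff (I := J ^ 2)
        (mem_nonZeroDivisors_of_ne_zero (pow_ne_zero 2 hJ))).mpr ⟨x, ?_⟩
      rw [← h]
    choose! y x J hy hx hJ0 hJs using hJ
    refine Colorable.trans (R := fun a a' => ∃ (u : (𝓞 E)ˣ) (d : E), a / a' = (u : E) * d ^ 2)
      (by positivity) ?_ ?_
    · refine Colorable.of_finite (T := {c : ClassGroup (𝓞 E) // c ^ 2 = 1})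
        (fun a => if h : EvenAway 1 (a / b) then ⟨_, hJsq _ _ (hJ0 _ h) (hJs _ h)⟩ else ⟨1, by simp⟩)
        le_rfl ?_
      rintro a ⟨_, ha⟩ a' ⟨_, ha'⟩ h
      rw [dif_pos ha, dif_pos ha', Subtype.mk.injEq, ClassGroup.mk0_eq_mk0_iff] at h
      obtain ⟨r, s, hr, hs, h⟩ := h
      have h2 : Ideal.span {r ^ 2 * x (a / b)} = Ideal.span {s ^ 2 * x (a' / b)} := by
        rw [← Ideal.span_singleton_mul_span_singleton, ← Ideal.span_singleton_mul_span_singleton,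
          ← Ideal.span_singleton_pow, ← Ideal.span_singleton_pow, hJs _ ha, hJs _ ha', ← mul_pow,
          ← mul_pow]
        exact congr_arg (· ^ 2) h
      obtain ⟨u, hu⟩ := (Ideal.span_singleton_eq_span_singleton.mp h2).symm
      have hu' := congr_arg (algebraMap (𝓞 E) E) hu
      simp only [map_mul, map_pow, ← hx _ ha, ← hx _ ha'] at hu'
      have hr' : algebraMap (𝓞 E) E r ≠ 0 := by simpa using hr
      have hs' : algebraMap (𝓞 E) E s ≠ 0 := by simpa using hs
      have hy' : algebraMap (𝓞 E) E (y (a / b)) ≠ 0 := by simpa using hy _ ha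
      have hy'' : algebraMap (𝓞 E) E (y (a' / b)) ≠ 0 := by simpa using hy _ ha'
      have hb0 := hb.1
      have ha0 := ha'.1
      have ha0' : a' ≠ 0 := by rintro rfl; simp at ha0
      refine ⟨u, algebraMap (𝓞 E) E s * algebraMap (𝓞 E) E (y (a' / b)) /
        (algebraMap (𝓞 E) E r * algebraMap (𝓞 E) E (y (a / b))), ?_⟩
      field_simp at hu' ⊢
      linear_combination -hu'
    · rintro a' ⟨ha', _⟩
      refine Colorable.comap (Units.colorable_isSquare E)
        (fun a => if h : ∃ (u : (𝓞 E)ˣ) (d : E), a / a' = (u : E) * d ^ 2 then h.choose else 1)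
        (fun _ _ => trivial) ?_
      rintro a ⟨⟨_, ha⟩, h⟩ c ⟨⟨_, hc⟩, h'⟩ hsq
      rw [dif_pos h, dif_pos h'] at hsq
      obtain ⟨d, hd⟩ := h.choose_spec
      obtain ⟨e, he⟩ := h'.choose_spec
      have h1 : a / c = (a / a') / (c / a') := (div_div_div_cancel_right₀ ha'.1 a c).symm
      have h3 : IsSquare ((h.choose : E) / (h'.choose : E)) := by
        obtain ⟨w, hw⟩ := hsq
        refine ⟨(w : E), ?_⟩
        rw [div_eq_iff (by simp)]
        have := congr_arg (fun z : (𝓞 E)ˣ => (z : E)) (div_eq_iff_eq_mul.mp hw)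
        simpa using this
      rw [h1, hd, he, mul_div_mul_comm]
      exact h3.mul ((IsSquare.sq d).div (IsSquare.sq e))

end Global

section Extension

variable {E L : Type*} [Field E] [Field L] [NumberField E] [NumberField L] [Algebra E L]

open IsDedekindDomain

theorem EvenAway.map {N : ℕ} {a : E} (ha : EvenAway N a) : EvenAway N (algebraMap E L a) := by
  refine ⟨by simpa using ha.1, fun w hw => ?_⟩
  let v := w.under (𝓞 E)
  have hv : w.asIdeal.LiesOver v.asIdeal := ⟨rfl⟩
  rw [← HeightOneSpectrum.valuation_liesOver L v w]
  refine IsSquare.pow _ (ha.2 v ?_)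
  intro h
  have : ((N : ℕ) : 𝓞 L) ∈ w.asIdeal := by simpa [v] using h
  exact hw this

variable (E L) in
/-- Every prime of `L` not dividing `N` is unramified over `E`, in the weak form that it
preserves parity of valuations. -/
def ParityDescent (N : ℕ) : Prop :=
  ∀ a : E, EvenAway N (algebraMap E L a) → EvenAway N a

theorem ParityDescent.of_inertia_eq_bot [IsGalois E L] {N : ℕ}
    (h : ∀ w : HeightOneSpectrum (𝓞 L), ((N : ℕ) : 𝓞 L) ∉ w.asIdeal →
      ∀ σ : L ≃ₐ[E] L, (∀ x : 𝓞 L, σ • x - x ∈ w.asIdeal) → σ = 1) :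
    ParityDescent E L N := by
  intro a ha
  refine ⟨by simpa using ha.1, fun v hv => ?_⟩
  obtain ⟨⟨P, hP, hPv⟩⟩ := v.asIdeal.nonempty_primesOver (S := 𝓞 L)
  have hv0 := v.ne_bot
  have hP0 : P ≠ ⊥ := Ideal.ne_bot_of_liesOver_of_ne_bot hv0 P
  let w : HeightOneSpectrum (𝓞 L) := ⟨P, hP, hP0⟩
  have hw : w.asIdeal.LiesOver v.asIdeal := hPv
  have hN : ((N : ℕ) : 𝓞 L) ∉ w.asIdeal := by
    intro h
    apply hv
    rw [hw.over]
    simpa using h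
  have h1 := ha.2 w hN
  rw [← HeightOneSpectrum.valuation_liesOver L v w] at h1
  have hfin : Module.Finite (𝓞 E) (𝓞 L) := Module.Finite.of_restrictScalars_finite ℤ _ _
  have hres : Finite v.asIdeal.ResidueField := by
    have : Finite (𝓞 E ⧸ v.asIdeal) := Ring.HasFiniteQuotients.finiteQuotient hv0
    have := v.isMaximal
    exact Finite.of_surjective _ (Ideal.bijective_algebraMap_quotient_residueField v.asIdeal).2
  have h2 := Ideal.card_inertia_eq_ramificationIdxIn (G := L ≃ₐ[E] L) v.asIdeal w.asIdeal
  have h3 : Ideal.inertia (L ≃ₐ[E] L) w.asIdeal = ⊥ := by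
    rw [eq_bot_iff]
    intro σ hσ
    exact h w hN σ hσ
  rw [h3, Ideal.ramificationIdxIn_eq_ramificationIdx v.asIdeal w.asIdeal (L ≃ₐ[E] L),
    ← Ideal.ramificationIdx'_eq_ramificationIdx v.asIdeal w.asIdeal hv0] at h2
  rw [← h2] at h1
  simpa using h1

variable (E L) in
theorem colorable_isSquare_algebraMap [IsGalois E L] :
    Colorable {a : E | a ≠ 0 ∧ IsSquare (algebraMap E L a)} (fun a b => IsSquare (a / b))
      (2 ^ Nat.card (L ≃ₐ[E] L)) := by
  classical
  refine Colorable.of_finite (T := (L ≃ₐ[E] L) → Bool)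
    (fun a σ => if h : IsSquare (algebraMap E L a) then decide (σ h.choose = h.choose) else true) ?_ ?_
  · rw [Nat.card_fun, Nat.card_eq_two_iff.mpr ⟨true, false, by simp, by ext b; cases b <;> simp⟩]
  · rintro a ⟨ha0, ha⟩ b ⟨hb0, hb⟩ h
    have hr := ha.choose_spec
    have hs := hb.choose_spec
    simp only [dif_pos ha, dif_pos hb, funext_iff, decide_eq_decide] at h
    generalize ha.choose = r at *
    generalize hb.choose = s at *
    have hs0 : s ≠ 0 := by
      rintro rfl
      simp [hb0] at hs
    have hsg : ∀ (c : E) (t : L), algebraMap E L c = t * t → ∀ σ : L ≃ₐ[E] L, σ t = t ∨ σ t = -t := by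
      intro c t ht σ
      have := congr_arg σ ht
      rw [AlgEquiv.commutes, map_mul, ht] at this
      exact (mul_self_eq_mul_self_iff.mp this).imp Eq.symm (fun h => (neg_eq_iff_eq_neg.mpr h).symm)
    obtain ⟨d, hd⟩ := (IsGalois.mem_range_algebraMap_iff_fixed (F := E) (r / s)).mpr (by
      intro σ
      rw [map_div₀]
      by_cases h1 : σ r = r
      · rw [h1, (h σ).mp h1]
      · rw [(hsg a r hr σ).resolve_left h1, (hsg b s hs σ).resolve_left fun h2 => h1 ((h σ).mpr h2),
          neg_div_neg_eq])
    refine ⟨d, (algebraMap E L).injective ?_⟩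
    rw [map_mul, hd, map_div₀, hr, hs]
    field_simp

end Extension

section Galois

variable {L : Type*} [Field L] [NumberField L] [IsGalois ℚ L]

/-- Elements of `L` whose square class is Galois invariant are, up to finitely many, rational up
to squares. -/
theorem colorable_invariant_squareClass :
    Colorable {a : L | a ≠ 0 ∧ ∀ σ : L ≃ₐ[ℚ] L, IsSquare (σ a / a)}
      (fun a b => ∃ (r : ℚ) (d : L), d ≠ 0 ∧ a / b = algebraMap ℚ L r * d ^ 2)
      (2 ^ (Nat.card (L ≃ₐ[ℚ] L) * Nat.card (L ≃ₐ[ℚ] L))) := by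
  classical
  let c : (L ≃ₐ[ℚ] L) → L → L := fun σ a => if h : IsSquare (σ a / a) then h.choose else 0
  refine Colorable.of_finite (T := ((L ≃ₐ[ℚ] L) × (L ≃ₐ[ℚ] L)) → Bool)
    (fun a στ => decide (c στ.1 a * στ.1 (c στ.2 a) = c (στ.1 * στ.2) a)) ?_ ?_
  · rw [Nat.card_fun, Nat.card_eq_two_iff.mpr ⟨true, false, by simp, by ext b; cases b <;> simp⟩,
      Nat.card_prod]
  · have hc : ∀ a : L, (∀ σ : L ≃ₐ[ℚ] L, IsSquare (σ a / a)) → ∀ σ : L ≃ₐ[ℚ] L,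
        σ a / a = c σ a * c σ a := by
      intro a ha σ
      simp only [c, dif_pos (ha σ)]
      exact (ha σ).choose_spec
    have hc0 : ∀ a : L, a ≠ 0 → (∀ σ : L ≃ₐ[ℚ] L, IsSquare (σ a / a)) → ∀ σ : L ≃ₐ[ℚ] L,
        c σ a ≠ 0 := by
      intro a ha0 ha σ h
      have := hc a ha σ
      rw [h, mul_zero, div_eq_zero_iff] at this
      simp [ha0] at this
    have hcc : ∀ a : L, a ≠ 0 → (∀ σ : L ≃ₐ[ℚ] L, IsSquare (σ a / a)) → ∀ σ τ : L ≃ₐ[ℚ] L,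
        c σ a * σ (c τ a) = c (σ * τ) a ∨ c σ a * σ (c τ a) = -c (σ * τ) a := by
      intro a ha0 ha σ τ
      apply mul_self_eq_mul_self_iff.mp
      rw [← hc a ha, mul_mul_mul_comm, ← hc a ha, ← map_mul, ← hc a ha, map_div₀,
        AlgEquiv.mul_apply]
      have : σ a ≠ 0 := by simpa using ha0
      field_simp
    rintro a ⟨ha0, ha⟩ b ⟨hb0, hb⟩ h
    simp only [funext_iff, decide_eq_decide, Prod.forall] at h
    let t : (L ≃ₐ[ℚ] L) → Lˣ := fun σ => Units.mk0 (c σ a / c σ b)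
      (div_ne_zero (hc0 a ha0 ha σ) (hc0 b hb0 hb σ))
    have ht : groupCohomology.IsMulCocycle₁ t := by
      intro σ τ
      ext
      simp only [t, Units.val_mk0, Units.val_mul, AlgEquiv.smul_units_def, Units.coe_map,
        MonoidHom.coe_coe]
      have h1 := hcc a ha0 ha σ τ
      have h2 := hcc b hb0 hb σ τ
      have h3 := h σ τ
      have e : ((σ : L →ₐ[ℚ] L) : L → L) = σ := rfl
      have key : c σ a * σ (c τ a) / (c σ b * σ (c τ b)) = c (σ * τ) a / c (σ * τ) b := by
        by_cases h4 : c σ a * σ (c τ a) = c (σ * τ) a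
        · rw [h4, h3.mp h4]
        · rw [h1.resolve_left h4, h2.resolve_left fun h5 => h4 (h3.mpr h5), neg_div_neg_eq]
      rw [← key]
      simp only [map_div₀]
      rw [mul_comm (c σ a), mul_comm (c σ b), mul_div_mul_comm]
    obtain ⟨d, hd⟩ := groupCohomology.isMulCoboundary₁_of_isMulCocycle₁_of_aut_to_units t ht
    have hd0 : (d : L) ≠ 0 := d.ne_zero
    have hd' : ∀ σ : L ≃ₐ[ℚ] L, σ (d : L) / d = c σ a / c σ b := by
      intro σ
      have := congr_arg (Units.val) (hd σ)
      simpa [t] using this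
    obtain ⟨r, hr⟩ := (IsGalois.mem_range_algebraMap_iff_fixed (F := ℚ) (a / b / (d : L) ^ 2)).mpr (by
      intro σ
      have h1 : σ a = c σ a * c σ a * a := by rw [← hc a ha]; field_simp
      have h2 : σ b = c σ b * c σ b * b := by rw [← hc b hb]; field_simp
      have h3 : σ (d : L) = c σ a / c σ b * d := by rw [← hd' σ]; field_simp
      have h4 := hc0 a ha0 ha σ
      have h5 := hc0 b hb0 hb σ
      rw [map_div₀, map_div₀, map_pow, h1, h2, h3]
      field_simp)
    refine ⟨r, d, hd0, ?_⟩
    rw [hr]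
    field_simp

theorem colorable_invariant_evenAway {N : ℕ} (hN : N ≠ 0) (hQ : ParityDescent ℚ L N) :
    Colorable {a : L | EvenAway N a ∧ ∀ σ : L ≃ₐ[ℚ] L, IsSquare (σ a / a)}
      (fun a b => IsSquare (a / b))
      (2 ^ (Nat.card (L ≃ₐ[ℚ] L) * Nat.card (L ≃ₐ[ℚ] L)) * 2 ^ (N.primeFactors.card + 1)) := by
  classical
  refine Colorable.trans (R := fun a b => ∃ (r : ℚ) (d : L), d ≠ 0 ∧
    a / b = algebraMap ℚ L r * d ^ 2) (by positivity)
    (colorable_invariant_squareClass.comap id (fun a ha => ⟨ha.1.1, ha.2⟩) (fun _ _ _ _ h => h)) ?_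
  rintro b ⟨hb, -⟩
  have hQcol := NumberField.colorable_evenAway ℚ N hN
  have hcl : Nat.card {c : ClassGroup (𝓞 ℚ) // c ^ 2 = 1} = 1 := by
    have h1 : Nat.card (ClassGroup (𝓞 ℚ)) = 1 := by
      rw [Nat.card_eq_fintype_card]; exact Rat.classNumber_eq
    have := (Nat.card_eq_one_iff_unique.mp h1).1
    rw [Nat.card_eq_one_iff_unique]
    exact ⟨inferInstance, ⟨1, by simp⟩⟩
  rw [hcl, Module.finrank_self, mul_one, one_mul, pow_one, ← pow_succ] at hQcol
  refine hQcol.comap (fun a => if h : ∃ (r : ℚ) (d : L), d ≠ 0 ∧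
    a / b = algebraMap ℚ L r * d ^ 2 then h.choose else 1) ?_ ?_
  · rintro a ⟨⟨ha, -⟩, h⟩
    simp only [dif_pos h]
    obtain ⟨d, hd, h2⟩ := h.choose_spec
    refine hQ _ ?_
    have h3 : algebraMap ℚ L h.choose = a / b / d ^ 2 :=
      (eq_div_iff (pow_ne_zero 2 hd)).mpr h2.symm
    rw [h3]
    exact (ha.div hb).div (EvenAway.of_isSquare (pow_ne_zero 2 hd) (IsSquare.sq d))
  · rintro a ⟨⟨ha, -⟩, h⟩ a' ⟨⟨ha', -⟩, h'⟩ hsq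
    rw [dif_pos h, dif_pos h'] at hsq
    obtain ⟨d, hd, h2⟩ := h.choose_spec
    obtain ⟨d', hd', h2'⟩ := h'.choose_spec
    rw [← div_div_div_cancel_right₀ hb.1, h2, h2', mul_div_mul_comm, ← map_div₀]
    exact (hsq.map (algebraMap ℚ L)).mul ((IsSquare.sq d).div (IsSquare.sq d'))

/-- The version of `colorable_invariant_evenAway` for elements of a subfield. -/
theorem colorable_invariant_evenAway_of_algebra (E : Type*) [Field E] [NumberField E] [Algebra E L]
    {N : ℕ} (hN : N ≠ 0) (hQ : ParityDescent ℚ L N) :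
    Colorable {a : E | EvenAway N a ∧ ∀ σ : L ≃ₐ[ℚ] L,
        IsSquare (σ (algebraMap E L a) / algebraMap E L a)}
      (fun a b => IsSquare (a / b))
      (2 ^ (Nat.card (L ≃ₐ[ℚ] L) * Nat.card (L ≃ₐ[ℚ] L)) * 2 ^ (N.primeFactors.card + 1) *
        2 ^ Nat.card (L ≃ₐ[ℚ] L)) := by
  have : IsGalois E L := IsGalois.tower_top_of_isGalois ℚ E L
  refine Colorable.trans (R := fun a b => IsSquare (algebraMap E L (a / b))) (by positivity)
    ((colorable_invariant_evenAway hN hQ).comap (algebraMap E L) (fun a ha => ⟨ha.1.map, ha.2⟩)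
      (fun a _ b _ h => by rwa [map_div₀])) ?_
  rintro b ⟨hb, -⟩
  refine ((colorable_isSquare_algebraMap E L).mono ?_).comap (fun a => a / b) ?_ ?_
  · refine Nat.pow_le_pow_right two_pos ?_
    rw [IsGalois.card_aut_eq_finrank, IsGalois.card_aut_eq_finrank]
    exact Nat.le_of_dvd Module.finrank_pos ⟨Module.finrank ℚ E, by
      rw [mul_comm, Module.finrank_mul_finrank]⟩
  · rintro a ⟨⟨ha, -⟩, h⟩
    exact ⟨div_ne_zero ha.1 hb.1, h⟩
  · rintro a ⟨⟨ha, -⟩, h⟩ a' ⟨⟨ha', -⟩, h'⟩ hsq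
    rwa [div_div_div_cancel_right₀ hb.1] at hsq

end Galois

/-- Permutations of four points preserving the partition `{0, 1}, {2, 3}`. -/
def PreservesPairing (g : Equiv.Perm (Fin 4)) : Prop :=
  (g 0 = 0 ∨ g 0 = 1) ↔ (g 1 = 0 ∨ g 1 = 1)

instance : DecidablePred PreservesPairing := fun g => by unfold PreservesPairing; infer_instance

set_option synthInstance.maxSize 4000 in
set_option synthInstance.maxHeartbeats 400000 in
set_option maxRecDepth 100000 in
theorem PreservesPairing.cases : ∀ g : Equiv.Perm (Fin 4), PreservesPairing g →
    (g 0 = 0 ∧ g 1 = 1 ∧ g 2 = 2 ∧ g 3 = 3) ∨ (g 0 = 1 ∧ g 1 = 0 ∧ g 2 = 2 ∧ g 3 = 3) ∨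
    (g 0 = 0 ∧ g 1 = 1 ∧ g 2 = 3 ∧ g 3 = 2) ∨ (g 0 = 1 ∧ g 1 = 0 ∧ g 2 = 3 ∧ g 3 = 2) ∨
    (g 0 = 2 ∧ g 1 = 3 ∧ g 2 = 0 ∧ g 3 = 1) ∨ (g 0 = 3 ∧ g 1 = 2 ∧ g 2 = 0 ∧ g 3 = 1) ∨
    (g 0 = 2 ∧ g 1 = 3 ∧ g 2 = 1 ∧ g 3 = 0) ∨ (g 0 = 3 ∧ g 1 = 2 ∧ g 2 = 1 ∧ g 3 = 0) := by
  decide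

/-- A quartic field `K` and its cubic resolvent `F` inside an `S₄`-extension `L`, together with
the roots of a polynomial generating `K`. -/
structure QuarticSetup (K L F : Type*) [Field K] [Field L] [Field F] [NumberField K]
    [NumberField L] [NumberField F] [Algebra K L] [Algebra F L] where
  x : Fin 4 → 𝓞 L
  e : (L ≃ₐ[ℚ] L) ≃* Equiv.Perm (Fin 4)
  injective_x : Function.Injective x
  map_x : ∀ σ i, σ (x i : L) = x (e σ i)
  sum_x : ∑ i, x i = 0
  mem_range_left : ∀ a : L, a ∈ Set.range (algebraMap K L) ↔ ∀ σ, e σ 0 = 0 → σ a = a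
  mem_range_right : ∀ a : L, a ∈ Set.range (algebraMap F L) ↔ ∀ σ, PreservesPairing (e σ) → σ a = a

namespace QuarticSetup

variable {K L F : Type*} [Field K] [Field L] [Field F] [NumberField K] [NumberField L]
  [NumberField F] [Algebra K L] [Algebra F L] (S : QuarticSetup K L F)

/-- The conjugates of an element of the quartic field. -/
def conj (i : Fin 4) : K →+* L :=
  (S.e.symm (Equiv.swap 0 i) : L →+* L).comp (algebraMap K L)

theorem conj_apply (i : Fin 4) (a : K) :
    S.conj i a = S.e.symm (Equiv.swap 0 i) (algebraMap K L a) := rfl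

theorem map_algebraMap (σ : L ≃ₐ[ℚ] L) (a : K) : σ (algebraMap K L a) = S.conj (S.e σ 0) a := by
  have h := (S.mem_range_left (algebraMap K L a)).mp ⟨a, rfl⟩
    ((S.e.symm (Equiv.swap 0 (S.e σ 0)))⁻¹ * σ) (by simp)
  rw [AlgEquiv.mul_apply, AlgEquiv.aut_inv, AlgEquiv.symm_apply_eq] at h
  exact h

theorem conj_zero (a : K) : S.conj 0 a = algebraMap K L a := by
  have := S.map_algebraMap 1 a
  simpa using this.symm

theorem map_conj (σ : L ≃ₐ[ℚ] L) (i : Fin 4) (a : K) : σ (S.conj i a) = S.conj (S.e σ i) a := by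
  rw [conj_apply, ← AlgEquiv.mul_apply, S.map_algebraMap]
  simp

/-- The integer `N` kills all relevant bad primes. -/
structure IsBad (N : ℕ) : Prop where
  ne_zero : N ≠ 0
  sub_dvd : ∀ i j, i ≠ j → S.x i - S.x j ∣ (N : 𝓞 L)
  add_dvd : ∀ i, i ≠ 0 → S.x 0 + S.x i ∣ (N : 𝓞 L)

variable {S} {N : ℕ} (hN : S.IsBad N)

include hN in
theorem IsBad.parityDescent (E : Type*) [Field E] [NumberField E] [Algebra E L] [IsGalois E L] :
    ParityDescent E L N := by
  refine ParityDescent.of_inertia_eq_bot fun w hw σ hσ => ?_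
  let τ : L ≃ₐ[ℚ] L := σ.restrictScalars ℚ
  have h1 : ∀ i, S.e τ i = i := by
    intro i
    by_contra hne
    apply hw
    refine w.asIdeal.mem_of_dvd (hN.sub_dvd _ _ hne) ?_
    have h := hσ (S.x i)
    convert h using 2
    apply RingOfIntegers.ext
    exact (S.map_x τ i).symm
  have h2 : τ = 1 := by
    apply S.e.injective
    rw [map_one]
    exact Equiv.ext h1
  ext y
  exact DFunLike.congr_fun h2 y

variable (S) in
theorem evenAway_conj {a : K} (ha : EvenAway N a) (i : Fin 4) : EvenAway N (S.conj i a) :=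
  @EvenAway.map K L _ _ _ _ (S.conj i).toAlgebra N a ha

variable (S) in
theorem conj_ne_zero {a : K} (ha : a ≠ 0) (i : Fin 4) : S.conj i a ≠ 0 := by simpa using ha

variable (S) in
theorem exists_e_apply_eq {i j : Fin 4} (hij : i ≠ j) :
    ∃ σ : L ≃ₐ[ℚ] L, S.e σ 0 = i ∧ S.e σ 1 = j := by
  have h : ∀ i j : Fin 4, i ≠ j → ∃ g : Equiv.Perm (Fin 4), g 0 = i ∧ g 1 = j := by decide
  obtain ⟨g, hg⟩ := h i j hij
  exact ⟨S.e.symm g, by simpa using hg⟩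

theorem isSquare_conj_mul_conj {a : K} (h : IsSquare (S.conj 0 a * S.conj 1 a)) {i j : Fin 4}
    (hij : i ≠ j) : IsSquare (S.conj i a * S.conj j a) := by
  obtain ⟨σ, rfl, rfl⟩ := S.exists_e_apply_eq hij
  have := h.map σ
  rwa [map_mul, S.map_conj, S.map_conj] at this

theorem isSquare_map_div {a : K} (ha : a ≠ 0) (h : IsSquare (S.conj 0 a * S.conj 1 a))
    (σ : L ≃ₐ[ℚ] L) : IsSquare (σ (algebraMap K L a) / algebraMap K L a) := by
  rw [S.map_algebraMap, ← S.conj_zero]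
  have h0 := S.conj_ne_zero ha 0
  by_cases hi : S.e σ 0 = 0
  · rw [hi, div_self h0]
    exact IsSquare.one
  · have h1 := (isSquare_conj_mul_conj h hi).div (IsSquare.sq (S.conj 0 a))
    rwa [pow_two, mul_div_mul_right _ _ h0] at h1

theorem exists_norm [IsGalois ℚ L] (a : K) : ∃ n : ℚ, algebraMap ℚ L n = ∏ i, S.conj i a := by
  refine (IsGalois.mem_range_algebraMap_iff_fixed (F := ℚ) _).mpr fun σ => ?_
  rw [map_prod]
  simp_rw [S.map_conj]
  exact Equiv.prod_comp (S.e σ) (fun i => S.conj i a)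

include hN in
theorem exists_resolvent [IsGalois ℚ L] {c : K} (hc : EvenAway N c) {n : ℚ}
    (hn : ∏ i, S.conj i c = algebraMap ℚ L n ^ 2) :
    ∃ b : F, EvenAway N b ∧ IsSquare (S.conj 0 c * S.conj 1 c * algebraMap F L b) := by
  have : IsGalois F L := IsGalois.tower_top_of_isGalois ℚ F L
  obtain ⟨m, hm, hm0⟩ : ∃ m : ℚ, ∏ i, S.conj i c = algebraMap ℚ L m ^ 2 ∧
      S.conj 0 c * S.conj 1 c + S.conj 2 c * S.conj 3 c + 2 * algebraMap ℚ L m ≠ 0 := by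
    by_contra! h
    have h1 := h n hn
    have h2 := h (-n) (by rw [hn, map_neg, neg_sq])
    rw [map_neg] at h2
    have h3 : algebraMap ℚ L n = 0 := by linear_combination (h1 - h2) / 4
    rw [h3, zero_pow two_ne_zero, Finset.prod_eq_zero_iff] at hn
    obtain ⟨i, -, hi⟩ := hn
    exact S.conj_ne_zero hc.1 i hi
  rw [Fin.prod_univ_four] at hm
  obtain ⟨b, hb⟩ := (S.mem_range_right
    (S.conj 0 c * S.conj 1 c + S.conj 2 c * S.conj 3 c + 2 * algebraMap ℚ L m)).mpr (by
      intro σ hσ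
      simp only [map_add, map_mul, S.map_conj, AlgEquiv.commutes, map_ofNat]
      rcases hσ.cases with h | h | h | h | h | h | h | h <;> obtain ⟨h0, h1, h2, h3⟩ := h <;>
        rw [h0, h1, h2, h3] <;> ring)
  have hsq : IsSquare (S.conj 0 c * S.conj 1 c * algebraMap F L b) :=
    ⟨S.conj 0 c * S.conj 1 c + algebraMap ℚ L m, by rw [hb]; linear_combination hm⟩
  refine ⟨b, hN.parityDescent F b ?_, hsq⟩
  rw [mul_comm] at hsq
  exact ((S.evenAway_conj hc 0).mul (S.evenAway_conj hc 1)).of_mul_isSquare (by rwa [hb]) hsq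

include hN in
theorem colorable_evenAway_left [IsGalois ℚ L] :
    Colorable {a : K | EvenAway N a} (fun a b => IsSquare (a / b))
      (2 ^ (N.primeFactors.card * Module.finrank ℚ ℚ) *
        (Nat.card {c : ClassGroup (𝓞 ℚ) // c ^ 2 = 1} * 2 ^ Module.finrank ℚ ℚ) *
      (2 ^ (N.primeFactors.card * Module.finrank ℚ F) *
        (Nat.card {c : ClassGroup (𝓞 F) // c ^ 2 = 1} * 2 ^ Module.finrank ℚ F) *
      (2 ^ (Nat.card (L ≃ₐ[ℚ] L) * Nat.card (L ≃ₐ[ℚ] L)) * 2 ^ (N.primeFactors.card + 1) *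
        2 ^ Nat.card (L ≃ₐ[ℚ] L)))) := by
  choose nm hnm using S.exists_norm
  have hnm_ev : ∀ a : K, EvenAway N a → EvenAway N (nm a) := by
    intro a ha
    apply hN.parityDescent ℚ
    rw [hnm, Fin.prod_univ_four]
    exact (((S.evenAway_conj ha 0).mul (S.evenAway_conj ha 1)).mul (S.evenAway_conj ha 2)).mul
      (S.evenAway_conj ha 3)
  have hI := colorable_invariant_evenAway_of_algebra (L := L) K hN.ne_zero (hN.parityDescent ℚ)
  have hF := NumberField.colorable_evenAway F N hN.ne_zero
  have hQ := NumberField.colorable_evenAway ℚ N hN.ne_zero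
  have hclF : 0 < Nat.card {c : ClassGroup (𝓞 F) // c ^ 2 = 1} :=
    Nat.card_pos_iff.mpr ⟨⟨1, one_pow 2⟩, inferInstance⟩
  refine Colorable.trans (R := fun a b => IsSquare (nm a / nm b)) (by positivity)
    (hQ.comap nm hnm_ev fun _ _ _ _ h => h) ?_
  rintro b hb
  refine Colorable.trans (R := fun a a' => IsSquare (S.conj 0 (a / a') * S.conj 1 (a / a')))
    (by positivity) ?_ ?_
  · have hex : ∀ a : K, EvenAway N a → IsSquare (nm a / nm b) → ∃ f : F, EvenAway N f ∧
        IsSquare (S.conj 0 (a / b) * S.conj 1 (a / b) * algebraMap F L f) := by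
      rintro a ha ⟨n, hn⟩
      refine exists_resolvent hN (ha.div hb) (n := n) ?_
      simp_rw [map_div₀, Finset.prod_div_distrib]
      rw [← hnm, ← hnm, ← map_div₀, hn, map_mul, pow_two]
    classical
    refine hF.comap (fun a => if h : EvenAway N a ∧ IsSquare (nm a / nm b) then
      (hex a h.1 h.2).choose else 1) ?_ ?_
    · rintro a ⟨h1, h2⟩
      have h1 : EvenAway N a := h1
      rw [dif_pos ⟨h1, h2⟩]
      exact (hex a h1 h2).choose_spec.1
    · rintro a ⟨h1, h2⟩ a' ⟨h1', h2'⟩ hsq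
      have h1 : EvenAway N a := h1
      have h1' : EvenAway N a' := h1'
      rw [dif_pos ⟨h1, h2⟩, dif_pos ⟨h1', h2'⟩] at hsq
      have h3 := (hex a h1 h2).choose_spec
      have h3' := (hex a' h1' h2').choose_spec
      generalize (hex a h1 h2).choose = f at *
      generalize (hex a' h1' h2').choose = f' at *
      have h4 := (h3.2.div h3'.2).div (hsq.map (algebraMap F L))
      have e0 : ∀ i, S.conj i (a / b) = S.conj i (a / a') * S.conj i (a' / b) := by
        intro i
        rw [← map_mul, div_mul_div_cancel₀ h1'.1]
      have n0 := S.conj_ne_zero (div_ne_zero h1'.1 hb.1)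
      have n1 : algebraMap F L f ≠ 0 := by simpa using h3.1.1
      have n2 : algebraMap F L f' ≠ 0 := by simpa using h3'.1.1
      have m0 := n0 0
      have m1 := n0 1
      rw [e0 0, e0 1, map_div₀ (algebraMap F L)] at h4
      generalize S.conj 0 (a / a') = p at *
      generalize S.conj 1 (a / a') = q at *
      have key : p * q = p * S.conj 0 (a' / b) * (q * S.conj 1 (a' / b)) * algebraMap F L f /
          (S.conj 0 (a' / b) * S.conj 1 (a' / b) * algebraMap F L f') /
          (algebraMap F L f / algebraMap F L f') := by
        field_simp
      exact key ▸ h4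
  · rintro a' ⟨ha', -⟩
    have ha' : EvenAway N a' := ha'
    refine hI.comap (fun a => a / a') ?_ ?_
    · rintro a ⟨⟨ha, -⟩, h⟩
      have ha : EvenAway N a := ha
      exact ⟨ha.div ha', isSquare_map_div (div_ne_zero ha.1 ha'.1) h⟩
    · rintro a - a'' - h
      simpa only [div_div_div_cancel_right₀ ha'.1] using h

end QuarticSetup

/-- The two-torsion of the class group is bounded by any colouring of the square classes of
enough generators of squares of ideals. -/
theorem NumberField.card_classGroup_two_torsion_le_of {E : Type*} [Field E] [NumberField E]
    {n : ℕ} {T : Set (𝓞 E)}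
    (hT : ∀ c : ClassGroup (𝓞 E), c ^ 2 = 1 → ∃ (J : nonZeroDivisors (Ideal (𝓞 E))) (x : 𝓞 E),
      x ∈ T ∧ x ≠ 0 ∧ ClassGroup.mk0 J = c ∧ Ideal.span {x} = (J : Ideal (𝓞 E)) ^ 2)
    (h : Colorable T (fun a b => IsSquare ((a : E) / b)) n) :
    Nat.card {c : ClassGroup (𝓞 E) // c ^ 2 = 1} ≤ n := by
  have hex := fun c : {c : ClassGroup (𝓞 E) // c ^ 2 = 1} => hT c.1 c.2
  choose J x hxT hx0 hJ hx using hex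
  refine Colorable.card_le (h.comap x (fun c _ => hxT c) ?_)
  rintro c - d - ⟨y, hy⟩
  obtain ⟨p, q, hq, rfl⟩ := IsFractionRing.div_surjective (A := 𝓞 E) y
  have hq0 := nonZeroDivisors.ne_zero hq
  have hq' : algebraMap (𝓞 E) E q ≠ 0 := by simpa using hq0
  have hd' : algebraMap (𝓞 E) E (x d) ≠ 0 := by simpa using hx0 d
  have hc' : algebraMap (𝓞 E) E (x c) ≠ 0 := by simpa using hx0 c
  have e : x c * q ^ 2 = p ^ 2 * x d := by
    apply FaithfulSMul.algebraMap_injective (𝓞 E) E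
    simp only [map_mul, map_pow]
    field_simp at hy
    linear_combination hy
  have hp0 : p ≠ 0 := by
    rintro rfl
    have := mul_ne_zero (hx0 c) (pow_ne_zero 2 hq0)
    simp [e] at this
  apply Subtype.ext
  rw [← hJ, ← hJ, ClassGroup.mk0_eq_mk0_iff]
  refine ⟨q, p, hq0, hp0, ?_⟩
  have h2 : (Ideal.span {q} * (J c : Ideal (𝓞 E))) ^ 2 =
      (Ideal.span {p} * (J d : Ideal (𝓞 E))) ^ 2 := by
    rw [mul_pow, mul_pow, ← hx, ← hx, Ideal.span_singleton_pow, Ideal.span_singleton_pow,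
      Ideal.span_singleton_mul_span_singleton, Ideal.span_singleton_mul_span_singleton, mul_comm,
      e]
  exact pow_left_injective two_ne_zero h2

theorem NumberField.exists_span_eq_sq {E : Type*} [Field E] [NumberField E]
    {J : nonZeroDivisors (Ideal (𝓞 E))} (hc : ClassGroup.mk0 J ^ 2 = 1) :
    ∃ x : 𝓞 E, x ≠ 0 ∧ Ideal.span {x} = (J : Ideal (𝓞 E)) ^ 2 := by
  rw [← map_pow, ClassGroup.mk0_eq_one_iff] at hc
  obtain ⟨x, hx⟩ := hc.principal
  have hx' : (J : Ideal (𝓞 E)) ^ 2 = Ideal.span {x} := by simpa using hx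
  refine ⟨x, ?_, hx'.symm⟩
  rintro rfl
  have := pow_ne_zero 2 (nonZeroDivisors.ne_zero J.2)
  simp [hx'] at this

/-- The two-torsion of the class group is bounded by any colouring of the square classes of even
valuation. -/
theorem NumberField.card_classGroup_two_torsion_le (E : Type*) [Field E] [NumberField E] {N n : ℕ}
    (h : Colorable {a : E | EvenAway N a} (fun a b => IsSquare (a / b)) n) :
    Nat.card {c : ClassGroup (𝓞 E) // c ^ 2 = 1} ≤ n := by
  refine card_classGroup_two_torsion_le_of (T := {x | EvenAway N (x : E)}) ?_
    (h.comap _ (fun _ hx => hx) fun _ _ _ _ h => h)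
  intro c hc
  obtain ⟨J, rfl⟩ := ClassGroup.mk0_surjective c
  obtain ⟨x, hx0, hx⟩ := NumberField.exists_span_eq_sq hc
  exact ⟨J, x, EvenAway.of_span_eq_sq hx0 hx, hx0, rfl, hx⟩

/-- Every ideal class contains an ideal coprime to `N`. -/
theorem NumberField.exists_mk0_eq_of_sq_eq_one {E : Type*} [Field E] [NumberField E] {N : ℕ}
    (hN : N ≠ 0) {c : ClassGroup (𝓞 E)} (hc : c ^ 2 = 1) :
    ∃ J : nonZeroDivisors (Ideal (𝓞 E)), ClassGroup.mk0 J = c ∧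
      (J : Ideal (𝓞 E)) ⊔ Ideal.span {(N : 𝓞 E)} = ⊤ := by
  obtain ⟨J, rfl⟩ := ClassGroup.mk0_surjective c
  have hJ := nonZeroDivisors.ne_zero J.2
  have hN' : Ideal.span {(N : 𝓞 E)} ≠ 0 := by simpa using hN
  obtain ⟨a, ha⟩ := IsDedekindDomain.exists_sup_span_eq
    (Ideal.mul_le_right (I := Ideal.span {(N : 𝓞 E)}) (J := (J : Ideal (𝓞 E))))
    (mul_ne_zero hN' hJ)
  obtain ⟨J', hJ'⟩ : (J : Ideal (𝓞 E)) ∣ Ideal.span {a} := by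
    rw [Ideal.dvd_iff_le, ← ha]
    exact le_sup_right
  have htop : Ideal.span {(N : 𝓞 E)} ⊔ J' = ⊤ := by
    rw [hJ', mul_comm, ← Ideal.mul_sup] at ha
    exact mul_left_cancel₀ hJ (ha.trans (Ideal.mul_top _).symm)
  by_cases h0 : J' = 0
  · refine ⟨J, rfl, ?_⟩
    rw [h0, Submodule.zero_eq_bot, sup_bot_eq] at htop
    rw [htop, sup_top_eq]
  · have hmem := mem_nonZeroDivisors_of_ne_zero h0
    refine ⟨⟨J', hmem⟩, ?_, by rw [sup_comm]; exact htop⟩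
    have h1 : ClassGroup.mk0 (J * ⟨J', hmem⟩) = 1 := by
      rw [ClassGroup.mk0_eq_one_iff]
      exact ⟨⟨a, by rw [Submonoid.coe_mul]; exact hJ'.symm⟩⟩
    rw [map_mul] at h1
    rw [pow_two] at hc
    exact mul_left_cancel (h1.trans hc.symm)

section Positivity

variable {F : Type*} [Field F] [NumberField F]

open ComplexEmbedding in
theorem NumberField.exists_real_combination {x : (F →+* ℂ) → ℂ}
    (hx : ∀ φ, x (conjugate φ) = star (x φ)) :
    ∃ r : Module.Free.ChooseBasisIndex ℤ (𝓞 F) → ℝ,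
      ∀ φ, x φ = ∑ i, (r i : ℂ) * φ (integralBasis F i) := by
  let b := canonicalEmbedding.latticeBasis F
  have h1 : ∀ φ : F →+* ℂ, x φ = ∑ i, b.repr x i * φ (integralBasis F i) := by
    intro φ
    conv_lhs => rw [← b.sum_repr x]
    simp [b, canonicalEmbedding.latticeBasis_apply]
  refine ⟨fun i => (b.repr x i).re, fun φ => ?_⟩
  have h2 : x φ = ∑ i, star (b.repr x i) * φ (integralBasis F i) := by
    have := congr_arg star (h1 (conjugate φ))
    rw [hx, star_star, star_sum] at this
    rw [this]
    refine Finset.sum_congr rfl fun i _ => ?_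
    rw [star_mul', conjugate_coe_eq, ← starRingEnd_apply, ← starRingEnd_apply, Complex.conj_conj]
  have h3 : x φ = (x φ + x φ) / 2 := by ring
  rw [h3]
  nth_rewrite 1 [h1 φ]
  rw [h2, ← Finset.sum_add_distrib, Finset.sum_div]
  refine Finset.sum_congr rfl fun i _ => ?_
  rw [Complex.re_eq_add_conj, starRingEnd_apply]
  ring

theorem NumberField.trace_eq_sum_ringHom (a : F) :
    ((Algebra.trace ℚ F a : ℚ) : ℂ) = ∑ φ : F →+* ℂ, φ a := by
  have h := trace_eq_sum_embeddings ℂ (K := ℚ) (L := F) (x := a)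
  rw [eq_ratCast] at h
  rw [h]
  exact (Fintype.sum_equiv (RingHom.equivRatAlgHom F ℂ) _ _ fun φ => rfl).symm

open ComplexEmbedding in
/-- A nonzero `γ` for which `Tr (γ x ^ 2)` is positive semidefinite is totally positive in a
totally real field. -/
theorem NumberField.isReal_and_nonneg_of_trace_nonneg {γ : F} (hγ : γ ≠ 0)
    (h : ∀ x : F, 0 ≤ Algebra.trace ℚ F (γ * x ^ 2)) (φ : F →+* ℂ) :
    IsReal φ ∧ 0 ≤ (φ γ).re := by
  classical
  have h1 : ∀ r : Module.Free.ChooseBasisIndex ℤ (𝓞 F) → ℝ,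
      0 ≤ (∑ φ : F →+* ℂ, φ γ * (∑ i, (r i : ℂ) * φ (integralBasis F i)) ^ 2).re := by
    have hd : DenseRange (fun (q : Module.Free.ChooseBasisIndex ℤ (𝓞 F) → ℚ) i => (q i : ℝ)) :=
      DenseRange.piMap fun _ => Rat.isDenseEmbedding_coe_real.dense
    intro r
    refine hd.induction_on (p := fun r : Module.Free.ChooseBasisIndex ℤ (𝓞 F) → ℝ =>
      0 ≤ (∑ φ : F →+* ℂ, φ γ * (∑ i, (r i : ℂ) * φ (integralBasis F i)) ^ 2).re) r ?_ ?_
    · exact isClosed_le continuous_const (by fun_prop)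
    · intro q
      have h2 := h (∑ i, (q i : F) * integralBasis F i)
      have h3 := trace_eq_sum_ringHom (γ * (∑ i, (q i : F) * integralBasis F i) ^ 2)
      simp only [map_mul, map_pow, map_sum, map_ratCast] at h3
      simp only [Complex.ofReal_ratCast]
      rw [← h3, Complex.ratCast_re]
      exact_mod_cast h2
  have h2 : ∀ x : (F →+* ℂ) → ℂ, (∀ φ, x (conjugate φ) = star (x φ)) →
      0 ≤ (∑ φ : F →+* ℂ, φ γ * x φ ^ 2).re := by
    intro x hx
    obtain ⟨r, hr⟩ := exists_real_combination hx
    simp_rw [hr]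
    exact h1 r
  by_cases hφ : IsReal φ
  · refine ⟨hφ, ?_⟩
    have h3 := h2 (Pi.single φ 1) (by
      intro ψ
      by_cases hψ : ψ = φ
      · subst hψ
        rw [isReal_iff.mp hφ]
        simp
      · have : conjugate ψ ≠ φ := by
          intro h
          apply hψ
          rw [← isReal_iff.mp hφ, ← h]
          exact (involutive_conjugate F ψ).symm
        simp [hψ, this])
    rw [Finset.sum_eq_single φ (by intro ψ _ hψ; simp [hψ]) (by simp)] at h3
    simpa using h3
  · exfalso
    have hne : conjugate φ ≠ φ := fun h => hφ (isReal_iff.mpr h)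
    obtain ⟨z, hz⟩ := IsAlgClosed.exists_pow_nat_eq (-star (φ γ)) two_pos
    have h3 := h2 (Pi.single φ z + Pi.single (conjugate φ) (star z)) (by
      intro ψ
      by_cases hψ : ψ = φ
      · subst hψ
        simp [hne, hne.symm]
      · by_cases hψ' : ψ = conjugate φ
        · have : conjugate ψ = φ := by rw [hψ']; exact involutive_conjugate F φ
          rw [this, hψ']
          simp [hne, hne.symm]
        · have h4 : conjugate ψ ≠ φ := by
            intro h
            apply hψ'
            rw [← h]
            exact (involutive_conjugate F ψ).symm
          have h5 : conjugate ψ ≠ conjugate φ := fun h => hψ ((involutive_conjugate F).injective h)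
          simp [hψ, hψ', h4, h5])
    rw [Finset.sum_eq_add_of_mem φ (conjugate φ) (by simp) (by simp) hne.symm (by
      rintro ψ - ⟨h1, h2⟩
      simp [h1, h2])] at h3
    simp only [Pi.add_apply, Pi.single_eq_same, Pi.single_eq_of_ne hne, add_zero,
      Pi.single_eq_of_ne hne.symm, zero_add, hz, conjugate_coe_eq, Complex.add_re, ← starRingEnd_apply, ← map_pow, map_neg,
      Complex.conj_conj] at h3
    have h4 : φ γ ≠ 0 := by simpa using hγ
    have h5 := Complex.normSq_pos.mpr h4
    simp [Complex.normSq_apply] at h3 h5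
    linarith

open ComplexEmbedding in
theorem NumberField.exists_trace_neg {w β : F} (hw : w ≠ 0) (hβ : β ≠ 0)
    (hpos : ∀ φ : F →+* ℂ, IsReal φ → 0 ≤ (φ β).re) (htr : Algebra.trace ℚ F w = 0) :
    ∃ x : F, Algebra.trace ℚ F (w * β * x ^ 2) < 0 := by
  by_contra! h
  have h1 := isReal_and_nonneg_of_trace_nonneg (mul_ne_zero hw hβ) h
  have hre : ∀ (φ : F →+* ℂ), IsReal φ → ∀ a, ((φ a).re : ℂ) = φ a := by
    intro φ hφ a
    rw [← Complex.conj_eq_iff_re, ← conjugate_coe_eq, isReal_iff.mp hφ]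
  have h2 : ∀ φ : F →+* ℂ, 0 ≤ (φ w).re := by
    intro φ
    obtain ⟨hφ, h3⟩ := h1 φ
    have h4 := hpos φ hφ
    rw [map_mul, ← hre φ hφ w, ← hre φ hφ β, ← Complex.ofReal_mul, Complex.ofReal_re] at h3
    have h5 : (φ β).re ≠ 0 := by
      intro h
      have := hre φ hφ β
      rw [h] at this
      simp at this
      exact hβ ((map_eq_zero φ).mp this.symm)
    exact nonneg_of_mul_nonneg_left h3 (lt_of_le_of_ne h4 h5.symm)
  have h3 := congr_arg Complex.re (trace_eq_sum_ringHom w)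
  rw [htr, Rat.cast_zero, Complex.zero_re, Complex.re_sum, eq_comm,
    Finset.sum_eq_zero_iff_of_nonneg fun φ _ => h2 φ] at h3
  obtain ⟨φ⟩ : Nonempty (F →+* ℂ) := inferInstance
  have h4 := hre φ (h1 φ).1 w
  rw [h3 φ (by simp), Complex.ofReal_zero, eq_comm, map_eq_zero] at h4
  exact hw h4

end Positivity

section SelfDual

theorem Submodule.exists_basis_fin_of_fg {V : Type*} [AddCommGroup V] [Module ℚ V] [Module.Finite ℚ V]
    {n : ℕ} (hV : Module.finrank ℚ V = n) {M : Submodule ℤ V} (hfg : M.FG)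
    (hspan : ∀ z : V, ∃ m : ℤ, m ≠ 0 ∧ m • z ∈ M) :
    ∃ (b : Module.Basis (Fin n) ℤ M) (e : Module.Basis (Fin n) ℚ V), ∀ i, e i = b i := by
  have : Module.Finite ℤ M := Module.Finite.iff_fg.mpr hfg
  have : Module.IsTorsionFree ℤ V := Module.IsTorsionFree.trans_faithfulSMul ℤ ℚ V
  have : Module.Free ℤ M := inferInstance
  let b := Module.Free.chooseBasis ℤ M
  have hli : LinearIndependent ℚ (fun i => (b i : V)) := by
    rw [← LinearIndependent.iff_fractionRing (R := ℤ)]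
    exact b.linearIndependent.map' M.subtype (by simp)
  have hsp : ⊤ ≤ Submodule.span ℚ (Set.range fun i => (b i : V)) := by
    intro z _
    obtain ⟨m, hm, hz⟩ := hspan z
    have h1 : m • z ∈ Submodule.span ℚ (Set.range fun i => (b i : V)) := by
      have h2 := congr_arg (Subtype.val) (b.sum_repr ⟨m • z, hz⟩)
      rw [show m • z = ((⟨m • z, hz⟩ : M) : V) from rfl, ← h2,
        AddSubmonoidClass.coe_finsetSum]
      refine Submodule.sum_mem _ fun i _ => ?_
      rw [SetLike.val_smul, ← Int.cast_smul_eq_zsmul ℚ]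
      exact Submodule.smul_mem _ _ (Submodule.subset_span ⟨i, rfl⟩)
    rw [← Int.cast_smul_eq_zsmul ℚ] at h1
    exact (Submodule.smul_mem_iff _ (by exact_mod_cast hm)).mp h1
  let e := Module.Basis.mk hli hsp
  have hcard : Fintype.card (Module.Free.ChooseBasisIndex ℤ M) = n := by
    rw [← Module.finrank_eq_card_basis e, hV]
  let f := Fintype.equivFinOfCardEq hcard
  refine ⟨b.reindex f, e.reindex f, fun i => ?_⟩
  simp [e]

open Matrix in
theorem LinearMap.BilinForm.exists_isotropic_of_selfDual {V : Type*} [AddCommGroup V] [Module ℚ V]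
    [Module.Finite ℚ V] (hV : Module.finrank ℚ V = 3) (B : LinearMap.BilinForm ℚ V)
    (hsymm : B.IsSymm) (hB : B.Nondegenerate) {M : Submodule ℤ V} (hfg : M.FG)
    (hspan : ∀ z : V, ∃ m : ℤ, m ≠ 0 ∧ m • z ∈ M)
    (hint : ∀ x ∈ M, ∀ y ∈ M, ∃ n : ℤ, B x y = n)
    (hdual : ∀ x, (∀ y ∈ M, ∃ n : ℤ, B x y = n) → x ∈ M)
    (hpos : ∃ x, 0 < B x x) (hneg : ∃ x, B x x < 0) : ∃ x, x ≠ 0 ∧ B x x = 0 := by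
  obtain ⟨b, e, he⟩ := Submodule.exists_basis_fin_of_fg hV hfg hspan
  choose G hG using fun i j => hint (b i) (b i).2 (b j) (b j).2
  have hBG : ∀ x y : Fin 3 → ℤ, B (∑ i, (x i : ℚ) • e i) (∑ j, (y j : ℚ) • e j) =
      ((x ⬝ᵥ Matrix.of G *ᵥ y : ℤ) : ℚ) := by
    intro x y
    simp only [map_sum, map_smul, LinearMap.sum_apply, LinearMap.smul_apply, he, hG, smul_eq_mul,
      dotProduct, mulVec, Matrix.of_apply, Finset.mul_sum]
    push_cast
    rw [Finset.sum_comm]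
    exact Finset.sum_congr rfl fun i _ => Finset.sum_congr rfl fun j _ => by ring
  have hrep : ∀ x ∈ M, ∃ c : Fin 3 → ℤ, x = ∑ i, (c i : ℚ) • e i := by
    intro x hx
    refine ⟨b.repr ⟨x, hx⟩, ?_⟩
    have h2 := congr_arg (Subtype.val) (b.sum_repr ⟨x, hx⟩)
    conv_lhs => rw [show x = ((⟨x, hx⟩ : M) : V) from rfl, ← h2]
    rw [AddSubmonoidClass.coe_finsetSum]
    refine Finset.sum_congr rfl fun i _ => ?_
    rw [SetLike.val_smul, ← Int.cast_smul_eq_zsmul ℚ, he]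
  have hdet : |(Matrix.of G).det| = 1 := by
    let d := B.dualBasis hB e
    have hd : ∀ i, d i ∈ M := by
      intro i
      refine hdual _ fun y hy => ?_
      obtain ⟨c, rfl⟩ := hrep y hy
      refine ⟨c i, ?_⟩
      simp only [map_sum, map_smul, d, LinearMap.BilinForm.apply_dualBasis_left]
      simp
    choose H hH using fun i => hrep (d i) (hd i)
    have h1 : Matrix.of H * Matrix.of G = 1 := by
      ext i j
      have h2 := LinearMap.BilinForm.apply_dualBasis_left hB e i j
      change B (d i) (e j) = _ at h2
      rw [hH] at h2
      simp only [map_sum, map_smul, LinearMap.sum_apply, LinearMap.smul_apply, he, hG,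
        smul_eq_mul] at h2
      simp only [Matrix.mul_apply, Matrix.of_apply, Matrix.one_apply]
      have h3 : ((∑ k, H i k * G k j : ℤ) : ℚ) = ((if i = j then 1 else 0 : ℤ) : ℚ) := by
        push_cast
        rw [h2]
        simp [eq_comm]
      exact_mod_cast h3
    have h2 := congr_arg Matrix.det h1
    rw [Matrix.det_mul, Matrix.det_one] at h2
    exact Int.isUnit_iff_abs_eq.mp (IsUnit.of_mul_eq_one_right _ h2)
  have hscale : ∀ x : V, ∃ c : Fin 3 → ℤ, ∃ m : ℚ, m ≠ 0 ∧ m • x = ∑ i, (c i : ℚ) • e i := by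
    intro x
    obtain ⟨m, hm, hx⟩ := hspan x
    obtain ⟨c, hc⟩ := hrep _ hx
    exact ⟨c, m, by exact_mod_cast hm, by rw [← hc, Int.cast_smul_eq_zsmul]⟩
  obtain ⟨c, hc0, hc⟩ := exists_isotropic_of_unimodular (Matrix.of G) (by
    ext i j
    have h := hsymm.eq (b i : V) (b j)
    rw [hG] at h
    simp only [Matrix.transpose_apply, Matrix.of_apply]
    have h' := hG j i
    rw [h'] at h
    exact_mod_cast h.symm) hdet (by
    obtain ⟨x, hx⟩ := hpos
    obtain ⟨c, m, hm, hc⟩ := hscale x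
    refine ⟨c, ?_⟩
    have h := hBG c c
    rw [← hc] at h
    simp only [map_smul, LinearMap.smul_apply, smul_eq_mul] at h
    have : 0 < ((c ⬝ᵥ Matrix.of G *ᵥ c : ℤ) : ℚ) := by
      rw [← h, ← mul_assoc]
      exact mul_pos (mul_self_pos.mpr hm) hx
    exact_mod_cast this) (by
    obtain ⟨x, hx⟩ := hneg
    obtain ⟨c, m, hm, hc⟩ := hscale x
    refine ⟨c, ?_⟩
    have h := hBG c c
    rw [← hc] at h
    simp only [map_smul, LinearMap.smul_apply, smul_eq_mul] at h
    have : ((c ⬝ᵥ Matrix.of G *ᵥ c : ℤ) : ℚ) < 0 := by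
      rw [← h, ← mul_assoc]
      exact mul_neg_of_pos_of_neg (mul_self_pos.mpr hm) hx
    exact_mod_cast this)
  refine ⟨∑ i, (c i : ℚ) • e i, ?_, ?_⟩
  · intro h
    apply hc0
    ext i
    have := Fintype.linearIndependent_iff.mp e.linearIndependent _ h i
    exact_mod_cast this
  · rw [hBG, hc, Int.cast_zero]

end SelfDual

section TraceForm

variable {F : Type*} [Field F] [NumberField F]

open Matrix in
/-- A family with unimodular Gram matrix spans a self-dual lattice. -/
theorem NumberField.exists_int_combination_of_trace {ι : Type*} [Fintype ι] [DecidableEq ι]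
    [Nonempty ι] (hF : Module.finrank ℚ F = Fintype.card ι) {w : F} (b : ι → F)
    (G : Matrix ι ι ℤ) (hG : ∀ i j, Algebra.trace ℚ F (w * b i * b j) = G i j)
    (hdet : |G.det| = 1) (z : F) (hz : ∀ i, ∃ n : ℤ, Algebra.trace ℚ F (w * z * b i) = n) :
    ∃ c : ι → ℤ, z = ∑ i, (c i : F) * b i := by
  have hu : IsUnit G.det := Int.isUnit_iff_abs_eq.mpr hdet
  have hcomb : ∀ (c : ι → ℚ) i, Algebra.trace ℚ F (w * (∑ j, c j • b j) * b i) =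
      (G.map (Int.cast : ℤ → ℚ) *ᵥ c) i := by
    intro c i
    simp only [Finset.mul_sum, Finset.sum_mul, mul_smul_comm, smul_mul_assoc, map_sum, map_smul,
      smul_eq_mul, mulVec, dotProduct, Matrix.map_apply]
    refine Finset.sum_congr rfl fun j _ => ?_
    rw [← hG, mul_comm (c j), mul_right_comm]
  have hinj : Function.Injective (G.map (Int.cast : ℤ → ℚ)).mulVec := by
    apply Matrix.mulVec_injective_of_isUnit
    rw [Matrix.isUnit_iff_isUnit_det]
    have h := hu.map (Int.castRingHom ℚ)
    rw [RingHom.map_det] at h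
    exact h
  have hli : LinearIndependent ℚ b := by
    rw [Fintype.linearIndependent_iff]
    intro c hc i
    have h : G.map (Int.cast : ℤ → ℚ) *ᵥ c = G.map (Int.cast : ℤ → ℚ) *ᵥ 0 := by
      ext i
      rw [← hcomb, hc]
      simp
    exact congr_fun (hinj h) i
  let e := basisOfLinearIndependentOfCardEqFinrank hli hF.symm
  have he : ∀ i, e i = b i := fun i => by simp [e]
  choose n hn using hz
  refine ⟨G⁻¹ *ᵥ n, ?_⟩
  have h1 : ⇑(e.repr z) = fun i => ((G⁻¹ *ᵥ n) i : ℚ) := by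
    apply hinj
    ext i
    rw [← hcomb]
    have h2 : G.map (Int.cast : ℤ → ℚ) *ᵥ (fun i => ((G⁻¹ *ᵥ n) i : ℚ)) =
        fun i => ((G *ᵥ G⁻¹ *ᵥ n) i : ℚ) := by
      ext i
      simp [mulVec, dotProduct]
    rw [h2, Matrix.mulVec_mulVec, Matrix.mul_nonsing_inv _ hu, Matrix.one_mulVec]
    beta_reduce
    rw [← hn]
    congr 3
    conv_rhs => rw [← e.sum_repr z]
    simp_rw [he]
  conv_lhs => rw [← e.sum_repr z]
  refine Finset.sum_congr rfl fun i _ => ?_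
  rw [congr_fun h1 i, he]
  simp [Algebra.smul_def]

theorem NumberField.exists_trace_eq_intCast (a : 𝓞 F) :
    ∃ n : ℤ, Algebra.trace ℚ F (algebraMap (𝓞 F) F a) = n :=
  ⟨Algebra.trace ℤ (𝓞 F) a, (Algebra.coe_trace_int a).symm⟩

theorem NumberField.exists_trace_isotropic (hF : Module.finrank ℚ F = 3) {w : F} (hw : w ≠ 0)
    (b : Fin 3 → F) (G : Matrix (Fin 3) (Fin 3) ℤ)
    (hG : ∀ i j, Algebra.trace ℚ F (w * b i * b j) = G i j) (hdet : |G.det| = 1)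
    (htr : Algebra.trace ℚ F w = 0) {δ : ℕ} (hδ : δ ≠ 0) {w' : 𝓞 F} {b' : Fin 3 → 𝓞 F}
    (hw' : algebraMap (𝓞 F) F w' = δ * w) (hb' : ∀ i, algebraMap (𝓞 F) F (b' i) = δ * b i)
    {β y : 𝓞 F} {J : Ideal (𝓞 F)} (hβ0 : β ≠ 0) (hJ : Ideal.span {β} = J ^ 2)
    (hy : (δ : 𝓞 F) ^ 12 ∣ β * y ^ 2 - 1)
    (hpos : ∀ φ : F →+* ℂ, ComplexEmbedding.IsReal φ → 0 ≤ (φ (algebraMap (𝓞 F) F β)).re) :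
    ∃ x : F, x ≠ 0 ∧ Algebra.trace ℚ F (w * algebraMap (𝓞 F) F β * x ^ 2) = 0 := by
  set β' := algebraMap (𝓞 F) F β with hβ'
  set y' := algebraMap (𝓞 F) F y with hy'
  have hβ'0 : β' ≠ 0 := by simpa [β'] using hβ0
  have hδ' : (δ : F) ≠ 0 := by exact_mod_cast hδ
  have hwβ : w * β' ≠ 0 := mul_ne_zero hw hβ'0
  obtain ⟨t, ht⟩ := hy
  have ht' : β' * y' ^ 2 = 1 + δ ^ 12 * algebraMap (𝓞 F) F t := by
    have := congr_arg (algebraMap (𝓞 F) F) ht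
    simp only [map_sub, map_mul, map_pow, map_one, map_natCast] at this
    linear_combination this
  let f : ((Fin 3 → ℤ) × J) →ₗ[ℤ] F :=
    { toFun := fun p => y' * ∑ i, (p.1 i : F) * b i + δ ^ 3 * algebraMap (𝓞 F) F p.2 / β'
      map_add' := by
        intro p q
        simp only [Prod.fst_add, Prod.snd_add, Pi.add_apply, Int.cast_add, add_mul,
          Finset.sum_add_distrib, Submodule.coe_add, map_add]
        ring
      map_smul' := by
        intro m p
        have h : (((m • p.2 : J) : 𝓞 F)) = m • (p.2 : 𝓞 F) := rfl
        simp only [Prod.smul_fst, Prod.smul_snd, Pi.smul_apply, smul_eq_mul, Int.cast_mul,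
          mul_assoc, ← Finset.mul_sum, h, zsmul_eq_mul, map_mul, map_intCast,
          RingHom.id_apply]
        ring }
  let M := LinearMap.range f
  have hfM : ∀ (c : Fin 3 → ℤ) (d : J), y' * ∑ i, (c i : F) * b i +
      δ ^ 3 * algebraMap (𝓞 F) F d / β' ∈ M := fun c d => ⟨(c, d), rfl⟩
  let B : LinearMap.BilinForm ℚ F := (Algebra.traceForm ℚ F).compLeft (LinearMap.mulLeft ℚ (w * β'))
  have hB : ∀ x z, B x z = Algebra.trace ℚ F (w * β' * x * z) := fun x z => rfl
  have hsymm : B.IsSymm := ⟨fun x z => by rw [hB, hB, mul_right_comm]⟩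
  have hnondeg : B.Nondegenerate := by
    refine (LinearMap.IsRefl.nondegenerate_iff_separatingLeft hsymm.isRefl).mpr ?_
    intro x hx
    have := (traceForm_nondegenerate ℚ F).1 (w * β' * x) hx
    simpa [hwβ] using this
  have hb1 : ∀ c : Fin 3 → ℤ, δ * ∑ i, (c i : F) * b i =
      algebraMap (𝓞 F) F (∑ i, (c i : 𝓞 F) * b' i) := by
    intro c
    rw [map_sum, Finset.mul_sum]
    refine Finset.sum_congr rfl fun i _ => ?_
    rw [map_mul, hb', map_intCast]
    ring
  have hwG : ∀ c c' : Fin 3 → ℤ, ∃ n : ℤ, Algebra.trace ℚ F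
      (w * (∑ i, (c i : F) * b i) * ∑ i, (c' i : F) * b i) = n := by
    intro c c'
    refine ⟨∑ j, ∑ i, c i * c' j * G i j, ?_⟩
    rw [Finset.mul_sum, map_sum]
    push_cast
    refine Finset.sum_congr rfl fun j _ => ?_
    rw [Finset.mul_sum, Finset.sum_mul, map_sum]
    refine Finset.sum_congr rfl fun i _ => ?_
    have h : w * ((c i : F) * b i) * ((c' j : F) * b j) =
        ((c i * c' j : ℤ) : ℚ) • (w * b i * b j) := by
      rw [Algebra.smul_def]
      simp
      ring
    rw [h, map_smul, hG]
    simp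
  have hβJ : β ∈ J := by
    have h : β ∈ J ^ 2 := hJ ▸ Ideal.mem_span_singleton_self β
    exact Ideal.pow_le_self two_ne_zero h
  suffices h : ∃ x ≠ 0, B x x = 0 by
    obtain ⟨x, hx0, hx⟩ := h
    refine ⟨x, hx0, ?_⟩
    rw [hB] at hx
    rw [← hx]
    congr 1
    ring
  refine B.exists_isotropic_of_selfDual hF hsymm hnondeg (M := M)
    (Module.Finite.iff_fg.mp (Module.Finite.range f)) ?_ ?_ ?_ ?_ ?_
  · intro z
    obtain ⟨m, hm, hmz⟩ := IsAlgebraic.exists_integral_multiple 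
      ((IsFractionRing.isAlgebraic_iff ℤ ℚ F).mpr (IsAlgebraic.of_finite ℚ z))
    refine ⟨δ ^ 3 * m, mul_ne_zero (pow_ne_zero _ (by exact_mod_cast hδ)) hm, ?_⟩
    obtain ⟨a, ha⟩ : ∃ a : 𝓞 F, algebraMap (𝓞 F) F a = m • z := ⟨⟨m • z, hmz⟩, rfl⟩
    have h := hfM 0 ⟨β * a, Ideal.mul_mem_right _ _ hβJ⟩
    convert h using 1
    simp only [map_mul, ha, ← hβ', Pi.zero_apply, Int.cast_zero, zero_mul, Finset.sum_const_zero]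
    simp
    field_simp
  · rintro _ ⟨⟨c, d⟩, rfl⟩ _ ⟨⟨c', d'⟩, rfl⟩
    obtain ⟨s, hs⟩ : ∃ s, (d : 𝓞 F) * d' = β * s := by
      have : (d : 𝓞 F) * d' ∈ Ideal.span {β} := by
        rw [hJ, pow_two]
        exact Ideal.mul_mem_mul d.2 d'.2
      exact Ideal.mem_span_singleton.mp this
    have hs' := congr_arg (algebraMap (𝓞 F) F) hs
    rw [map_mul, map_mul] at hs'
    obtain ⟨n, hn⟩ := hwG c c'
    set l := ∑ i, (c i : F) * b i
    set l' := ∑ i, (c' i : F) * b i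
    obtain ⟨n', hn'⟩ := exists_trace_eq_intCast
      ((δ : 𝓞 F) ^ 9 * w' * t * (∑ i, (c i : 𝓞 F) * b' i) * (∑ i, (c' i : 𝓞 F) * b' i) +
        y * ((δ : 𝓞 F) * w' * ((∑ i, (c i : 𝓞 F) * b' i) * (d' : 𝓞 F) +
          (∑ i, (c' i : 𝓞 F) * b' i) * (d : 𝓞 F))) +
        (δ : 𝓞 F) ^ 5 * w' * s)
    refine ⟨n + n', ?_⟩
    rw [Int.cast_add, ← hn, ← hn', ← map_add, hB]
    congr 1
    simp only [map_add, map_mul, map_pow, map_natCast, ← hb1, hw', f, LinearMap.coe_mk,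
      AddHom.coe_mk]
    change w * β' * (y' * l + δ ^ 3 * algebraMap (𝓞 F) F d / β') *
      (y' * l' + δ ^ 3 * algebraMap (𝓞 F) F d' / β') = w * l * l' + _
    field_simp
    linear_combination (l * l' * β') * ht' + δ ^ 6 * hs'
  · intro z hz
    obtain ⟨c, hc⟩ := exists_int_combination_of_trace (by simpa using hF) b G hG hdet
      (β' * y' * z) (fun i => by
        obtain ⟨n, hn⟩ := hz _ (hfM (Pi.single i 1) 0)
        refine ⟨n, ?_⟩
        rw [← hn, hB]
        congr 1
        simp [Pi.single_apply]
        ring)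
    have hint : ∀ e ∈ J, ∃ a : 𝓞 F, (algebraMap (𝓞 F) F a) = δ ^ 5 * z * algebraMap (𝓞 F) F e := by
      intro e he
      obtain ⟨c, hc⟩ := exists_int_combination_of_trace (by simpa using hF) b G hG hdet
        (δ ^ 4 * z * algebraMap (𝓞 F) F e) (fun i => by
          obtain ⟨n, hn⟩ := hz _ (hfM 0 ⟨b' i * e, Ideal.mul_mem_left _ _ he⟩)
          refine ⟨n, ?_⟩
          rw [← hn, hB]
          congr 1
          simp [hb']
          field_simp)
      refine ⟨_, (hb1 c).symm.trans ?_⟩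
      rw [← hc]
      ring
    have hβ2 : β ∈ J * J := by
      rw [← pow_two, ← hJ]
      exact Ideal.mem_span_singleton_self β
    obtain ⟨j, hjJ, hj⟩ : ∃ j ∈ J, algebraMap (𝓞 F) F j = δ ^ 5 * z * algebraMap (𝓞 F) F β := by
      refine Submodule.mul_induction_on hβ2 ?_ ?_
      · intro e he e' he'
        obtain ⟨a, ha⟩ := hint e he
        refine ⟨a * e', Ideal.mul_mem_left _ _ he', ?_⟩
        rw [map_mul, ha, map_mul]
        ring
      · rintro e e' ⟨a, ha, h⟩ ⟨a', ha', h'⟩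
        refine ⟨a + a', add_mem ha ha', ?_⟩
        rw [map_add, map_add, h, h']
        ring
    have h := hfM c ⟨-(δ ^ 4 * t * j), neg_mem (Ideal.mul_mem_left _ _ hjJ)⟩
    convert h using 1
    rw [← hc]
    simp only [map_neg, map_mul, map_pow, map_natCast, hj]
    field_simp
    linear_combination (-z * β') * ht'
  · obtain ⟨x, hx⟩ := exists_trace_neg (w := -w) (by simpa using hw) hβ'0 hpos (by simp [htr])
    refine ⟨x, ?_⟩
    rw [hB]
    rw [neg_mul, neg_mul, map_neg] at hx
    rw [mul_assoc, ← pow_two]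
    linarith
  · obtain ⟨x, hx⟩ := exists_trace_neg hw hβ'0 hpos htr
    refine ⟨x, ?_⟩
    rwa [hB, mul_assoc, ← pow_two]

end TraceForm

section ParityScaling

open IsDedekindDomain

theorem isSquare_valuation_ringHom {E L : Type*} [Field E] [Field L] [NumberField E]
    [NumberField L] (σ : E →+* L) (v : HeightOneSpectrum (𝓞 E)) (w : HeightOneSpectrum (𝓞 L))
    (h : v.asIdeal = w.asIdeal.comap (RingOfIntegers.mapRingHom σ)) {a : E}
    (ha : IsSquare (v.valuation E a)) : IsSquare (w.valuation L (σ a)) := by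
  let _ := σ.toAlgebra
  have hv : w.asIdeal.LiesOver v.asIdeal := ⟨h⟩
  have := HeightOneSpectrum.valuation_liesOver L v w a
  rw [show σ a = algebraMap E L a from rfl, ← this]
  exact ha.pow _

theorem WithZero.isSquare_mul_of_not {x y : WithZero (Multiplicative ℤ)} (hx : ¬ IsSquare x)
    (hy : ¬ IsSquare y) : IsSquare (x * y) := by
  have key : ∀ x : WithZero (Multiplicative ℤ), x ≠ 0 → (IsSquare x ↔ Even (WithZero.log x)) := by
    intro x hx
    constructor
    · rintro ⟨r, rfl⟩
      have hr : r ≠ 0 := by rintro rfl; simp at hx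
      rw [WithZero.log_mul hr hr]
      exact ⟨_, rfl⟩
    · rintro ⟨r, hr⟩
      refine ⟨WithZero.exp r, ?_⟩
      rw [← WithZero.exp_add, ← hr, WithZero.exp_log hx]
  have hx0 : x ≠ 0 := by rintro rfl; exact hx ⟨0, by simp⟩
  have hy0 : y ≠ 0 := by rintro rfl; exact hy ⟨0, by simp⟩
  rw [key _ hx0] at hx
  rw [key _ hy0] at hy
  rw [key _ (mul_ne_zero hx0 hy0), WithZero.log_mul hx0 hy0]
  exact (Int.not_even_iff_odd.mp hx).add_odd (Int.not_even_iff_odd.mp hy)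

theorem IsSquare.of_mul_left_of_ne_zero {G : Type*} [CommGroupWithZero G] {x y : G}
    (hx : x ≠ 0) (h : IsSquare x) (hxy : IsSquare (x * y)) : IsSquare y := by
  have := hxy.div h
  rwa [mul_div_cancel_left₀ _ hx] at this

variable {L : Type*} [Field L] [NumberField L] [IsGalois ℚ L] {N : ℕ}

theorem isSquare_valuation_of_under_eq {a : L} (h : ∀ σ : L ≃ₐ[ℚ] L, EvenAway N (σ a * a))
    {w w' : HeightOneSpectrum (𝓞 L)} (hw : ((N : ℕ) : 𝓞 L) ∉ w'.asIdeal)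
    (hww' : w.under (𝓞 ℚ) = w'.under (𝓞 ℚ)) (hsq : IsSquare (w.valuation L a)) :
    IsSquare (w'.valuation L a) := by
  have hl : w.asIdeal.LiesOver (w.under (𝓞 ℚ)).asIdeal := ⟨rfl⟩
  have hl' : w'.asIdeal.LiesOver (w.under (𝓞 ℚ)).asIdeal := ⟨by rw [hww']; rfl⟩
  obtain ⟨σ, hσ⟩ := Ideal.exists_smul_eq_of_isGaloisGroup (w.under (𝓞 ℚ)).asIdeal w.asIdeal
    w'.asIdeal (L ≃ₐ[ℚ] L)
  have h1 : IsSquare (w'.valuation L (σ a)) := by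
    refine isSquare_valuation_ringHom (σ : L →+* L) w w' ?_ hsq
    rw [← hσ]
    ext x
    rw [Ideal.mem_comap]
    exact (Ideal.smul_mem_pointwise_smul_iff (a := σ)).symm
  have h2 := (h σ).2 w' hw
  rw [map_mul] at h2
  exact h1.of_mul_left_of_ne_zero (by
    have := (h σ).1
    intro h0
    apply left_ne_zero_of_mul this
    simpa using h0) h2

/-- If the ideal of `a` is Galois invariant modulo squares away from `N`, it becomes a square away
from `N` after scaling `a` by a rational number. -/
theorem exists_rat_mul_evenAway (hQ : ParityDescent ℚ L N) {a : L}
    (h : ∀ σ : L ≃ₐ[ℚ] L, EvenAway N (σ a * a)) :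
    ∃ r : ℚ, r ≠ 0 ∧ EvenAway N (algebraMap ℚ L r * a) := by
  have hfin : ∀ a : L, {w : HeightOneSpectrum (𝓞 L) | ((N : ℕ) : 𝓞 L) ∉ w.asIdeal ∧
      ¬ IsSquare (w.valuation L a)}.Finite := by
    intro a
    refine ((HeightOneSpectrum.Support.finite (𝓞 L) a).union
      (HeightOneSpectrum.Support.finite (𝓞 L) a⁻¹)).subset ?_
    rintro w ⟨-, hw⟩
    by_contra hn
    apply hw
    simp only [Set.mem_union, not_or] at hn
    have h1 : w.valuation L a ≤ 1 := not_lt.mp hn.1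
    have h2 : w.valuation L a⁻¹ ≤ 1 := not_lt.mp hn.2
    by_cases h0 : w.valuation L a = 0
    · rw [h0]; exact ⟨0, by simp⟩
    · rw [map_inv₀, inv_le_one₀ (zero_lt_iff.mpr h0)] at h2
      rw [le_antisymm h1 h2]
      exact IsSquare.one
  induction hn : {w : HeightOneSpectrum (𝓞 L) | ((N : ℕ) : 𝓞 L) ∉ w.asIdeal ∧
      ¬ IsSquare (w.valuation L a)}.ncard using Nat.strong_induction_on generalizing a with
  | _ n ih =>
  have ha0 : a ≠ 0 := right_ne_zero_of_mul (h 1).1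
  by_cases hall : ∀ w : HeightOneSpectrum (𝓞 L), ((N : ℕ) : 𝓞 L) ∉ w.asIdeal →
      IsSquare (w.valuation L a)
  · exact ⟨1, one_ne_zero, by simpa using ha0, by simpa using hall⟩
  push Not at hall
  obtain ⟨w, hw, hwa⟩ := hall
  have : IsPrincipalIdealRing (𝓞 ℚ) :=
    IsPrincipalIdealRing.of_surjective (Rat.ringOfIntegersEquiv.symm : ℤ →+* 𝓞 ℚ)
      Rat.ringOfIntegersEquiv.symm.surjective
  set v := w.under (𝓞 ℚ) with hv
  obtain ⟨p, hp⟩ := (IsPrincipalIdealRing.principal v.asIdeal).principal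
  have hp : v.asIdeal = Ideal.span {p} := hp
  have hp0 : p ≠ 0 := by
    rintro rfl
    apply v.ne_bot
    simpa using hp
  have hval : v.valuation ℚ (algebraMap (𝓞 ℚ) ℚ p) = WithZero.exp (-1) := by
    rw [HeightOneSpectrum.valuation_of_algebraMap]
    exact v.intValuation_singleton hp0 hp
  set q : ℚ := algebraMap (𝓞 ℚ) ℚ p with hq
  have hq0 : q ≠ 0 := by simpa [q] using hp0
  have hq0' : algebraMap ℚ L q ≠ 0 := by simpa using hq0
  have hqL : algebraMap ℚ L q = algebraMap (𝓞 L) L (algebraMap (𝓞 ℚ) (𝓞 L) p) := by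
    rw [hq, ← IsScalarTower.algebraMap_apply, ← IsScalarTower.algebraMap_apply]
  have hmem : ∀ w' : HeightOneSpectrum (𝓞 L), w'.under (𝓞 ℚ) ≠ v →
      w'.valuation L (algebraMap ℚ L q) = 1 := by
    intro w' hne
    rw [hqL, HeightOneSpectrum.valuation_of_algebraMap]
    refine le_antisymm (w'.intValuation_le_one _) (not_lt.mp fun hlt => hne ?_)
    rw [HeightOneSpectrum.intValuation_lt_one_iff_mem] at hlt
    refine (HeightOneSpectrum.ext (v.isMaximal.eq_of_le (w'.under (𝓞 ℚ)).isPrime.ne_top ?_)).symm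
    rw [hp, Ideal.span_singleton_le_iff_mem]
    exact hlt
  have hinv : ∀ M : ℕ, ∀ σ : L ≃ₐ[ℚ] L, EvenAway M (σ (algebraMap ℚ L q) * algebraMap ℚ L q) := by
    intro M σ
    rw [AlgEquiv.commutes]
    exact EvenAway.of_isSquare (mul_ne_zero hq0' hq0') ⟨_, rfl⟩
  have hnsq : ∀ w' : HeightOneSpectrum (𝓞 L), ((N : ℕ) : 𝓞 L) ∉ w'.asIdeal →
      w'.under (𝓞 ℚ) = v → ¬ IsSquare (w'.valuation L (algebraMap ℚ L q)) := by
    intro w' hw' hwv hsq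
    have h1 : EvenAway N q := by
      refine hQ q ⟨hq0', fun w'' hw'' => ?_⟩
      by_cases hv'' : w''.under (𝓞 ℚ) = v
      · exact isSquare_valuation_of_under_eq (hinv N) hw'' (hwv.trans hv''.symm) hsq
      · rw [hmem w'' hv'']
        exact IsSquare.one
    have h2 := h1.2 v (by
      intro hN
      apply hw
      have : ((N : ℕ) : 𝓞 ℚ) ∈ w.asIdeal.under (𝓞 ℚ) := hN
      simpa using this)
    rw [hval] at h2
    obtain ⟨r, hr⟩ := h2
    have hr0 : r ≠ 0 := by
      rintro rfl
      simp at hr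
    have := congr_arg WithZero.log hr
    rw [WithZero.log_mul hr0 hr0, WithZero.log_exp] at this
    omega
  have hinv' : ∀ σ : L ≃ₐ[ℚ] L,
      EvenAway N (σ (algebraMap ℚ L q * a) * (algebraMap ℚ L q * a)) := by
    intro σ
    have := (hinv N σ).mul (h σ)
    rwa [mul_mul_mul_comm, ← map_mul] at this
  suffices hlt : _ by
    obtain ⟨r, hr, hra⟩ := ih _ (hn ▸ Set.ncard_lt_ncard hlt (hfin a)) hinv' rfl
    exact ⟨r * q, mul_ne_zero hr hq0, by rwa [map_mul, mul_assoc]⟩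
  refine Set.ssubset_iff_subset_ne.mpr ⟨?_, ?_⟩
  · rintro w' ⟨hw', hw'a⟩
    refine ⟨hw', fun hsq => hw'a ?_⟩
    rw [map_mul]
    by_cases hv' : w'.under (𝓞 ℚ) = v
    · exact absurd (isSquare_valuation_of_under_eq h hw hv' hsq) hwa
    · rw [hmem w' hv', one_mul]
      exact hsq
  · intro heq
    have : w ∈ {w : HeightOneSpectrum (𝓞 L) | ((N : ℕ) : 𝓞 L) ∉ w.asIdeal ∧
      ¬ IsSquare (w.valuation L a)} := ⟨hw, hwa⟩
    rw [← heq] at this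
    apply this.2
    rw [map_mul]
    exact WithZero.isSquare_mul_of_not (hnsq w hw rfl) hwa

end ParityScaling

section UnitSquares

variable (F : Type*) [Field F] [NumberField F]

theorem NumberField.colorable_sq_eq_one {N k : ℕ} (hN : N ≠ 0) :
    Colorable {y : 𝓞 F | (N : 𝓞 F) ^ k ∣ y ^ 2 - 1} (fun y y' => (N : 𝓞 F) ^ k ∣ y - y')
      (2 ^ (N.primeFactors.card * Module.finrank ℚ F) * 2 ^ Module.finrank ℚ F) := by
  classical
  obtain ⟨hfin, hcard⟩ := NumberField.card_heightOneSpectrum_dvd_le F N hN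
  set n : 𝓞 F := (N : 𝓞 F) ^ k with hn
  have hn0 : n ≠ 0 := pow_ne_zero _ (by exact_mod_cast hN)
  have hle : ∀ (v : IsDedekindDomain.HeightOneSpectrum (𝓞 F)) (y : 𝓞 F), n ∣ y →
      v.intValuation y ≤ v.intValuation n := by
    rintro v _ ⟨c, rfl⟩
    rw [map_mul]
    exact mul_le_of_le_one_right' (v.intValuation_le_one c)
  have hone : ∀ v : IsDedekindDomain.HeightOneSpectrum (𝓞 F), (N : 𝓞 F) ∉ v.asIdeal →
      v.intValuation n = 1 := by
    intro v hv
    have : v.intValuation (N : 𝓞 F) = 1 :=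
      le_antisymm (v.intValuation_le_one _) (not_lt.1 (fun h => hv
        ((v.intValuation_lt_one_iff_mem _).1 h)))
    rw [hn, map_pow, this, one_pow]
  have hdvd : ∀ y : 𝓞 F, (∀ v : IsDedekindDomain.HeightOneSpectrum (𝓞 F),
      (N : 𝓞 F) ∈ v.asIdeal → v.intValuation y ≤ v.intValuation n) → n ∣ y := by
    intro y hy
    obtain ⟨z, hz⟩ := IsDedekindDomain.HeightOneSpectrum.mem_integers_of_valuation_le_one F
      (algebraMap (𝓞 F) F y / algebraMap (𝓞 F) F n) (fun v => by
        rw [map_div₀, v.valuation_of_algebraMap, v.valuation_of_algebraMap]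
        have h0 : v.intValuation n ≠ 0 := v.intValuation_ne_zero _ hn0
        rw [div_le_one₀ (zero_lt_iff.2 h0)]
        by_cases hv : (N : 𝓞 F) ∈ v.asIdeal
        · exact hy v hv
        · rw [hone v hv]
          exact v.intValuation_le_one y)
    refine ⟨z, FaithfulSMul.algebraMap_injective (𝓞 F) F ?_⟩
    have : algebraMap (𝓞 F) F n ≠ 0 := by simpa using hn0
    rw [map_mul, hz]
    field_simp
  have hor : ∀ (y : 𝓞 F), n ∣ y ^ 2 - 1 → ∀ v : IsDedekindDomain.HeightOneSpectrum (𝓞 F),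
      v.intValuation (2 * (y - 1)) ≤ v.intValuation n ∨
      v.intValuation (2 * (y + 1)) ≤ v.intValuation n := by
    intro y hy v
    have h := hle v _ hy
    rw [show y ^ 2 - 1 = (y - 1) * (y + 1) by ring, map_mul] at h
    have h2 : v.intValuation 2 ≤ max (v.intValuation (y + 1)) (v.intValuation (y - 1)) := by
      rw [show (2 : 𝓞 F) = (y + 1) - (y - 1) by ring]
      exact Valuation.map_sub _ _ _
    rcases le_max_iff.1 h2 with h2 | h2
    · left
      rw [map_mul, mul_comm]
      exact (mul_le_mul_right h2 _).trans h
    · right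
      rw [map_mul]
      exact (mul_le_mul_left h2 _).trans h
  refine Colorable.trans (R := fun y y' => n ∣ 2 * (y - y')) (by positivity) ?_ ?_
  · refine Colorable.of_finite (T := {v : IsDedekindDomain.HeightOneSpectrum (𝓞 F) //
      (N : 𝓞 F) ∈ v.asIdeal} → Bool)
      (fun y v => decide (v.1.intValuation (2 * (y - 1)) ≤ v.1.intValuation n)) ?_ ?_
    · rw [Nat.card_fun, Nat.card_eq_fintype_card (α := Bool), Fintype.card_bool]
      exact Nat.pow_le_pow_right two_pos hcard
    · intro y hy y' hy' h
      refine hdvd _ fun v hv => ?_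
      have hv' := congr_fun h ⟨v, hv⟩
      simp only [decide_eq_decide] at hv'
      by_cases h1 : v.intValuation (2 * (y - 1)) ≤ v.intValuation n
      · rw [show 2 * (y - y') = 2 * (y - 1) - 2 * (y' - 1) by ring]
        exact (Valuation.map_sub _ _ _).trans (max_le h1 (hv'.1 h1))
      · have h2 := (hor y hy v).resolve_left h1
        have h3 := (hor y' hy' v).resolve_left (fun h => h1 (hv'.2 h))
        rw [show 2 * (y - y') = 2 * (y + 1) - 2 * (y' + 1) by ring]
        exact (Valuation.map_sub _ _ _).trans (max_le h2 h3)
  · intro b hb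
    have hq : ∀ y : {y : 𝓞 F // n ∣ 2 * (y - b)}, ∃ q, 2 * (y.1 - b) = n * q := fun y => y.2
    choose q hq using hq
    have hfq : Finite (𝓞 F ⧸ Ideal.span {((2 : ℕ) : 𝓞 F)}) :=
      Ring.HasFiniteQuotients.finiteQuotient (by simp)
    refine Colorable.of_finite (T := 𝓞 F ⧸ Ideal.span {((2 : ℕ) : 𝓞 F)})
      (fun y => if h : n ∣ 2 * (y - b) then Ideal.Quotient.mk _ (q ⟨y, h⟩) else 0) ?_ ?_
    · rw [← Submodule.cardQuot_apply, ← Ideal.absNorm_apply, Ideal.absNorm_span_natCast,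
        RingOfIntegers.rank]
    · rintro y ⟨-, hy⟩ y' ⟨-, hy'⟩ h
      have hy : n ∣ 2 * (y - b) := hy
      have hy' : n ∣ 2 * (y' - b) := hy'
      simp only [dif_pos hy, dif_pos hy'] at h
      rw [Ideal.Quotient.eq, Ideal.mem_span_singleton] at h
      obtain ⟨c, hc⟩ := h
      have e1 := hq ⟨y, hy⟩
      have e2 := hq ⟨y', hy'⟩
      refine ⟨c, mul_left_cancel₀ (two_ne_zero (α := 𝓞 F)) ?_⟩
      push_cast at hc
      linear_combination e1 - e2 + n * hc

/-- The square classes of units modulo `N ^ k` are few. -/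
theorem NumberField.colorable_isCoprime {N : ℕ} (hN : N ≠ 0) (k : ℕ) :
    Colorable {x : 𝓞 F | IsCoprime x (N : 𝓞 F)}
      (fun x x' => ∃ y, (N : 𝓞 F) ^ k ∣ x * x' * y ^ 2 - 1)
      (2 ^ (N.primeFactors.card * Module.finrank ℚ F) * 2 ^ Module.finrank ℚ F) := by
  classical
  set n : 𝓞 F := (N : 𝓞 F) ^ k with hn
  have hn0 : n ≠ 0 := pow_ne_zero _ (by exact_mod_cast hN)
  have hfq : Finite (𝓞 F ⧸ Ideal.span {n}) :=
    Ring.HasFiniteQuotients.finiteQuotient (by simpa using hn0)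
  let f : (𝓞 F ⧸ Ideal.span {n})ˣ →* (𝓞 F ⧸ Ideal.span {n})ˣ := powMonoidHom 2
  have hsurj : ∀ a : (𝓞 F ⧸ Ideal.span {n})ˣ, ∃ y : 𝓞 F, Ideal.Quotient.mk (Ideal.span {n}) y = a :=
    fun a => Ideal.Quotient.mk_surjective _
  choose g hg using hsurj
  have hker : Nat.card f.ker ≤
      2 ^ (N.primeFactors.card * Module.finrank ℚ F) * 2 ^ Module.finrank ℚ F := by
    refine Colorable.card_le ((NumberField.colorable_sq_eq_one F hN (k := k)).comap
      (fun a => g a.1) ?_ ?_)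
    · rintro ⟨a, ha⟩ -
      have ha : a ^ 2 = 1 := ha
      change n ∣ _
      rw [← Ideal.mem_span_singleton, ← Ideal.Quotient.eq, map_pow, hg, map_one, ← Units.val_pow_eq_pow_val,
        ha, Units.val_one]
    · rintro ⟨a, ha⟩ - ⟨b, hb⟩ - h
      change n ∣ _ at h
      rw [← Ideal.mem_span_singleton, ← Ideal.Quotient.eq, hg, hg] at h
      exact Subtype.ext (Units.ext h)
  have hunit : ∀ x : 𝓞 F, IsCoprime x (N : 𝓞 F) →
      IsUnit (Ideal.Quotient.mk (Ideal.span {n}) x) := by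
    intro x hx
    obtain ⟨a, b, hab⟩ := hx.pow_right (n := k)
    refine IsUnit.of_mul_eq_one (Ideal.Quotient.mk _ a) ?_
    rw [← map_mul, ← map_one (Ideal.Quotient.mk (Ideal.span {n})), Ideal.Quotient.eq,
      Ideal.mem_span_singleton]
    exact ⟨-b, by linear_combination hab⟩
  refine Colorable.of_finite (T := (𝓞 F ⧸ Ideal.span {n})ˣ ⧸ f.range)
    (fun x => if h : IsUnit (Ideal.Quotient.mk (Ideal.span {n}) x) then
      (QuotientGroup.mk h.unit : (𝓞 F ⧸ Ideal.span {n})ˣ ⧸ f.range) else 1) ?_ ?_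
  · rw [← Subgroup.index, Subgroup.index_range]
    exact hker
  · intro x hx x' hx' h
    have hu := hunit x hx
    have hu' := hunit x' hx'
    simp only [dif_pos hu, dif_pos hu'] at h
    obtain ⟨z, hz⟩ := QuotientGroup.eq.1 h
    have hz : z ^ 2 = hu.unit⁻¹ * hu'.unit := hz
    refine ⟨g (z * hu'.unit⁻¹), ?_⟩
    rw [← Ideal.mem_span_singleton, ← Ideal.Quotient.eq, map_mul, map_pow, hg, map_mul, map_one]
    have key : hu.unit * hu'.unit * (z * hu'.unit⁻¹) ^ 2 = 1 := by
      rw [mul_pow, hz, inv_pow, pow_two]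
      simp [mul_assoc, mul_left_comm]
    simpa only [Units.val_mul, Units.val_pow_eq_pow_val, IsUnit.unit_spec, Units.val_one] using
      congr_arg Units.val key

end UnitSquares

/-- A Galois invariant algebraic integer is a rational integer. -/
theorem NumberField.exists_intCast_eq_of_forall_fixed {L : Type*} [Field L] [NumberField L]
    [IsGalois ℚ L] (a : 𝓞 L) (h : ∀ σ : L ≃ₐ[ℚ] L, σ a = a) : ∃ n : ℤ, a = n := by
  obtain ⟨r, hr⟩ := (IsGalois.mem_range_algebraMap_iff_fixed (F := ℚ) (a : L)).mpr h
  have hint : IsIntegral ℤ r := by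
    rw [← isIntegral_algebraMap_iff (FaithfulSMul.algebraMap_injective ℚ L), hr]
    exact a.isIntegral_coe
  obtain ⟨n, hn⟩ := IsIntegrallyClosed.isIntegral_iff.1 hint
  refine ⟨n, RingOfIntegers.ext ?_⟩
  rw [← hr, ← hn]
  simp

/-- An element of `F` which becomes integral in `L` is integral. -/
theorem NumberField.exists_algebraMap_eq_of_map {F L : Type*} [Field F] [Field L]
    [NumberField F] [NumberField L] (φ : F →+* L) {a : F} {z : 𝓞 L} (h : φ a = z) :
    ∃ z' : 𝓞 F, algebraMap (𝓞 F) F z' = a := by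
  have hint : IsIntegral ℤ a := by
    have : IsIntegral ℤ (φ.toIntAlgHom a) := by
      change IsIntegral ℤ (φ a)
      rw [h]
      exact z.isIntegral_coe
    exact (isIntegral_algHom_iff φ.toIntAlgHom φ.injective).1 this
  exact ⟨⟨a, hint⟩, rfl⟩

namespace QuarticSetup

variable {K L F : Type*} [Field K] [Field L] [Field F] [NumberField K] [NumberField L]
  [NumberField F] [Algebra K L] [Algebra F L] (S : QuarticSetup K L F)

/-- The conjugates of an element of the cubic field. -/
def conjF (k : Fin 4) : F →+* L :=
  (S.e.symm (Equiv.swap 1 k) : L →+* L).comp (algebraMap F L)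

theorem conjF_apply (k : Fin 4) (a : F) :
    S.conjF k a = S.e.symm (Equiv.swap 1 k) (algebraMap F L a) := rfl

theorem conjF_one (a : F) : S.conjF 1 a = algebraMap F L a := by
  rw [conjF_apply, Equiv.swap_self]
  have : S.e.symm (Equiv.refl (Fin 4)) = 1 := S.e.symm.map_one
  rw [this]
  rfl

theorem map_conjF {σ : L ≃ₐ[ℚ] L} {k k' : Fin 4}
    (h : PreservesPairing (Equiv.swap 1 k' * S.e σ * Equiv.swap 1 k)) (a : F) :
    σ (S.conjF k a) = S.conjF k' a := by
  have h := (S.mem_range_right (algebraMap F L a)).mp ⟨a, rfl⟩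
    ((S.e.symm (Equiv.swap 1 k'))⁻¹ * (σ * S.e.symm (Equiv.swap 1 k))) (by
      simpa [← mul_assoc] using h)
  rw [AlgEquiv.mul_apply, AlgEquiv.aut_inv, AlgEquiv.symm_apply_eq] at h
  exact h

/-- The sum of two roots. -/
def pairSum (k : Fin 4) : 𝓞 L := S.x 0 + S.x k

/-- The value at a root of the derivative of the resolvent cubic, with the other two roots
labelled `i` and `j`. -/
def derivVal (k i j : Fin 4) : 𝓞 L :=
  (S.x k - S.x i) * (S.x 0 - S.x j) * ((S.x k - S.x j) * (S.x 0 - S.x i))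

theorem exists_theta : ∃ θ : F, ∀ k, S.conjF k θ = ((S.pairSum k : 𝓞 L) : L) ^ 2 ∨ k = 0 := by
  have hx : (S.x 0 : L) + S.x 1 + S.x 2 + S.x 3 = 0 := by
    have := S.sum_x
    rw [Fin.sum_univ_four] at this
    exact_mod_cast congr_arg (algebraMap (𝓞 L) L) this
  obtain ⟨θ, hθ⟩ := (S.mem_range_right (((S.pairSum 1 : 𝓞 L) : L) ^ 2)).mpr (by
    intro σ hσ
    simp only [pairSum, map_add, map_pow, S.map_x]
    rcases hσ.cases with h | h | h | h | h | h | h | h <;> obtain ⟨h0, h1, h2, h3⟩ := h <;>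
      rw [h0, h1] <;> first | ring1 | linear_combination (-(S.x 0 + S.x 1 : L) + S.x 2 + S.x 3) * hx)
  refine ⟨θ, fun k => or_iff_not_imp_right.2 fun hk => ?_⟩
  rw [conjF_apply, hθ]
  simp only [pairSum, map_add, map_pow, S.map_x, MulEquiv.apply_symm_apply,
    Equiv.swap_apply_left]
  rw [Equiv.swap_apply_of_ne_of_ne (by decide) (Ne.symm hk)]

theorem exists_derivVal : ∃ f : F, S.conjF 1 f = S.derivVal 1 2 3 ∧
    S.conjF 2 f = S.derivVal 2 1 3 ∧ S.conjF 3 f = S.derivVal 3 2 1 := by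
  obtain ⟨f, hf⟩ := (S.mem_range_right ((S.derivVal 1 2 3 : 𝓞 L) : L)).mpr (by
    intro σ hσ
    simp only [derivVal, map_mul, map_sub, S.map_x]
    rcases hσ.cases with h | h | h | h | h | h | h | h <;> obtain ⟨h0, h1, h2, h3⟩ := h <;>
      rw [h0, h1, h2, h3] <;> ring)
  refine ⟨f, ?_, ?_, ?_⟩ <;> rw [conjF_apply, hf] <;>
    simp only [derivVal, map_mul, map_sub, S.map_x, MulEquiv.apply_symm_apply]
  all_goals
    simp [Equiv.swap_apply_def]

variable {S} {N : ℕ} (hN : S.IsBad N)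

theorem x_sub_ne_zero {i j : Fin 4} (h : i ≠ j) : S.x i - S.x j ≠ 0 :=
  sub_ne_zero.2 fun h' => h (S.injective_x h')

include hN in
theorem pairSum_ne_zero {k : Fin 4} (hk : k ≠ 0) : S.pairSum k ≠ 0 :=
  ne_zero_of_dvd_ne_zero (by exact_mod_cast hN.ne_zero) (hN.add_dvd k hk)

theorem pairSum_sq_sub (i j k : Fin 4) (h : S.x 0 + S.x i + S.x j + S.x k = 0) :
    S.pairSum i ^ 2 - S.pairSum j ^ 2 = (S.x i - S.x j) * (S.x 0 - S.x k) := by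
  simp only [pairSum]
  linear_combination (S.x i - S.x j) * h

theorem conjF_injective : ∀ k l : Fin 4, k ≠ 0 → l ≠ 0 → S.conjF k = S.conjF l → k = l := by
  obtain ⟨θ, hθ⟩ := S.exists_theta
  intro k l hk hl h
  by_contra hkl
  obtain ⟨m, hm⟩ : ∃ m : Fin 4, m ≠ 0 ∧ ∀ (f : Fin 4 → 𝓞 L), ∑ i, f i = f 0 + f k + f l + f m := by
    have : ∀ k l : Fin 4, k ≠ 0 → l ≠ 0 → k ≠ l → ∃ m : Fin 4, m ≠ 0 ∧
      (Finset.univ : Finset (Fin 4)) = {0, k, l, m} ∧ m ≠ k ∧ m ≠ l := by decide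
    obtain ⟨m, hm, h2, h3, h4⟩ := this k l hk hl hkl
    refine ⟨m, hm, fun f => ?_⟩
    rw [h2, Finset.sum_insert, Finset.sum_insert, Finset.sum_insert, Finset.sum_singleton]
    · ring
    all_goals simp [hk.symm, hl.symm, hm.symm, hkl, h3.symm, h4.symm]
  have h1 := DFunLike.congr_fun h θ
  rw [(hθ k).resolve_right hk, (hθ l).resolve_right hl] at h1
  have h2 := pairSum_sq_sub (S := S) k l m ((hm.2 S.x).symm.trans S.sum_x)
  rw [show S.pairSum k ^ 2 - S.pairSum l ^ 2 = 0 from sub_eq_zero.2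
    (RingOfIntegers.ext (by exact_mod_cast h1))] at h2
  exact mul_ne_zero (x_sub_ne_zero hkl) (x_sub_ne_zero hm.1.symm) h2.symm

variable (S) in
theorem trace_eq_sum_conjF (hF : Module.finrank ℚ F = 3) (a : F) :
    algebraMap ℚ L (Algebra.trace ℚ F a) = S.conjF 1 a + S.conjF 2 a + S.conjF 3 a := by
  obtain ⟨φ⟩ : Nonempty (L →+* ℂ) := inferInstance
  apply φ.injective
  let g : Fin 3 → (F →+* ℂ) := fun k => φ.comp (S.conjF k.succ)
  have hg : Function.Injective g := by
    intro k l h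
    refine Fin.succ_injective _ (conjF_injective (S := S) _ _ (Fin.succ_ne_zero _) (Fin.succ_ne_zero _) ?_)
    ext a
    exact φ.injective (DFunLike.congr_fun h a)
  have hb : Function.Bijective g := by
    rw [Fintype.bijective_iff_injective_and_card]
    exact ⟨hg, by rw [NumberField.Embeddings.card, hF, Fintype.card_fin]⟩
  rw [eq_ratCast, map_ratCast, NumberField.trace_eq_sum_ringHom,
    ← Function.Bijective.sum_comp hb (fun φ : F →+* ℂ => φ a), Fin.sum_univ_three]
  simp [g]

end QuarticSetup

section Lagrange

variable {L : Type*} [Field L] {t₁ t₂ t₃ : L} (h₁₂ : t₁ - t₂ ≠ 0) (h₁₃ : t₁ - t₃ ≠ 0)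
  (h₂₃ : t₂ - t₃ ≠ 0)

include h₁₂ h₁₃ h₂₃

theorem lagrange_sum_eq (P : L → L) (c : L) (h : P t₁ * (t₂ - t₃) - P t₂ * (t₁ - t₃) +
    P t₃ * (t₁ - t₂) = c * ((t₁ - t₂) * (t₁ - t₃) * (t₂ - t₃))) :
    P t₁ / ((t₁ - t₂) * (t₁ - t₃)) + P t₂ / ((t₂ - t₁) * (t₂ - t₃)) +
      P t₃ / ((t₃ - t₂) * (t₃ - t₁)) = c := by
  rw [show t₂ - t₁ = -(t₁ - t₂) by ring, show t₃ - t₂ = -(t₂ - t₃) by ring,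
    show t₃ - t₁ = -(t₁ - t₃) by ring]
  generalize t₁ - t₂ = a, t₁ - t₃ = b, t₂ - t₃ = d at *
  field_simp
  linear_combination h

end Lagrange

namespace QuarticSetup

variable {K L F : Type*} [Field K] [Field L] [Field F] [NumberField K] [NumberField L]
  [NumberField F] [Algebra K L] [Algebra F L] {S : QuarticSetup K L F} {N : ℕ} (hN : S.IsBad N)

variable (S) in
theorem sum_x_eq_zero : S.x 0 + S.x 1 + S.x 2 + S.x 3 = 0 := by
  rw [← Fin.sum_univ_four, S.sum_x]

variable (S) in
theorem exists_prod_pairSum_eq_intCast [IsGalois ℚ L] :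
    ∃ q : ℤ, S.pairSum 1 * S.pairSum 2 * S.pairSum 3 = q := by
  refine NumberField.exists_intCast_eq_of_forall_fixed _ fun σ => ?_
  have key : ∀ y : L, y = ((S.pairSum 1 * S.pairSum 2 * S.pairSum 3 : 𝓞 L) : L) →
      y + y + y = ∑ i, (S.x i : L) ^ 3 := by
    rintro _ rfl
    have h : ∀ y : 𝓞 L, y = S.pairSum 1 * S.pairSum 2 * S.pairSum 3 →
        y + y + y = ∑ i, S.x i ^ 3 := by
      rintro _ rfl
      have h := S.sum_x_eq_zero
      rw [Fin.sum_univ_four]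
      simp only [pairSum]
      have h3 : S.x 3 = -(S.x 0 + S.x 1 + S.x 2) := by linear_combination h
      rw [h3]
      ring
    have := congr_arg (algebraMap (𝓞 L) L) (h _ rfl)
    simpa only [map_add, map_sum, map_pow] using this
  have h1 := key _ rfl
  have h2 := congr_arg σ h1
  apply mul_left_cancel₀ (three_ne_zero (α := L))
  have h3 : σ (∑ i, (S.x i : L) ^ 3) = ∑ i, (S.x i : L) ^ 3 := by
    simp only [map_sum, map_pow, S.map_x]
    exact Equiv.sum_comp (S.e σ) (fun i => (S.x i : L) ^ 3)
  simp only [map_add] at h2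
  linear_combination h2 - h1 + h3

include hN in
theorem derivVal_dvd {k i j : Fin 4} (hki : k ≠ i) (hj : 0 ≠ j) (hkj : k ≠ j) (hi : 0 ≠ i) :
    S.derivVal k i j ∣ (N : 𝓞 L) ^ 4 := by
  rw [show (N : 𝓞 L) ^ 4 = N * N * (N * N) by ring]
  exact mul_dvd_mul (mul_dvd_mul (hN.sub_dvd _ _ hki) (hN.sub_dvd _ _ hj))
    (mul_dvd_mul (hN.sub_dvd _ _ hkj) (hN.sub_dvd _ _ hi))

theorem derivVal_ne_zero {k i j : Fin 4} (hki : k ≠ i) (hj : 0 ≠ j) (hkj : k ≠ j) (hi : 0 ≠ i) :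
    S.derivVal k i j ≠ 0 :=
  mul_ne_zero (mul_ne_zero (x_sub_ne_zero hki) (x_sub_ne_zero hj))
    (mul_ne_zero (x_sub_ne_zero hkj) (x_sub_ne_zero hi))

variable (S) in
theorem trace_eq_of_conjF (hF : Module.finrank ℚ F = 3) (a : F) (c : ℤ)
    (h : S.conjF 1 a + S.conjF 2 a + S.conjF 3 a = c) : Algebra.trace ℚ F a = c := by
  apply (algebraMap ℚ L).injective
  rw [S.trace_eq_sum_conjF hF, h]
  simp

include hN in
/-- The two ternary quadratic forms attached to `β` are isotropic as soon as `β` generates the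
square of an ideal, is a square modulo a high power of `N`, and is positive at the real places. -/
theorem exists_conjF_isotropic [IsGalois ℚ L] (hF : Module.finrank ℚ F = 3) {β y : 𝓞 F}
    {J : Ideal (𝓞 F)} (hβ0 : β ≠ 0) (hJ : Ideal.span {β} = J ^ 2)
    (hy : (N : 𝓞 F) ^ 48 ∣ β * y ^ 2 - 1)
    (hpos : ∀ φ : F →+* ℂ, ComplexEmbedding.IsReal φ → 0 ≤ (φ (algebraMap (𝓞 F) F β)).re) :
    (∃ x : F, x ≠ 0 ∧
      S.conjF 1 β * S.conjF 1 x ^ 2 / S.derivVal 1 2 3 +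
      S.conjF 2 β * S.conjF 2 x ^ 2 / S.derivVal 2 1 3 +
      S.conjF 3 β * S.conjF 3 x ^ 2 / S.derivVal 3 2 1 = 0) ∧
    (∃ x : F, x ≠ 0 ∧
      S.conjF 1 β * (S.pairSum 1 : L) ^ 2 * S.conjF 1 x ^ 2 / S.derivVal 1 2 3 +
      S.conjF 2 β * (S.pairSum 2 : L) ^ 2 * S.conjF 2 x ^ 2 / S.derivVal 2 1 3 +
      S.conjF 3 β * (S.pairSum 3 : L) ^ 2 * S.conjF 3 x ^ 2 / S.derivVal 3 2 1 = 0) := by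
  obtain ⟨θ, hθ⟩ := S.exists_theta
  obtain ⟨f, hf1, hf2, hf3⟩ := S.exists_derivVal
  obtain ⟨q, hq⟩ := S.exists_prod_pairSum_eq_intCast
  have hθ1 := (hθ 1).resolve_right (by decide)
  have hθ2 := (hθ 2).resolve_right (by decide)
  have hθ3 := (hθ 3).resolve_right (by decide)
  have hu1 := pairSum_ne_zero hN (k := 1) (by decide)
  have hu2 := pairSum_ne_zero hN (k := 2) (by decide)
  have hu3 := pairSum_ne_zero hN (k := 3) (by decide)
  have hu1' : (S.pairSum 1 : L) ≠ 0 := by exact_mod_cast hu1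
  have hu2' : (S.pairSum 2 : L) ≠ 0 := by exact_mod_cast hu2
  have hu3' : (S.pairSum 3 : L) ≠ 0 := by exact_mod_cast hu3
  obtain ⟨z, hz⟩ := derivVal_dvd hN (k := 1) (i := 2) (j := 3) (by decide) (by decide) (by decide)
    (by decide)
  obtain ⟨c, hc⟩ : S.pairSum 1 ∣ (N : 𝓞 L) := hN.add_dvd 1 (by decide)
  have hx := S.sum_x_eq_zero
  have e12 := pairSum_sq_sub (S := S) 1 2 3 hx
  have e13 := pairSum_sq_sub (S := S) 1 3 2 (by linear_combination hx)
  have e23 := pairSum_sq_sub (S := S) 2 3 1 (by linear_combination hx)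
  have n12 : S.pairSum 1 ^ 2 - S.pairSum 2 ^ 2 ≠ 0 :=
    e12 ▸ mul_ne_zero (x_sub_ne_zero (by decide)) (x_sub_ne_zero (by decide))
  have n13 : S.pairSum 1 ^ 2 - S.pairSum 3 ^ 2 ≠ 0 :=
    e13 ▸ mul_ne_zero (x_sub_ne_zero (by decide)) (x_sub_ne_zero (by decide))
  have n23 : S.pairSum 2 ^ 2 - S.pairSum 3 ^ 2 ≠ 0 :=
    e23 ▸ mul_ne_zero (x_sub_ne_zero (by decide)) (x_sub_ne_zero (by decide))
  have d1 : S.derivVal 1 2 3 = (S.pairSum 1 ^ 2 - S.pairSum 2 ^ 2) *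
      (S.pairSum 1 ^ 2 - S.pairSum 3 ^ 2) := by
    rw [e12, e13]; rfl
  have d2 : S.derivVal 2 1 3 = (S.pairSum 2 ^ 2 - S.pairSum 1 ^ 2) *
      (S.pairSum 2 ^ 2 - S.pairSum 3 ^ 2) := by
    rw [← neg_sub, e12, e23, derivVal]; ring
  have d3 : S.derivVal 3 2 1 = (S.pairSum 3 ^ 2 - S.pairSum 2 ^ 2) *
      (S.pairSum 3 ^ 2 - S.pairSum 1 ^ 2) := by
    rw [← neg_sub, e23, ← neg_sub (S.pairSum 1 ^ 2), e13, derivVal]; ring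
  have hf0 : f ≠ 0 := by
    rintro rfl
    rw [map_zero] at hf1
    exact derivVal_ne_zero (S := S) (k := 1) (i := 2) (j := 3) (by decide) (by decide) (by decide)
      (by decide) (RingOfIntegers.ext (by exact_mod_cast hf1.symm))
  have hθ0 : θ ≠ 0 := by
    rintro rfl
    rw [map_zero] at hθ1
    exact pow_ne_zero 2 hu1' hθ1.symm
  have hNL : (N : L) = S.pairSum 1 * c := by exact_mod_cast congr_arg (algebraMap (𝓞 L) L) hc
  have hzL : (N : L) ^ 4 = S.derivVal 1 2 3 * z := by
    exact_mod_cast congr_arg (algebraMap (𝓞 L) L) hz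
  have hd0 : ((S.derivVal 1 2 3 : 𝓞 L) : L) ≠ 0 := by rw [← hf1]; simpa using hf0
  have hqL : (q : L) = S.pairSum 1 * S.pairSum 2 * S.pairSum 3 := by
    simpa only [map_mul, map_intCast] using (congr_arg (algebraMap (𝓞 L) L) hq).symm
  have D1 : ((S.derivVal 1 2 3 : 𝓞 L) : L) = _ := congr_arg (algebraMap (𝓞 L) L) d1
  have D2 : ((S.derivVal 2 1 3 : 𝓞 L) : L) = _ := congr_arg (algebraMap (𝓞 L) L) d2
  have D3 : ((S.derivVal 3 2 1 : 𝓞 L) : L) = _ := congr_arg (algebraMap (𝓞 L) L) d3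
  have N12 : ((S.pairSum 1 : 𝓞 L) : L) ^ 2 - (S.pairSum 2 : L) ^ 2 ≠ 0 := by
    simpa only [map_sub, map_pow] using RingOfIntegers.coe_ne_zero_iff.2 n12
  have N13 : ((S.pairSum 1 : 𝓞 L) : L) ^ 2 - (S.pairSum 3 : L) ^ 2 ≠ 0 := by
    simpa only [map_sub, map_pow] using RingOfIntegers.coe_ne_zero_iff.2 n13
  have N23 : ((S.pairSum 2 : 𝓞 L) : L) ^ 2 - (S.pairSum 3 : L) ^ 2 ≠ 0 := by
    simpa only [map_sub, map_pow] using RingOfIntegers.coe_ne_zero_iff.2 n23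
  simp only [map_mul, map_sub, map_pow] at D1 D2 D3
  have lag : ∀ (P : L → L) (c : L), P ((S.pairSum 1 : L) ^ 2) *
      ((S.pairSum 2 : L) ^ 2 - (S.pairSum 3 : L) ^ 2) - P ((S.pairSum 2 : L) ^ 2) *
      ((S.pairSum 1 : L) ^ 2 - (S.pairSum 3 : L) ^ 2) + P ((S.pairSum 3 : L) ^ 2) *
      ((S.pairSum 1 : L) ^ 2 - (S.pairSum 2 : L) ^ 2) =
        c * (((S.pairSum 1 : L) ^ 2 - (S.pairSum 2 : L) ^ 2) *
          ((S.pairSum 1 : L) ^ 2 - (S.pairSum 3 : L) ^ 2) *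
          ((S.pairSum 2 : L) ^ 2 - (S.pairSum 3 : L) ^ 2)) →
      P ((S.pairSum 1 : L) ^ 2) / S.derivVal 1 2 3 + P ((S.pairSum 2 : L) ^ 2) / S.derivVal 2 1 3 +
        P ((S.pairSum 3 : L) ^ 2) / S.derivVal 3 2 1 = c := by
    intro P c h
    rw [D1, D2, D3]
    exact lagrange_sum_eq N12 N13 N23 P c h
  obtain ⟨s, hs⟩ : ∃ s : ℤ, ((S.pairSum 1 : 𝓞 L) : L) ^ 2 + (S.pairSum 2 : L) ^ 2 +
      (S.pairSum 3 : L) ^ 2 = s := by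
    obtain ⟨θ', hθ'⟩ := NumberField.exists_algebraMap_eq_of_map (S.conjF 1) (a := θ)
      (z := S.pairSum 1 ^ 2) (by rw [hθ1]; simp)
    obtain ⟨n, hn⟩ := NumberField.exists_trace_eq_intCast θ'
    refine ⟨n, ?_⟩
    have := S.trace_eq_sum_conjF hF θ
    rw [hθ1, hθ2, hθ3, ← hθ', hn] at this
    rw [← this]
    simp
  have tr : ∀ (P : L → L) (a : F) (n : ℤ), (∀ k, S.conjF k a = P (S.conjF k θ) / S.conjF k f) →
      P ((S.pairSum 1 : L) ^ 2) / S.derivVal 1 2 3 + P ((S.pairSum 2 : L) ^ 2) / S.derivVal 2 1 3 +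
      P ((S.pairSum 3 : L) ^ 2) / S.derivVal 3 2 1 = n → Algebra.trace ℚ F a = n := by
    intro P a n h hsum
    refine S.trace_eq_of_conjF hF _ _ ?_
    rw [h, h, h, hθ1, hθ2, hθ3, hf1, hf2, hf3, hsum]
  have htr : ∀ (m : ℕ) (n : ℤ), ((S.pairSum 1 : L) ^ 2) ^ m / S.derivVal 1 2 3 +
      ((S.pairSum 2 : L) ^ 2) ^ m / S.derivVal 2 1 3 +
      ((S.pairSum 3 : L) ^ 2) ^ m / S.derivVal 3 2 1 = n → Algebra.trace ℚ F (θ ^ m / f) = n :=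
    fun m n h => tr (fun t => t ^ m) _ n (fun k => by simp) h
  obtain ⟨h, hh⟩ : ∃ h : ℤ, ((S.pairSum 1 : L) ^ 2) ^ 4 / S.derivVal 1 2 3 +
      ((S.pairSum 2 : L) ^ 2) ^ 4 / S.derivVal 2 1 3 +
      ((S.pairSum 3 : L) ^ 2) ^ 4 / S.derivVal 3 2 1 = h := by
    have h1 := lag (fun t => t ^ 4) (((S.pairSum 1 ^ 4 + S.pairSum 2 ^ 4 + S.pairSum 3 ^ 4 +
      S.pairSum 1 ^ 2 * S.pairSum 2 ^ 2 + S.pairSum 1 ^ 2 * S.pairSum 3 ^ 2 +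
      S.pairSum 2 ^ 2 * S.pairSum 3 ^ 2 : 𝓞 L)) : L) (by
        simp only [map_add, map_mul, map_pow]; ring)
    beta_reduce at h1
    rw [h1]
    have h2 := S.trace_eq_sum_conjF hF (θ ^ 4 / f)
    simp only [map_div₀, map_pow, hθ1, hθ2, hθ3, hf1, hf2, hf3] at h2
    rw [h1] at h2
    obtain ⟨n, hn⟩ := NumberField.exists_intCast_eq_of_forall_fixed _ (fun σ => by
      rw [← h2]; exact σ.commutes _)
    refine ⟨n, ?_⟩
    rw [hn]
    exact map_intCast (algebraMap (𝓞 L) L) n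
  have tr0 : Algebra.trace ℚ F (θ ^ 0 / f) = (0 : ℤ) := htr 0 0 (by
    simpa using lag (fun t => 1) 0 (by ring))
  have tr1 : Algebra.trace ℚ F (θ ^ 1 / f) = (0 : ℤ) := htr 1 0 (by
    simpa using lag (fun t => t) 0 (by ring))
  have tr2 : Algebra.trace ℚ F (θ ^ 2 / f) = (1 : ℤ) := htr 2 1 (by
    simpa using lag (fun t => t ^ 2) 1 (by ring))
  have tr3 : Algebra.trace ℚ F (θ ^ 3 / f) = s := htr 3 s (by
    rw [← hs]; exact lag (fun t => t ^ 3) _ (by ring))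
  have tr4 : Algebra.trace ℚ F (θ ^ 4 / f) = h := htr 4 h hh
  have hq0 : (q : L) ≠ 0 := by
    rw [hqL]; exact mul_ne_zero (mul_ne_zero hu1' hu2') hu3'
  have trq : Algebra.trace ℚ F (q ^ 2 / θ / f) = (1 : ℤ) :=
    tr (fun t => q ^ 2 / t) _ 1 (fun k => by simp) (by
      refine lag (fun t => q ^ 2 / t) _ ?_
      rw [hqL]
      push_cast
      field_simp
      ring)
  have trq0 : Algebra.trace ℚ F (q / f) = (0 : ℤ) := tr (fun t => q) _ 0 (fun k => by simp) (by
    simpa using lag (fun t => q) 0 (by ring))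
  have trq1 : Algebra.trace ℚ F (q * θ / f) = (0 : ℤ) := tr (fun t => q * t) _ 0 (fun k => by simp) (by
    simpa using lag (fun t => q * t) 0 (by ring))
  have hδ : N ^ 4 ≠ 0 := pow_ne_zero _ hN.ne_zero
  have hy' : ((N ^ 4 : ℕ) : 𝓞 F) ^ 12 ∣ β * y ^ 2 - 1 := by
    rwa [Nat.cast_pow, ← pow_mul]
  have conv : ∀ w x : F, Algebra.trace ℚ F (w * β * x ^ 2) = 0 →
      S.conjF 1 w * S.conjF 1 β * S.conjF 1 x ^ 2 + S.conjF 2 w * S.conjF 2 β * S.conjF 2 x ^ 2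
        + S.conjF 3 w * S.conjF 3 β * S.conjF 3 x ^ 2 = 0 := by
    intro w x h
    have := S.trace_eq_sum_conjF hF (w * β * x ^ 2)
    simpa only [map_mul, map_pow, h, map_zero, eq_comm] using this
  have int : ∀ (a : F) (z : 𝓞 L), S.conjF 1 a = z → ∃ z' : 𝓞 F, algebraMap (𝓞 F) F z' = a :=
    fun a z h => NumberField.exists_algebraMap_eq_of_map _ h
  constructor
  · obtain ⟨w', hw'⟩ := int (((N ^ 4 : ℕ) : F) * (1 / f)) z (by
      simp only [map_mul, map_natCast, map_div₀, map_one, hf1, Nat.cast_pow, map_pow]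
      rw [hzL]; field_simp)
    have hb : ∀ i : Fin 3, ∃ b : 𝓞 F, algebraMap (𝓞 F) F b = ((N ^ 4 : ℕ) : F) * θ ^ (i : ℕ) :=
      fun i => int _ (N ^ 4 * (S.pairSum 1 ^ 2) ^ (i : ℕ)) (by
        simp only [map_mul, map_natCast, hθ1, Nat.cast_pow, map_pow])
    choose b' hb' using hb
    obtain ⟨x, hx0, hx⟩ := NumberField.exists_trace_isotropic hF (w := 1 / f) (by simpa using hf0)
      (fun i => θ ^ (i : ℕ)) (Matrix.of fun i j => [0, 0, 1, s, h].getD ((i : ℕ) + j) 0)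
      (fun i j => by
        rw [show 1 / f * θ ^ (i : ℕ) * θ ^ (j : ℕ) = θ ^ ((i : ℕ) + j) / f by ring]
        fin_cases i <;> fin_cases j <;> first | exact tr0 | exact tr1 | exact tr2 | exact tr3 | exact tr4)
      (by simp [Matrix.det_fin_three]) (by simpa using tr0) hδ hw' hb' hβ0 hJ hy' hpos
    refine ⟨x, hx0, ?_⟩
    have := conv _ _ hx
    simp only [map_div₀, map_one, hf1, hf2, hf3] at this
    linear_combination this
  · obtain ⟨w', hw'⟩ := int (((N ^ 4 : ℕ) : F) * (θ / f)) (S.pairSum 1 ^ 2 * z) (by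
      simp only [map_mul, map_natCast, map_div₀, hθ1, hf1, Nat.cast_pow, map_pow]
      rw [hzL]; field_simp)
    obtain ⟨b₀, hb₀⟩ := int (((N ^ 4 : ℕ) : F) * 1) (N ^ 4) (by simp)
    obtain ⟨b₁, hb₁⟩ := int (((N ^ 4 : ℕ) : F) * θ) (N ^ 4 * S.pairSum 1 ^ 2) (by simp [hθ1])
    obtain ⟨b₂, hb₂⟩ := int (((N ^ 4 : ℕ) : F) * (q / θ))
      (N ^ 3 * (c * S.pairSum 2 * S.pairSum 3)) (by
        simp only [map_mul, map_natCast, map_div₀, map_intCast, hθ1, Nat.cast_pow, map_pow, hNL, hqL]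
        field_simp)
    obtain ⟨x, hx0, hx⟩ := NumberField.exists_trace_isotropic hF (w := θ / f)
      (div_ne_zero hθ0 hf0) ![1, θ, q / θ] !![0, 1, 0; 1, s, 0; 0, 0, 1] (fun i j => by
        have e : ∀ {a b : F} {n : ℤ}, Algebra.trace ℚ F b = n → a = b →
          Algebra.trace ℚ F a = n := fun h h' => h' ▸ h
        fin_cases i <;> fin_cases j <;>
          first
          | (refine e tr1 ?_; simp; done)
          | (refine e tr2 ?_; simp; ring1)
          | (refine e tr3 ?_; simp; ring1)
          | (refine e trq0 ?_; simp; field_simp; done)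
          | (refine e trq1 ?_; simp; field_simp; done)
          | (refine e trq ?_; simp; field_simp; done))
      (by simp [Matrix.det_fin_three]) (by simpa using tr1) hδ hw' (b' := ![b₀, b₁, b₂])
      (fun i => by fin_cases i <;> assumption) hβ0 hJ hy' hpos
    refine ⟨x, hx0, ?_⟩
    have := conv _ _ hx
    simp only [map_div₀, hθ1, hθ2, hθ3, hf1, hf2, hf3] at this
    linear_combination this

end QuarticSetup

theorem EvenAway.of_dvd_pow {L : Type*} [Field L] [NumberField L] {N k : ℕ} (hN : N ≠ 0) {x : 𝓞 L}
    (h : x ∣ (N : 𝓞 L) ^ k) : EvenAway N (x : L) := by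
  have hx : x ≠ 0 := ne_zero_of_dvd_ne_zero (pow_ne_zero _ (by exact_mod_cast hN)) h
  refine ⟨RingOfIntegers.coe_ne_zero_iff.2 hx, fun v hv => ?_⟩
  have : v.intValuation x = 1 := by
    refine le_antisymm (v.intValuation_le_one _) (not_lt.1 fun hlt => hv ?_)
    rw [v.intValuation_lt_one_iff_mem] at hlt
    exact v.isPrime.mem_of_pow_mem _ (v.asIdeal.mem_of_dvd h hlt)
  rw [v.valuation_of_algebraMap, this]
  exact IsSquare.one

theorem EvenAway.map_algEquiv {L : Type*} [Field L] [NumberField L] {N : ℕ} {a : L}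
    (h : EvenAway N a) (σ : L ≃ₐ[ℚ] L) : EvenAway N (σ a) :=
  @EvenAway.map L L _ _ _ _ (σ : L →+* L).toAlgebra N a h

namespace QuarticSetup

variable {K L F : Type*} [Field K] [Field L] [Field F] [NumberField K] [NumberField L]
  [NumberField F] [Algebra K L] [Algebra F L] {S : QuarticSetup K L F} {N : ℕ} (hN : S.IsBad N)

variable (S) in
theorem evenAway_conjF {a : F} (ha : EvenAway N a) (k : Fin 4) : EvenAway N (S.conjF k a) :=
  @EvenAway.map F L _ _ _ _ (S.conjF k).toAlgebra N a ha

theorem map_conjF_of_fix {σ : L ≃ₐ[ℚ] L} (h0 : S.e σ 0 = 0) {k : Fin 4} (hk : k ≠ 0) (a : F) :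
    σ (S.conjF k a) = S.conjF (S.e σ k) a := by
  apply S.map_conjF
  have hk' : S.e σ k ≠ 0 := fun h => hk ((S.e σ).injective (h.trans h0.symm))
  have h1 : (Equiv.swap 1 (S.e σ k) * S.e σ * Equiv.swap 1 k) 0 = 0 := by
    simp only [Equiv.Perm.mul_apply]
    rw [Equiv.swap_apply_of_ne_of_ne (by decide) hk.symm, h0,
      Equiv.swap_apply_of_ne_of_ne (by decide) hk'.symm]
  have h2 : (Equiv.swap 1 (S.e σ k) * S.e σ * Equiv.swap 1 k) 1 = 1 := by
    simp
  unfold PreservesPairing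
  rw [h1, h2]
  decide

theorem perm_cases_of_fix : ∀ g : Equiv.Perm (Fin 4), g 0 = 0 →
    (g 1 = 1 ∧ g 2 = 2 ∧ g 3 = 3) ∨ (g 1 = 1 ∧ g 2 = 3 ∧ g 3 = 2) ∨
    (g 1 = 2 ∧ g 2 = 1 ∧ g 3 = 3) ∨ (g 1 = 2 ∧ g 2 = 3 ∧ g 3 = 1) ∨
    (g 1 = 3 ∧ g 2 = 1 ∧ g 3 = 2) ∨ (g 1 = 3 ∧ g 2 = 2 ∧ g 3 = 1) := by
  decide

theorem mul_eq_of_isotropic {E : Type*} [Field E] {A₁ A₂ A₃ u₁ u₂ u₃ x₁ x₂ x₃ z₁ z₂ z₃ : E}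
    (h : A₁ * x₁ ^ 2 + A₂ * x₂ ^ 2 + A₃ * x₃ ^ 2 = 0)
    (h' : A₁ * u₁ ^ 2 * z₁ ^ 2 + A₂ * u₂ ^ 2 * z₂ ^ 2 + A₃ * u₃ ^ 2 * z₃ ^ 2 = 0) :
    (A₁ * u₁ * x₁ * z₁ + A₂ * u₂ * x₂ * z₂ + A₃ * u₃ * x₃ * z₃) *
      (A₁ * u₁ * x₁ * z₁ - A₂ * u₂ * x₂ * z₂ - A₃ * u₃ * x₃ * z₃) =
    A₂ * A₃ * (x₂ * u₃ * z₃ - x₃ * u₂ * z₂) ^ 2 := by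
  linear_combination A₁ * x₁ ^ 2 * h' - (A₂ * u₂ ^ 2 * z₂ ^ 2 + A₃ * u₃ ^ 2 * z₃ ^ 2) * h

include hN in
theorem exists_quartic_of_isotropic {β x z : F} (hβ : β ≠ 0) (hx : x ≠ 0) (hz : z ≠ 0)
    (h : S.conjF 1 β * S.conjF 1 x ^ 2 / S.derivVal 1 2 3 +
      S.conjF 2 β * S.conjF 2 x ^ 2 / S.derivVal 2 1 3 +
      S.conjF 3 β * S.conjF 3 x ^ 2 / S.derivVal 3 2 1 = 0)
    (h' : S.conjF 1 β * (S.pairSum 1 : L) ^ 2 * S.conjF 1 z ^ 2 / S.derivVal 1 2 3 +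
      S.conjF 2 β * (S.pairSum 2 : L) ^ 2 * S.conjF 2 z ^ 2 / S.derivVal 2 1 3 +
      S.conjF 3 β * (S.pairSum 3 : L) ^ 2 * S.conjF 3 z ^ 2 / S.derivVal 3 2 1 = 0) :
    ∃ α : K, α ≠ 0 ∧ IsSquare (S.conj 0 α * S.conj 1 α *
      (S.conjF 2 β * S.conjF 3 β * (S.derivVal 2 1 3 * S.derivVal 3 2 1))) := by
  have hd1 : ((S.derivVal 1 2 3 : 𝓞 L) : L) ≠ 0 := RingOfIntegers.coe_ne_zero_iff.2
    (derivVal_ne_zero (by decide) (by decide) (by decide) (by decide))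
  have hd2 : ((S.derivVal 2 1 3 : 𝓞 L) : L) ≠ 0 := RingOfIntegers.coe_ne_zero_iff.2
    (derivVal_ne_zero (by decide) (by decide) (by decide) (by decide))
  have hd3 : ((S.derivVal 3 2 1 : 𝓞 L) : L) ≠ 0 := RingOfIntegers.coe_ne_zero_iff.2
    (derivVal_ne_zero (by decide) (by decide) (by decide) (by decide))
  have key := mul_eq_of_isotropic (A₁ := S.conjF 1 β / S.derivVal 1 2 3)
    (A₂ := S.conjF 2 β / S.derivVal 2 1 3) (A₃ := S.conjF 3 β / S.derivVal 3 2 1)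
    (u₁ := S.pairSum 1) (u₂ := S.pairSum 2) (u₃ := S.pairSum 3)
    (x₁ := S.conjF 1 x) (x₂ := S.conjF 2 x) (x₃ := S.conjF 3 x)
    (z₁ := S.conjF 1 z) (z₂ := S.conjF 2 z) (z₃ := S.conjF 3 z)
    (by linear_combination h) (by linear_combination h')
  set α₀ : L := S.conjF 1 β / S.derivVal 1 2 3 * S.pairSum 1 * S.conjF 1 x * S.conjF 1 z +
    S.conjF 2 β / S.derivVal 2 1 3 * S.pairSum 2 * S.conjF 2 x * S.conjF 2 z +
    S.conjF 3 β / S.derivVal 3 2 1 * S.pairSum 3 * S.conjF 3 x * S.conjF 3 z with hα₀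
  obtain ⟨α, hα⟩ := (S.mem_range_left α₀).mpr (by
    intro σ hσ
    rw [hα₀]
    have c1 := map_conjF_of_fix hσ (k := 1) (by decide)
    have c2 := map_conjF_of_fix hσ (k := 2) (by decide)
    have c3 := map_conjF_of_fix hσ (k := 3) (by decide)
    have hd : ∀ k i j, σ (S.derivVal k i j : L) =
        S.derivVal (S.e σ k) (S.e σ i) (S.e σ j) := by
      intro k i j
      simp only [derivVal, map_sub, map_mul, S.map_x, hσ]
    have hs : ∀ k i j, S.derivVal k i j = S.derivVal k j i := fun k i j => by
      simp only [derivVal]; ring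
    have hu : ∀ k, σ (S.pairSum k : L) = S.pairSum (S.e σ k) := by
      intro k
      simp only [pairSum, map_add, S.map_x, hσ]
    simp only [map_add, map_mul, map_div₀, hd, hu, c1, c2, c3]
    rw [hs 1 2 3, hs 2 1 3, hs 3 2 1]
    rcases perm_cases_of_fix _ hσ with h | h | h | h | h | h <;> obtain ⟨h1, h2, h3⟩ := h <;>
      rw [h1, h2, h3] <;>
      (try simp only [hs 1 2 3, hs 2 1 3, hs 3 2 1]) <;> ring)
  have hconj0 : S.conj 0 α = α₀ := by rw [S.conj_zero, hα]
  have hconj1 : S.conj 1 α =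
      S.conjF 1 β / S.derivVal 1 2 3 * S.pairSum 1 * S.conjF 1 x * S.conjF 1 z -
      S.conjF 2 β / S.derivVal 2 1 3 * S.pairSum 2 * S.conjF 2 x * S.conjF 2 z -
      S.conjF 3 β / S.derivVal 3 2 1 * S.pairSum 3 * S.conjF 3 x * S.conjF 3 z := by
    have c1 := S.map_conjF (σ := S.e.symm (Equiv.swap 0 1)) (k := 1) (k' := 1) (by
      rw [MulEquiv.apply_symm_apply]; decide)
    have c2 := S.map_conjF (σ := S.e.symm (Equiv.swap 0 1)) (k := 2) (k' := 3) (by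
      rw [MulEquiv.apply_symm_apply]; decide)
    have c3 := S.map_conjF (σ := S.e.symm (Equiv.swap 0 1)) (k := 3) (k' := 2) (by
      rw [MulEquiv.apply_symm_apply]; decide)
    have e0 : Equiv.swap (0 : Fin 4) 1 0 = 1 := by decide
    have e1 : Equiv.swap (0 : Fin 4) 1 1 = 0 := by decide
    have e2 : Equiv.swap (0 : Fin 4) 1 2 = 2 := by decide
    have e3 : Equiv.swap (0 : Fin 4) 1 3 = 3 := by decide
    have u2 : ((S.pairSum 2 : 𝓞 L) : L) = -((S.x 1 : L) + S.x 3) := by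
      have := congr_arg (algebraMap (𝓞 L) L) S.sum_x_eq_zero
      simp only [map_add, map_zero] at this
      simp only [pairSum, map_add]
      linear_combination this
    have u3 : ((S.pairSum 3 : 𝓞 L) : L) = -((S.x 1 : L) + S.x 2) := by
      have := congr_arg (algebraMap (𝓞 L) L) S.sum_x_eq_zero
      simp only [map_add, map_zero] at this
      simp only [pairSum, map_add]
      linear_combination this
    have d1 : S.e.symm (Equiv.swap 0 1) (S.derivVal 1 2 3 : L) = S.derivVal 1 2 3 := by
      simp only [derivVal, map_sub, map_mul, S.map_x, MulEquiv.apply_symm_apply, e0, e1, e2, e3]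
      ring
    have d2 : S.e.symm (Equiv.swap 0 1) (S.derivVal 2 1 3 : L) = S.derivVal 3 2 1 := by
      simp only [derivVal, map_sub, map_mul, S.map_x, MulEquiv.apply_symm_apply, e0, e1, e2, e3]
      ring
    have d3 : S.e.symm (Equiv.swap 0 1) (S.derivVal 3 2 1 : L) = S.derivVal 2 1 3 := by
      simp only [derivVal, map_sub, map_mul, S.map_x, MulEquiv.apply_symm_apply, e0, e1, e2, e3]
      ring
    have v1 : S.e.symm (Equiv.swap 0 1) (S.pairSum 1 : L) = S.pairSum 1 := by
      simp only [pairSum, map_add, S.map_x, MulEquiv.apply_symm_apply, e0, e1]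
      ring
    have v2 : S.e.symm (Equiv.swap 0 1) (S.pairSum 2 : L) = -S.pairSum 3 := by
      rw [u3]
      simp only [pairSum, map_add, S.map_x, MulEquiv.apply_symm_apply, e0, e2]
      ring
    have v3 : S.e.symm (Equiv.swap 0 1) (S.pairSum 3 : L) = -S.pairSum 2 := by
      rw [u2]
      simp only [pairSum, map_add, S.map_x, MulEquiv.apply_symm_apply, e0, e3]
      ring
    rw [conj_apply, hα, hα₀]
    simp only [map_add, map_mul, map_div₀, c1, c2, c3, d1, d2, d3, v1, v2, v3]
    ring
  refine ⟨α, ?_, ?_⟩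
  · rintro rfl
    rw [map_zero] at hconj0 hconj1
    have h0 : S.conjF 1 β / S.derivVal 1 2 3 * S.pairSum 1 * S.conjF 1 x * S.conjF 1 z = 0 := by
      apply mul_left_cancel₀ (two_ne_zero (α := L))
      rw [hα₀] at hconj0
      linear_combination - hconj0 - hconj1
    have hu1 : ((S.pairSum 1 : 𝓞 L) : L) ≠ 0 :=
      RingOfIntegers.coe_ne_zero_iff.2 (pairSum_ne_zero hN (by decide))
    refine mul_ne_zero (mul_ne_zero (mul_ne_zero (div_ne_zero ?_ hd1) hu1) ?_) ?_ h0 <;> simpa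
  · rw [hconj0, hconj1, key]
    refine ⟨S.conjF 2 β * S.conjF 3 β * (S.conjF 2 x * S.pairSum 3 * S.conjF 3 z -
      S.conjF 3 x * S.pairSum 2 * S.conjF 2 z), ?_⟩
    field_simp

include hN in
/-- The element of the quartic field attached to `β` can be scaled to have even valuation. -/
theorem exists_evenAway_quartic [IsGalois ℚ L] {β : F} (hβ : EvenAway N β) {α : K} (hα : α ≠ 0)
    (h : IsSquare (S.conj 0 α * S.conj 1 α *
      (S.conjF 2 β * S.conjF 3 β * (S.derivVal 2 1 3 * S.derivVal 3 2 1)))) :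
    ∃ α' : K, EvenAway N α' ∧ IsSquare (S.conj 0 α' * S.conj 1 α' *
      (S.conjF 2 β * S.conjF 3 β * (S.derivVal 2 1 3 * S.derivVal 3 2 1))) := by
  have : IsGalois K L := IsGalois.tower_top_of_isGalois ℚ K L
  have hd2 := EvenAway.of_dvd_pow hN.ne_zero (derivVal_dvd hN (k := 2) (i := 1) (j := 3)
    (by decide) (by decide) (by decide) (by decide))
  have hd3 := EvenAway.of_dvd_pow hN.ne_zero (derivVal_dvd hN (k := 3) (i := 2) (j := 1)
    (by decide) (by decide) (by decide) (by decide))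
  have h01 : EvenAway N (S.conj 0 α * S.conj 1 α) :=
    (((S.evenAway_conjF hβ 2).mul (S.evenAway_conjF hβ 3)).mul (hd2.mul hd3)).of_mul_isSquare
      (mul_ne_zero (S.conj_ne_zero hα 0) (S.conj_ne_zero hα 1)) h
  obtain ⟨r, hr, hr'⟩ := exists_rat_mul_evenAway (hN.parityDescent ℚ) (a := algebraMap K L α) (by
    intro σ
    rw [S.map_algebraMap, ← S.conj_zero]
    by_cases h0 : S.e σ 0 = 0
    · rw [h0]
      exact EvenAway.of_isSquare (mul_ne_zero (S.conj_ne_zero hα 0) (S.conj_ne_zero hα 0)) ⟨_, rfl⟩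
    · obtain ⟨τ, hτ0, hτ1⟩ := S.exists_e_apply_eq (Ne.symm h0)
      have := h01.map_algEquiv τ
      rwa [map_mul, S.map_conj, S.map_conj, hτ0, hτ1, mul_comm] at this)
  refine ⟨r * α, hN.parityDescent K _ (by simpa using hr'), ?_⟩
  have e : ∀ i, S.conj i ((r : K) * α) = (r : L) * S.conj i α := fun i => by
    rw [map_mul, map_ratCast]
  rw [e, e]
  clear e
  obtain ⟨s, hs⟩ := h
  exact ⟨r * s, by linear_combination (r : L) ^ 2 * hs⟩

end QuarticSetup

theorem Colorable.and {α : Type*} {S : Set α} {R R' : α → α → Prop} {n m : ℕ}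
    (h : Colorable S R n) (h' : Colorable S R' m) :
    Colorable S (fun a b => R a b ∧ R' a b) (n * m) := by
  obtain ⟨f, hf⟩ := h
  obtain ⟨g, hg⟩ := h'
  refine Colorable.of_finite (T := Fin n × Fin m) (fun a => (f a, g a)) (by simp) ?_
  intro a ha b hb hab
  simp only [Prod.mk.injEq] at hab
  exact ⟨hf a ha b hb hab.1, hg a ha b hb hab.2⟩

/-- Integers of a number field can be coloured by their signs at the real places. -/
theorem NumberField.colorable_sign (E : Type*) [Field E] [NumberField E] :
    Colorable (Set.univ : Set (𝓞 E)) (fun a b => ∀ φ : E →+* ℂ, ComplexEmbedding.IsReal φ →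
      0 ≤ (φ (algebraMap (𝓞 E) E (a * b))).re) (2 ^ Module.finrank ℚ E) := by
  classical
  refine Colorable.of_finite (T := (E →+* ℂ) → Bool)
    (fun a φ => decide (0 ≤ (φ (algebraMap (𝓞 E) E a)).re)) ?_ ?_
  · rw [Nat.card_fun, Nat.card_eq_fintype_card (α := Bool), Fintype.card_bool,
      Nat.card_eq_fintype_card, NumberField.Embeddings.card]
  · rintro a - b - h φ hφ
    have h1 := congr_fun h φ
    simp only [decide_eq_decide] at h1
    have him : ∀ z : E, (φ z).im = 0 := fun z =>
      Complex.conj_eq_iff_im.1 (RingHom.congr_fun hφ z)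
    rw [map_mul, map_mul, Complex.mul_re, him, zero_mul, sub_zero]
    by_cases h2 : 0 ≤ (φ (algebraMap (𝓞 E) E a)).re
    · exact mul_nonneg h2 (h1.1 h2)
    · exact mul_nonneg_of_nonpos_of_nonpos (not_le.1 h2).le (not_le.1 fun h => h2 (h1.2 h)).le

namespace QuarticSetup

variable {K L F : Type*} [Field K] [Field L] [Field F] [NumberField K] [NumberField L]
  [NumberField F] [Algebra K L] [Algebra F L] {S : QuarticSetup K L F} {N : ℕ} (hN : S.IsBad N)

variable (S) in
theorem norm_eq_prod_conjF (hF : Module.finrank ℚ F = 3) (a : F) :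
    algebraMap ℚ L (Algebra.norm ℚ a) = S.conjF 1 a * S.conjF 2 a * S.conjF 3 a := by
  obtain ⟨φ⟩ : Nonempty (L →+* ℂ) := inferInstance
  apply φ.injective
  let g : Fin 3 → (F →ₐ[ℚ] ℂ) := fun k => (φ.comp (S.conjF k.succ)).toRatAlgHom
  have hg : Function.Injective g := by
    intro k l h
    refine Fin.succ_injective _
      (conjF_injective (S := S) _ _ (Fin.succ_ne_zero _) (Fin.succ_ne_zero _) ?_)
    ext a
    exact φ.injective (DFunLike.congr_fun h a)
  have hb : Function.Bijective g := by
    rw [Fintype.bijective_iff_injective_and_card]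
    exact ⟨hg, by rw [AlgHom.card, hF, Fintype.card_fin]⟩
  rw [eq_ratCast, map_ratCast, ← eq_ratCast (algebraMap ℚ ℂ), Algebra.norm_eq_prod_embeddings,
    ← Function.Bijective.prod_comp hb (fun φ : F →ₐ[ℚ] ℂ => φ a), Fin.prod_univ_three]
  simp [g]

variable (S) in
/-- Generators of squares of ideals coprime to `N` in the cubic resolvent. -/
def coprimeSquares (_ : QuarticSetup K L F) (N : ℕ) : Set (𝓞 F) :=
  {x | x ≠ 0 ∧ IsCoprime x (N : 𝓞 F) ∧ ∃ J : Ideal (𝓞 F), Ideal.span {x} = J ^ 2}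

include hN in
theorem exists_quartic [IsGalois ℚ L] (hF : Module.finrank ℚ F = 3) {a b y : 𝓞 F}
    (ha : a ∈ S.coprimeSquares N) (hb : b ∈ S.coprimeSquares N)
    (hy : (N : 𝓞 F) ^ 48 ∣ a * b * y ^ 2 - 1)
    (hpos : ∀ φ : F →+* ℂ, ComplexEmbedding.IsReal φ → 0 ≤ (φ (algebraMap (𝓞 F) F (a * b))).re)
    (hnm : IsSquare (Algebra.norm ℚ (a : F) / Algebra.norm ℚ (b : F))) :
    ∃ α : K, EvenAway N α ∧ IsSquare (S.conj 0 α * S.conj 1 α *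
      (algebraMap F L ((a * b : 𝓞 F) : F) * (S.derivVal 2 1 3 * S.derivVal 3 2 1))) := by
  obtain ⟨ha0, -, I, hI⟩ := ha
  obtain ⟨hb0, -, J, hJ⟩ := hb
  have hβ0 := mul_ne_zero ha0 hb0
  have hIJ : Ideal.span {a * b} = (I * J) ^ 2 := by
    rw [mul_pow, ← hI, ← hJ, Ideal.span_singleton_mul_span_singleton]
  obtain ⟨⟨x, hx, h⟩, z, hz, h'⟩ := exists_conjF_isotropic hN hF hβ0 hIJ hy hpos
  have hβ0' : ((a * b : 𝓞 F) : F) ≠ 0 := RingOfIntegers.coe_ne_zero_iff.2 hβ0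
  obtain ⟨α, hα, h2⟩ := exists_quartic_of_isotropic hN hβ0' hx hz h h'
  obtain ⟨α', hα', s, hs⟩ := exists_evenAway_quartic hN (EvenAway.of_span_eq_sq hβ0 hIJ) hα h2
  refine ⟨α', hα', ?_⟩
  obtain ⟨m, hm⟩ := hnm
  have hm' : Algebra.norm ℚ ((a * b : 𝓞 F) : F) = (m * Algebra.norm ℚ (b : F)) ^ 2 := by
    have : Algebra.norm ℚ (b : F) ≠ 0 := by simpa using hb0
    rw [show ((a * b : 𝓞 F) : F) = (a : F) * b from rfl, map_mul]
    field_simp at hm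
    linear_combination Algebra.norm ℚ (b : F) * hm
  have h3 := S.norm_eq_prod_conjF hF ((a * b : 𝓞 F) : F)
  rw [hm', map_pow] at h3
  set q := algebraMap ℚ L (m * Algebra.norm ℚ (b : F))
  rw [← S.conjF_one]
  set β : F := ((a * b : 𝓞 F) : F)
  have n1 : S.conjF 1 β ≠ 0 := by simpa using hβ0'
  have n2 : S.conjF 2 β ≠ 0 := by simpa using hβ0'
  have n3 : S.conjF 3 β ≠ 0 := by simpa using hβ0'
  refine ⟨s * q / (S.conjF 2 β * S.conjF 3 β), ?_⟩
  field_simp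
  linear_combination q ^ 2 * hs - S.conj 0 α' * S.conj 1 α' * S.derivVal 2 1 3 *
    S.derivVal 3 2 1 * S.conjF 2 β * S.conjF 3 β * h3

end QuarticSetup

namespace QuarticSetup

variable {K L F : Type*} [Field K] [Field L] [Field F] [NumberField K] [NumberField L]
  [NumberField F] [Algebra K L] [Algebra F L] {S : QuarticSetup K L F} {N : ℕ} (hN : S.IsBad N)

theorem evenAway_norm (S : QuarticSetup K L F) (hQ : ParityDescent ℚ L N) (hF : Module.finrank ℚ F = 3) {a : F}
    (ha : EvenAway N a) : EvenAway N (Algebra.norm ℚ a) := by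
  apply hQ
  rw [S.norm_eq_prod_conjF hF]
  exact ((S.evenAway_conjF ha 1).mul (S.evenAway_conjF ha 2)).mul (S.evenAway_conjF ha 3)

include hN in
theorem colorable_coprimeSquares [IsGalois ℚ L] (hF : Module.finrank ℚ F = 3) :
    Colorable (S.coprimeSquares N) (fun a b => IsSquare ((a : F) / b))
      (2 ^ (N.primeFactors.card * Module.finrank ℚ F) * 2 ^ Module.finrank ℚ F *
        2 ^ Module.finrank ℚ F *
        (2 ^ (N.primeFactors.card * Module.finrank ℚ ℚ) *
          (Nat.card {c : ClassGroup (𝓞 ℚ) // c ^ 2 = 1} * 2 ^ Module.finrank ℚ ℚ)) *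
      (2 ^ (N.primeFactors.card * Module.finrank ℚ K) *
        (Nat.card {c : ClassGroup (𝓞 K) // c ^ 2 = 1} * 2 ^ Module.finrank ℚ K) *
      2 ^ Nat.card (L ≃ₐ[F] L))) := by
  classical
  have hgal : IsGalois F L := IsGalois.tower_top_of_isGalois ℚ F L
  have hclK : 0 < Nat.card {c : ClassGroup (𝓞 K) // c ^ 2 = 1} :=
    Nat.card_pos_iff.mpr ⟨⟨1, one_pow 2⟩, inferInstance⟩
  have h1 : Colorable (S.coprimeSquares N) _ _ :=
    (NumberField.colorable_isCoprime F hN.ne_zero 48).comap id (fun a ha => ha.2.1)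
      fun _ _ _ _ h => h
  have h2 : Colorable (S.coprimeSquares N) _ _ :=
    (NumberField.colorable_sign F).comap id (fun _ _ => Set.mem_univ _) fun _ _ _ _ h => h
  have h3 : Colorable (S.coprimeSquares N)
      (fun a b => IsSquare (Algebra.norm ℚ (a : F) / Algebra.norm ℚ (b : F))) _ :=
    (NumberField.colorable_evenAway ℚ N hN.ne_zero).comap (fun a : 𝓞 F => Algebra.norm ℚ (a : F))
      (fun a ha => S.evenAway_norm (hN.parityDescent ℚ) hF
        (EvenAway.of_span_eq_sq ha.1 ha.2.2.choose_spec)) fun _ _ _ _ h => h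
  refine Colorable.trans (Nat.mul_pos (Nat.mul_pos (by positivity)
    (Nat.mul_pos hclK (by positivity))) (by positivity)) ((h1.and h2).and h3) fun b hb => ?_
  simp only [id]
  refine Colorable.trans (R := fun a a' : 𝓞 F => IsSquare (algebraMap F L ((a : F) / a')))
    (by positivity) ?_ fun a' ha' => ?_
  · have hex : ∀ a : 𝓞 F, a ∈ {a | a ∈ S.coprimeSquares N ∧
        ((∃ y, (N : 𝓞 F) ^ 48 ∣ a * b * y ^ 2 - 1) ∧ ∀ φ : F →+* ℂ, ComplexEmbedding.IsReal φ →
          0 ≤ (φ (algebraMap (𝓞 F) F (a * b))).re) ∧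
        IsSquare (Algebra.norm ℚ (a : F) / Algebra.norm ℚ (b : F))} →
        ∃ α : K, EvenAway N α ∧ IsSquare (S.conj 0 α * S.conj 1 α *
          (algebraMap F L ((a * b : 𝓞 F) : F) * (S.derivVal 2 1 3 * S.derivVal 3 2 1))) := by
      rintro a ⟨ha, ⟨⟨y, hy⟩, hpos⟩, hnm⟩
      exact exists_quartic hN hF ha hb hy hpos hnm
    refine (NumberField.colorable_evenAway K N hN.ne_zero).comap
      (fun a => if h : a ∈ _ then (hex a h).choose else 1) ?_ ?_
    · intro a ha
      simp only [dif_pos ha]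
      exact (hex a ha).choose_spec.1
    · intro a ha a' ha' hsq
      simp only [dif_pos ha, dif_pos ha'] at hsq
      have e1 := (hex a ha).choose_spec
      have e2 := (hex a' ha').choose_spec
      generalize (hex a ha).choose = α at *
      generalize (hex a' ha').choose = α' at *
      have e3 := ((e1.2.div e2.2).div (hsq.map (S.conj 0))).div (hsq.map (S.conj 1))
      have a0 := S.conj_ne_zero e1.1.1 0
      have a1 := S.conj_ne_zero e1.1.1 1
      have b0 := S.conj_ne_zero e2.1.1 0
      have b1 := S.conj_ne_zero e2.1.1 1
      have hd2 : ((S.derivVal 2 1 3 : 𝓞 L) : L) ≠ 0 := RingOfIntegers.coe_ne_zero_iff.2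
        (derivVal_ne_zero (by decide) (by decide) (by decide) (by decide))
      have hd3 : ((S.derivVal 3 2 1 : 𝓞 L) : L) ≠ 0 := RingOfIntegers.coe_ne_zero_iff.2
        (derivVal_ne_zero (by decide) (by decide) (by decide) (by decide))
      have c1 : algebraMap F L (a' : F) ≠ 0 := by simpa using ha'.1.1
      have c2 : algebraMap F L (b : F) ≠ 0 := by simpa using hb.1
      rw [show ((a * b : 𝓞 F) : F) = (a : F) * b from rfl,
        show ((a' * b : 𝓞 F) : F) = (a' : F) * b from rfl, map_mul, map_mul, map_div₀,
        map_div₀] at e3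
      obtain ⟨s, hs⟩ := e3
      refine ⟨s, ?_⟩
      rw [← hs, map_div₀]
      field_simp
  · have ha0 : (a' : F) ≠ 0 := RingOfIntegers.coe_ne_zero_iff.2 ha'.1.1
    refine (colorable_isSquare_algebraMap F L).comap (fun a => (a : F) / a') ?_ ?_
    · rintro a ⟨⟨ha, -⟩, h⟩
      exact ⟨div_ne_zero (RingOfIntegers.coe_ne_zero_iff.2 ha.1) ha0, h⟩
    · rintro a - c - h
      simpa only [div_div_div_cancel_right₀ ha0] using h

include hN in
theorem card_classGroup_right_le [IsGalois ℚ L] (hF : Module.finrank ℚ F = 3) :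
    Nat.card {c : ClassGroup (𝓞 F) // c ^ 2 = 1} ≤
      2 ^ (N.primeFactors.card * Module.finrank ℚ F) * 2 ^ Module.finrank ℚ F *
        2 ^ Module.finrank ℚ F *
        (2 ^ (N.primeFactors.card * Module.finrank ℚ ℚ) *
          (Nat.card {c : ClassGroup (𝓞 ℚ) // c ^ 2 = 1} * 2 ^ Module.finrank ℚ ℚ)) *
      (2 ^ (N.primeFactors.card * Module.finrank ℚ K) *
        (Nat.card {c : ClassGroup (𝓞 K) // c ^ 2 = 1} * 2 ^ Module.finrank ℚ K) *
      2 ^ Nat.card (L ≃ₐ[F] L)) := by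
  refine NumberField.card_classGroup_two_torsion_le_of (fun c hc => ?_)
    (colorable_coprimeSquares hN hF)
  obtain ⟨J, rfl, hJ⟩ := NumberField.exists_mk0_eq_of_sq_eq_one hN.ne_zero hc
  obtain ⟨x, hx0, hx⟩ := NumberField.exists_span_eq_sq hc
  refine ⟨J, x, ⟨hx0, ?_, J, hx⟩, hx0, rfl, hx⟩
  rw [← Ideal.isCoprime_span_singleton_iff, hx]
  exact (Ideal.isCoprime_iff_sup_eq.2 hJ).pow_left

end QuarticSetup

set_option maxRecDepth 100000 in
theorem preservesPairing_iff : ∀ g : Equiv.Perm (Fin 4), PreservesPairing g ↔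
    ∀ i j : Fin 4, (i < 2 ↔ j < 2) ↔ (g i < 2 ↔ g j < 2) := by
  decide

/-- The permutations preserving the pairing `{0, 1}, {2, 3}` form a group. -/
def pairingSubgroup : Subgroup (Equiv.Perm (Fin 4)) where
  carrier := {g | PreservesPairing g}
  one_mem' := by decide
  mul_mem' := by
    intro g h hg hh
    have hg : PreservesPairing g := hg
    have hh : PreservesPairing h := hh
    change PreservesPairing (g * h)
    rw [preservesPairing_iff] at *
    intro i j
    rw [hh i j, hg (h i) (h j)]
    rfl
  inv_mem' := by
    intro g hg
    have hg : PreservesPairing g := hg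
    change PreservesPairing g⁻¹
    rw [preservesPairing_iff] at *
    intro i j
    rw [hg (g⁻¹ i) (g⁻¹ j)]
    simp

set_option maxRecDepth 100000 in
theorem card_pairingSubgroup : Nat.card pairingSubgroup = 8 := by
  change Nat.card {g : Equiv.Perm (Fin 4) // PreservesPairing g} = 8
  rw [Nat.card_eq_fintype_card]
  decide

open scoped Pointwise in
/-- Every subgroup of order eight preserves a pairing, up to relabelling. -/
theorem exists_mem_iff_preservesPairing {Q : Subgroup (Equiv.Perm (Fin 4))} (hQ : Nat.card Q = 8) :
    ∃ g : Equiv.Perm (Fin 4), ∀ s, s ∈ Q ↔ PreservesPairing (g⁻¹ * s * g) := by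
  have : Fact (Nat.Prime 2) := ⟨Nat.prime_two⟩
  have h24 : 2 ^ (Nat.card (Equiv.Perm (Fin 4))).factorization 2 = 8 := by
    rw [Nat.card_perm, Nat.card_fin, show Nat.factorial 4 = 2 ^ 3 * 3 from rfl,
      Nat.factorization_mul (by norm_num) (by norm_num), Nat.Prime.factorization_pow Nat.prime_two,
      Nat.Prime.factorization Nat.prime_three]
    simp
  obtain ⟨g, hg⟩ := MulAction.exists_smul_eq (Equiv.Perm (Fin 4))
    (Sylow.ofCard (p := 2) pairingSubgroup (card_pairingSubgroup.trans h24.symm))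
    (Sylow.ofCard (p := 2) Q (hQ.trans h24.symm))
  refine ⟨g, fun s => ?_⟩
  have h1 : MulAut.conj g • pairingSubgroup = Q := congr_arg Sylow.toSubgroup hg
  rw [← h1, Subgroup.mem_pointwise_smul_iff_inv_smul_mem]
  change (MulAut.conj g)⁻¹ s ∈ {g | PreservesPairing g} ↔ _
  rw [← map_inv]
  simp

section

section Embeddings

variable (K L : Type*) [Field K] [Field L] [NumberField K] [NumberField L]

/-- The Galois group of `L` acts on the embeddings of `K` in `L`. -/
def galPerm : (L ≃ₐ[ℚ] L) →* Equiv.Perm (K →ₐ[ℚ] L) where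
  toFun σ :=
    { toFun := fun τ => (σ : L →ₐ[ℚ] L).comp τ
      invFun := fun τ => (σ.symm : L →ₐ[ℚ] L).comp τ
      left_inv := fun τ => by ext; simp
      right_inv := fun τ => by ext; simp }
  map_one' := rfl
  map_mul' _ _ := rfl

variable {K L}

theorem galPerm_injective (h : IntermediateField.normalClosure ℚ K L = ⊤) :
    Function.Injective (galPerm K L) := by
  rw [injective_iff_map_eq_one]
  intro σ hσ
  have hle : IntermediateField.normalClosure ℚ K L ≤
      IntermediateField.fixedField (Subgroup.zpowers σ) := by
    refine iSup_le fun τ => ?_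
    rintro _ ⟨a, rfl⟩
    rw [IntermediateField.mem_fixedField_iff]
    have h1 : σ ∈ MulAction.stabilizer (L ≃ₐ[ℚ] L) (τ a) :=
      DFunLike.congr_fun (DFunLike.congr_fun hσ τ) a
    intro f hf
    exact (Subgroup.zpowers_le.2 h1) hf
  ext a
  rw [h] at hle
  exact (IntermediateField.mem_fixedField_iff _ _).1 (hle (IntermediateField.mem_top (x := a))) σ
    (Subgroup.mem_zpowers σ)

theorem card_algHom_of_normal [IsGalois ℚ L] (f : K →ₐ[ℚ] L) :
    Nat.card (K →ₐ[ℚ] L) = Module.finrank ℚ K := by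
  rw [Nat.card_eq_fintype_card]
  refine AlgHom.card_of_splits ℚ K L fun x => ?_
  rw [← minpoly.algHom_eq f f.injective]
  exact Normal.splits inferInstance _

end Embeddings

variable {K L F : Type*} [Field K] [Field L] [Field F] [NumberField K] [NumberField L]
  [NumberField F]

theorem exists_labelling [IsGalois ℚ L] (hK : Module.finrank ℚ K = 4) (f : K →ₐ[ℚ] L)
    (hcl : IntermediateField.normalClosure ℚ K L = ⊤) (hcard : Nat.card (L ≃ₐ[ℚ] L) = 24)
    {P : Subgroup (L ≃ₐ[ℚ] L)} (hP : Nat.card P = 8) :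
    ∃ (τ : Fin 4 ≃ (K →ₐ[ℚ] L)) (e : (L ≃ₐ[ℚ] L) ≃* Equiv.Perm (Fin 4)),
      (∀ σ i a, τ (e σ i) a = σ (τ i a)) ∧ ∀ σ, σ ∈ P ↔ PreservesPairing (e σ) := by
  have hX := (card_algHom_of_normal f).trans hK
  have hbij : Function.Bijective (galPerm K L) := by
    rw [Nat.bijective_iff_injective_and_card]
    refine ⟨galPerm_injective hcl, ?_⟩
    rw [hcard, Nat.card_perm, hX]
    rfl
  let t : (K →ₐ[ℚ] L) ≃ Fin 4 := Finite.equivFinOfCardEq hX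
  let e₁ := MulEquiv.ofBijective _ hbij
  let e₂ := e₁.trans t.permCongrHom
  obtain ⟨g, hg⟩ := exists_mem_iff_preservesPairing (Q := P.map e₂.toMonoidHom) (by
    rw [← hP]
    exact (Nat.card_congr (e₂.subgroupMap P).toEquiv).symm)
  refine ⟨g.trans t.symm, e₁.trans (t.trans g.symm).permCongrHom, ?_, fun σ => ?_⟩
  · intro σ i a
    have : g.trans t.symm ((e₁.trans (t.trans g.symm).permCongrHom) σ i) =
        galPerm K L σ (t.symm (g i)) := by
      simp [e₁]
    rw [this]
    rfl
  · have h1 : σ ∈ P ↔ e₂ σ ∈ P.map e₂.toMonoidHom := by simp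
    rw [h1, hg]
    rfl

end

section

variable {K L F : Type*} [Field K] [Field L] [Field F] [NumberField K] [NumberField L]
  [NumberField F]

theorem exists_quarticSetup [IsGalois ℚ L] [Algebra K L] [Algebra F L]
    {τ : Fin 4 ≃ (K →ₐ[ℚ] L)} {e : (L ≃ₐ[ℚ] L) ≃* Equiv.Perm (Fin 4)}
    (hτ : ∀ σ i a, τ (e σ i) a = σ (τ i a)) (hK : ∀ a, algebraMap K L a = τ 0 a)
    (hF : ∀ a : L, a ∈ Set.range (algebraMap F L) ↔ ∀ σ, PreservesPairing (e σ) → σ a = a)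
    {ξ : 𝓞 K} (hξ : IntermediateField.adjoin ℚ {(ξ : K)} = ⊤) :
    ∃ S : QuarticSetup K L F, ∀ i, (S.x i : L) = 4 * τ i ξ - ∑ j, τ j ξ := by
  let y : Fin 4 → 𝓞 L := fun i => RingOfIntegers.mapRingHom (τ i : K →+* L) ξ
  have hy : ∀ i, (y i : L) = τ i ξ := fun i => rfl
  have hyi : Function.Injective y := by
    intro i j h
    apply τ.injective
    have h1 : τ i ξ = τ j ξ := by rw [← hy, ← hy, h]
    have hle : (⊤ : IntermediateField ℚ K).toSubalgebra ≤ AlgHom.equalizer (τ i) (τ j) := by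
      rw [← hξ, IntermediateField.adjoin_simple_toSubalgebra_of_isAlgebraic
        (Algebra.IsAlgebraic.isAlgebraic _), Algebra.adjoin_le_iff]
      rintro _ rfl
      exact h1
    ext a
    exact hle (Algebra.mem_top : a ∈ (⊤ : Subalgebra ℚ K))
  have hsum : ∀ σ : L ≃ₐ[ℚ] L, σ (∑ j, τ j ξ) = ∑ j, τ j (ξ : K) := by
    intro σ
    rw [map_sum]
    simp_rw [← hτ]
    exact Equiv.sum_comp (e σ) fun j => τ j (ξ : K)
  have hx : ∀ i, ((4 * y i - ∑ j, y j : 𝓞 L) : L) = 4 * τ i ξ - ∑ j, τ j ξ := by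
    intro i
    change algebraMap (𝓞 L) L _ = _
    rw [map_sub, map_mul, map_sum, map_ofNat]
    simp_rw [hy]
  refine ⟨⟨fun i => 4 * y i - ∑ j, y j, e, ?_, ?_, ?_, ?_, hF⟩, hx⟩
  · intro i j h
    exact hyi (mul_left_cancel₀ (by norm_num : (4 : 𝓞 L) ≠ 0) (sub_left_injective h))
  · intro σ i
    rw [hx, hx, map_sub, hsum, map_mul, map_ofNat, hτ]
  · rw [Finset.sum_sub_distrib, ← Finset.mul_sum]
    simp
  · intro a
    have h1 : ∀ σ, e σ 0 = 0 ↔ σ ∈ (τ 0).fieldRange.fixingSubgroup := by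
      intro σ
      rw [IntermediateField.mem_fixingSubgroup_iff]
      constructor
      · rintro h _ ⟨b, rfl⟩
        have := hτ σ 0 b
        rw [h] at this
        exact this.symm
      · intro h
        apply τ.injective
        ext b
        rw [hτ]
        exact h _ ⟨b, rfl⟩
    have h2 : a ∈ Set.range (algebraMap K L) ↔ a ∈ (τ 0).fieldRange := by
      constructor <;> rintro ⟨b, rfl⟩
      · exact ⟨b, (hK b).symm⟩
      · exact ⟨b, hK b⟩
    rw [h2, ← IsGalois.fixedField_fixingSubgroup (τ 0).fieldRange,
      IntermediateField.mem_fixedField_iff]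
    simp_rw [h1]

end

open NumberField.mixedEmbedding NumberField.InfinitePlace in
/-- A number field is generated by an integer whose size is controlled by the discriminant. -/
theorem NumberField.exists_primitive_element_le (K : Type*) [Field K] [NumberField K] :
    ∃ ξ : 𝓞 K, IntermediateField.adjoin ℚ {(ξ : K)} = ⊤ ∧
      ∀ w : InfinitePlace K, w ξ ≤ (2 ^ Module.finrank ℚ K + 2) * |(discr K : ℝ)| := by
  set D : ℕ := (discr K).natAbs with hD
  set n := Module.finrank ℚ K
  have hD1 : (1 : ℝ) ≤ |(discr K : ℝ)| := by
    exact_mod_cast Int.one_le_abs (discr_ne_zero K)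
  have hDr : |(discr K : ℝ)| = D := by
    rw [hD, Nat.cast_natAbs, Int.cast_abs]
  rw [hDr] at hD1 ⊢
  let B : NNReal := NNReal.sqrt D * 2 ^ n + 1
  have hB : (B : ℝ) ≤ 2 ^ n * D + 1 := by
    have h1 : (NNReal.sqrt D : ℝ) ≤ D := by
      rw [Real.coe_sqrt, NNReal.coe_natCast, Real.sqrt_le_left (by positivity)]
      nlinarith
    simp only [B, NNReal.coe_add, NNReal.coe_mul, NNReal.coe_pow, NNReal.coe_ofNat, NNReal.coe_one]
    nlinarith [pow_pos (two_pos (α := ℝ)) n]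
  have hm : minkowskiBound K 1 < B := by
    have hlt : NNReal.sqrt D * 2 ^ n < B := lt_add_one _
    refine lt_of_le_of_lt ?_ (ENNReal.coe_lt_coe.mpr hlt)
    rw [minkowskiBound, volume_fundamentalDomain_fractionalIdealLatticeBasis, Units.val_one,
      FractionalIdeal.absNorm_one, Rat.cast_one, ENNReal.ofReal_one, one_mul,
      mixedEmbedding.finrank, volume_fundamentalDomain_latticeBasis, ENNReal.coe_mul,
      ENNReal.coe_pow, ENNReal.coe_ofNat, show (NNReal.sqrt D : ENNReal) = 1 * NNReal.sqrt D by
        rw [one_mul]]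
    gcongr
    · exact pow_le_one₀ (by positivity) (by simp)
    · rw [← NNReal.coe_le_coe, coe_nnnorm, Int.norm_eq_abs, NNReal.coe_natCast, hDr]
  have hfin : (1 : ℝ) + B ≤ (2 ^ n + 2) * D := by nlinarith
  by_cases hreal : ∃ w : InfinitePlace K, w.IsReal
  · obtain ⟨w₀, hw₀⟩ := hreal
    obtain ⟨ξ, h1, h2⟩ := exists_primitive_element_lt_of_isReal K hw₀ (B := B) (by
      calc minkowskiBound K 1 < 1 * B := by rwa [one_mul]
        _ ≤ convexBodyLTFactor K * B := by gcongr; exact mod_cast one_le_convexBodyLTFactor K)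
    refine ⟨ξ, h1, fun w => (h2 w).le.trans (le_trans ?_ hfin)⟩
    rw [NNReal.coe_max, NNReal.coe_one]
    exact max_le (by linarith) (by linarith [B.coe_nonneg])
  · obtain ⟨w₀⟩ : Nonempty (InfinitePlace K) := inferInstance
    have hw₀ : w₀.IsComplex := not_isReal_iff_isComplex.1 fun h => hreal ⟨w₀, h⟩
    obtain ⟨ξ, h1, h2⟩ := exists_primitive_element_lt_of_isComplex K hw₀ (B := B) (by
      calc minkowskiBound K 1 < 1 * B := by rwa [one_mul]
        _ ≤ convexBodyLT'Factor K * B := by gcongr; exact mod_cast one_le_convexBodyLT'Factor K)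
    refine ⟨ξ, h1, fun w => (h2 w).le.trans (le_trans ?_ hfin)⟩
    rw [Real.sqrt_le_left (by positivity)]
    nlinarith [B.coe_nonneg]

section

namespace QuarticSetup

variable {K L F : Type*} [Field K] [Field L] [Field F] [NumberField K] [NumberField L]
  [NumberField F] [Algebra K L] [Algebra F L] (S : QuarticSetup K L F)

theorem x_add_x_ne_zero {i j : Fin 4} (hij : i ≠ j) : S.x i + S.x j ≠ 0 := by
  intro h
  obtain ⟨k, hki, hkj⟩ : ∃ k, k ≠ i ∧ k ≠ j := by
    have : ∀ i j : Fin 4, ∃ k, k ≠ i ∧ k ≠ j := by decide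
    exact this i j
  have h1 : (S.x i : L) + S.x j = 0 := congrArg (algebraMap (𝓞 L) L) h
  have h2 := congrArg (S.e.symm (Equiv.swap j k)) h1
  rw [map_add, map_zero, S.map_x, S.map_x, MulEquiv.apply_symm_apply,
    Equiv.swap_apply_of_ne_of_ne hij hki.symm, Equiv.swap_apply_left, ← h1, add_right_inj] at h2
  exact hkj (S.injective_x (RingOfIntegers.ext h2))

theorem exists_isBad [IsGalois ℚ L] (φ : L →+* ℂ) {B : ℝ} (hB : ∀ i, ‖φ (S.x i)‖ ≤ B) :
    ∃ N, S.IsBad N ∧ (N : ℝ) ≤ (2 * B) ^ 24 := by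
  let M : 𝓞 L := ∏ p ∈ (Finset.univ : Finset (Fin 4)).offDiag,
    (S.x p.1 - S.x p.2) * (S.x p.1 + S.x p.2)
  have hML : (M : L) = ∏ p ∈ (Finset.univ : Finset (Fin 4)).offDiag,
      ((S.x p.1 : L) - S.x p.2) * ((S.x p.1 : L) + S.x p.2) := by
    change algebraMap (𝓞 L) L M = _
    simp only [M, map_prod, map_mul, map_sub, map_add]
  obtain ⟨m, hm⟩ := NumberField.exists_intCast_eq_of_forall_fixed M (by
    intro σ
    rw [hML, map_prod]
    simp_rw [map_mul, map_sub, map_add, S.map_x]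
    refine Finset.prod_equiv ((S.e σ).prodCongr (S.e σ)) ?_ ?_
    · simp
    · simp)
  have hM0 : M ≠ 0 := by
    refine Finset.prod_ne_zero_iff.2 fun p hp => ?_
    have hne : p.1 ≠ p.2 := (Finset.mem_offDiag.1 hp).2.2
    exact mul_ne_zero (sub_ne_zero.2 fun h => hne (S.injective_x h)) (S.x_add_x_ne_zero hne)
  have hm0 : m ≠ 0 := by
    rintro rfl
    exact hM0 (by simpa using hm)
  have hdvd : M ∣ (m.natAbs : 𝓞 L) := by
    have h2 := map_dvd (Int.castRingHom (𝓞 L)) (Int.dvd_natAbs.2 (dvd_refl m))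
    rw [hm]
    simpa only [eq_intCast, Int.cast_natCast] using h2
  have hfac : ∀ i j, i ≠ j → (S.x i - S.x j) * (S.x i + S.x j) ∣ (m.natAbs : 𝓞 L) :=
    fun i j hij => (Finset.dvd_prod_of_mem (fun p : Fin 4 × Fin 4 =>
      (S.x p.1 - S.x p.2) * (S.x p.1 + S.x p.2)) (a := (i, j)) (by simpa using hij)).trans hdvd
  refine ⟨m.natAbs, ⟨?_, fun i j hij => ?_, fun i hi => ?_⟩, ?_⟩
  · simpa using hm0
  · exact (dvd_mul_right _ _).trans (hfac i j hij)
  · exact (dvd_mul_left _ _).trans (hfac 0 i hi.symm)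
  · have h1 : (m.natAbs : ℝ) = ‖φ (M : L)‖ := by
      have : (M : L) = (m : L) := by
        rw [hm]
        exact map_intCast (algebraMap (𝓞 L) L) m
      rw [this, map_intCast, Complex.norm_intCast, Nat.cast_natAbs, Int.cast_abs]
    have h2 : ‖φ (M : L)‖ ≤ (2 * B) ^ 24 := by
      rw [hML, map_prod, norm_prod]
      calc _ ≤ ∏ p ∈ (Finset.univ : Finset (Fin 4)).offDiag, (2 * B) ^ 2 := by
            refine Finset.prod_le_prod (fun _ _ => norm_nonneg _) fun p _ => ?_
            rw [map_mul, map_sub, map_add, norm_mul, sq]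
            refine mul_le_mul ?_ ?_ (norm_nonneg _) ?_
            · linarith [norm_sub_le (φ (S.x p.1)) (φ (S.x p.2)), hB p.1, hB p.2]
            · linarith [norm_add_le (φ (S.x p.1)) (φ (S.x p.2)), hB p.1, hB p.2]
            · linarith [norm_nonneg (φ (S.x 0)), hB 0]
        _ = _ := by
            rw [Finset.prod_const, ← pow_mul]
            rfl
    rw [h1]
    exact h2

end QuarticSetup

variable {K L F : Type*} [Field K] [Field L] [Field F] [NumberField K] [NumberField L]
  [NumberField F]

theorem exists_quarticSetup_isBad [IsGalois ℚ L] [Algebra K L] [Algebra F L]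
    (hK4 : Module.finrank ℚ K = 4)
    {τ : Fin 4 ≃ (K →ₐ[ℚ] L)} {e : (L ≃ₐ[ℚ] L) ≃* Equiv.Perm (Fin 4)}
    (hτ : ∀ σ i a, τ (e σ i) a = σ (τ i a)) (hK : ∀ a, algebraMap K L a = τ 0 a)
    (hF : ∀ a : L, a ∈ Set.range (algebraMap F L) ↔ ∀ σ, PreservesPairing (e σ) → σ a = a) :
    ∃ (S : QuarticSetup K L F) (N : ℕ), S.IsBad N ∧
      (N : ℝ) ≤ (288 * |(discr K : ℝ)|) ^ 24 := by
  obtain ⟨ξ, hξ, hle⟩ := NumberField.exists_primitive_element_le K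
  obtain ⟨S, hS⟩ := exists_quarticSetup hτ hK hF hξ
  obtain ⟨φ⟩ : Nonempty (L →+* ℂ) := inferInstance
  have h1 : ∀ i, ‖φ (τ i ξ)‖ ≤ 18 * |(discr K : ℝ)| := by
    intro i
    have := hle (InfinitePlace.mk (φ.comp (τ i : K →+* L)))
    rw [InfinitePlace.apply, hK4] at this
    norm_num at this
    exact this
  obtain ⟨N, hN, hNB⟩ := S.exists_isBad φ (B := 144 * |(discr K : ℝ)|) fun i => by
    rw [hS, map_sub, map_mul, map_sum, map_ofNat, Fin.sum_univ_four]
    refine (norm_sub_le _ _).trans ?_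
    rw [norm_mul, RCLike.norm_ofNat]
    have h2 : ‖φ (τ 0 ξ) + φ (τ 1 ξ) + φ (τ 2 ξ) + φ (τ 3 ξ)‖ ≤ _ := norm_add₄_le
    linarith [h1 0, h1 1, h1 2, h1 3, h1 i]
  refine ⟨S, N, hN, hNB.trans (le_of_eq ?_)⟩
  ring

end

theorem Rat.card_classGroup_two_torsion :
    Nat.card {c : ClassGroup (𝓞 ℚ) // c ^ 2 = 1} = 1 := by
  have h1 : Nat.card (ClassGroup (𝓞 ℚ)) = 1 := by
    rw [Nat.card_eq_fintype_card]; exact Rat.classNumber_eq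
  have := (Nat.card_eq_one_iff_unique.mp h1).1
  rw [Nat.card_eq_one_iff_unique]
  exact ⟨inferInstance, ⟨1, by simp⟩⟩

namespace QuarticSetup

variable {K L F : Type*} [Field K] [Field L] [Field F] [NumberField K] [NumberField L]
  [NumberField F] [Algebra K L] [Algebra F L] {S : QuarticSetup K L F} {N : ℕ} (hN : S.IsBad N)

include hN

theorem card_left_le_mul_card_right [IsGalois ℚ L] (hF : Module.finrank ℚ F = 3)
    (hL : Nat.card (L ≃ₐ[ℚ] L) = 24) :
    Nat.card {c : ClassGroup (𝓞 K) // c ^ 2 = 1} ≤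
      2 ^ 605 * 256 ^ N.primeFactors.card * Nat.card {c : ClassGroup (𝓞 F) // c ^ 2 = 1} := by
  refine (NumberField.card_classGroup_two_torsion_le K (colorable_evenAway_left hN)).trans ?_
  rw [Rat.card_classGroup_two_torsion, Module.finrank_self, hF, hL]
  generalize Nat.card {c : ClassGroup (𝓞 F) // c ^ 2 = 1} = f
  generalize N.primeFactors.card = w
  rw [show (2 : ℕ) ^ 605 = 2 ^ (24 * 24) * 2 ^ 29 by rw [← pow_add]]
  generalize 2 ^ (24 * 24) = A
  calc _ = A * 2 ^ 29 * 32 ^ w * f := by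
        rw [show 32 = 2 ^ 5 by norm_num, ← pow_mul]
        ring
    _ ≤ _ := by
        gcongr
        norm_num

theorem card_right_le_mul_card_left [IsGalois ℚ L] (hK : Module.finrank ℚ K = 4)
    (hF : Module.finrank ℚ F = 3) (hL : Nat.card (L ≃ₐ[ℚ] L) = 24) :
    Nat.card {c : ClassGroup (𝓞 F) // c ^ 2 = 1} ≤
      2 ^ 605 * 256 ^ N.primeFactors.card * Nat.card {c : ClassGroup (𝓞 K) // c ^ 2 = 1} := by
  refine (card_classGroup_right_le hN hF).trans ?_
  have : IsGalois F L := IsGalois.tower_top_of_isGalois ℚ F L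
  have h8 : Nat.card (L ≃ₐ[F] L) = 8 := by
    have h := Module.finrank_mul_finrank ℚ F L
    rw [← IsGalois.card_aut_eq_finrank ℚ L, hL, hF] at h
    rw [IsGalois.card_aut_eq_finrank]
    omega
  rw [Rat.card_classGroup_two_torsion, Module.finrank_self, hF, hK, h8]
  generalize Nat.card {c : ClassGroup (𝓞 K) // c ^ 2 = 1} = k
  generalize N.primeFactors.card = w
  calc _ = 2 ^ 19 * 256 ^ w * k := by
        rw [show 256 = 2 ^ 8 by norm_num, ← pow_mul]
        ring
    _ ≤ _ := by
        gcongr <;> norm_num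

end QuarticSetup

/-- Lemma 6.1: for a quartic field `K` whose Galois closure `L/ℚ` has Galois group of
order 24 (so `Gal(L/ℚ) ≅ S₄`), and `F` the cubic resolvent of `K` (the fixed field of a
subgroup `P ≤ Gal(L/ℚ)` of order 8), the 2-torsion of the class groups of `K` and of `F`
agree up to a factor `O_ε(|D_K|^ε)`. -/
theorem quartic_cubic_resolvent_two_torsion_transfer (ε : ℝ) (hε : 0 < ε) :
    ∃ C : ℝ, 1 ≤ C ∧
      ∀ (K L F : Type) [Field K] [Field L] [Field F]
        [NumberField K] [NumberField L] [NumberField F],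
        Module.finrank ℚ K = 4 →
        IsGalois ℚ L →
        (K →ₐ[ℚ] L) →
        IntermediateField.normalClosure ℚ K L = ⊤ →
        Nat.card (L ≃ₐ[ℚ] L) = 24 →
        ∀ P : Subgroup (L ≃ₐ[ℚ] L), Nat.card P = 8 →
        ∀ fF : F →ₐ[ℚ] L, fF.fieldRange = IntermediateField.fixedField P →
        Module.finrank ℚ F = 3 →
        C⁻¹ * |(NumberField.discr K : ℝ)| ^ (-ε)
            ≤ (Nat.card {c : ClassGroup (𝓞 K) // c ^ 2 = 1} : ℝ)
              / (Nat.card {c : ClassGroup (𝓞 F) // c ^ 2 = 1} : ℝ) ∧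
          (Nat.card {c : ClassGroup (𝓞 K) // c ^ 2 = 1} : ℝ)
              / (Nat.card {c : ClassGroup (𝓞 F) // c ^ 2 = 1} : ℝ)
            ≤ C * |(NumberField.discr K : ℝ)| ^ ε := by
  obtain ⟨C₁, hC₁, hpow⟩ :=
    exists_pow_card_primeFactors_le 256 (by norm_num) (ε / 24) (by positivity)
  have hB : (1 : ℝ) ≤ (288 ^ 24) ^ (ε / 24) := Real.one_le_rpow (by norm_num) (by positivity)
  have hA : (1 : ℝ) ≤ 2 ^ 605 := one_le_pow₀ one_le_two
  generalize hAB : (2 : ℝ) ^ 605 = A at hA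
  refine ⟨A * (C₁ * (288 ^ 24) ^ (ε / 24)),
    one_le_mul_of_one_le_of_one_le hA (one_le_mul_of_one_le_of_one_le hC₁ hB), ?_⟩
  intro K L F _ _ _ _ _ _ hK hL f hcl hcard P hP fF hfF hF
  obtain ⟨τ, e, hτ, he⟩ := exists_labelling hK f hcl hcard hP
  let _ : Algebra K L := (τ 0).toRingHom.toAlgebra
  let _ : Algebra F L := fF.toRingHom.toAlgebra
  obtain ⟨S, N, hN, hNle⟩ := exists_quarticSetup_isBad (F := F) hK hτ (fun _ => rfl) fun a => by
    have h1 : a ∈ Set.range (algebraMap F L) ↔ a ∈ fF.fieldRange := Iff.rfl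
    rw [h1, hfF, IntermediateField.mem_fixedField_iff]
    simp_rw [he]
  have hk := QuarticSetup.card_left_le_mul_card_right hN hF hcard
  have hf := QuarticSetup.card_right_le_mul_card_left hN hK hF hcard
  have hk0 : 0 < Nat.card {c : ClassGroup (𝓞 K) // c ^ 2 = 1} :=
    Nat.card_pos_iff.mpr ⟨⟨1, one_pow 2⟩, inferInstance⟩
  have hf0 : 0 < Nat.card {c : ClassGroup (𝓞 F) // c ^ 2 = 1} :=
    Nat.card_pos_iff.mpr ⟨⟨1, one_pow 2⟩, inferInstance⟩
  generalize Nat.card {c : ClassGroup (𝓞 K) // c ^ 2 = 1} = k at *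
  generalize Nat.card {c : ClassGroup (𝓞 F) // c ^ 2 = 1} = f at *
  have hD : 0 < |(discr K : ℝ)| := by
    rw [abs_pos]
    exact_mod_cast discr_ne_zero K
  generalize |(discr K : ℝ)| = D at *
  have hω : (256 : ℝ) ^ N.primeFactors.card ≤ C₁ * (288 ^ 24) ^ (ε / 24) * D ^ ε := by
    have h1 : (N : ℝ) ^ (ε / 24) ≤ (288 ^ 24) ^ (ε / 24) * D ^ ε := by
      calc (N : ℝ) ^ (ε / 24) ≤ (288 ^ 24 * D ^ 24) ^ (ε / 24) :=
            Real.rpow_le_rpow (Nat.cast_nonneg N) (hNle.trans_eq (by ring)) (by positivity)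
        _ = _ := by
            rw [Real.mul_rpow (by positivity) (by positivity), ← Real.rpow_natCast D,
              ← Real.rpow_mul hD.le]
            congr 2
            push_cast
            ring
    calc _ ≤ C₁ * (N : ℝ) ^ (ε / 24) := hpow N hN.ne_zero
      _ ≤ C₁ * ((288 ^ 24) ^ (ε / 24) * D ^ ε) := by gcongr
      _ = _ := by ring
  have key : ∀ a b : ℕ, a ≤ 2 ^ 605 * 256 ^ N.primeFactors.card * b →
      (a : ℝ) ≤ A * (C₁ * (288 ^ 24) ^ (ε / 24)) * D ^ ε * b := by
    intro a b h
    have h1 : (a : ℝ) ≤ A * 256 ^ N.primeFactors.card * b := by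
      rw [← hAB]
      exact_mod_cast h
    refine h1.trans ?_
    rw [mul_assoc A (C₁ * _)]
    gcongr
  have hk0' : (0 : ℝ) < k := by exact_mod_cast hk0
  have hf0' : (0 : ℝ) < f := by exact_mod_cast hf0
  have hDε : 0 < D ^ ε := Real.rpow_pos_of_pos hD ε
  constructor
  · rw [Real.rpow_neg hD.le, ← mul_inv, le_div_iff₀ hf0', inv_mul_le_iff₀ (by positivity)]
    exact key f k hf
  · rw [div_le_iff₀ hf0']
    exact key k f hk
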